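/- For each positive integer i there is an injective group homomorphism ε̃_i : B_{4,2} → G̃_i satisfying ε̃_i(X) = x and ε̃_i(Y) = y. -/

import Mathlib

/-!
Common setup: the commutator convention `[a,b] = a⁻¹b⁻¹ab` of the paper, the sequence
`x₀ = x`, `x_{i+1} = [yxy, x_i]`, the Laurent polynomial ring `R = 𝔽₂[t,t⁻¹]`, and the
images `X`, `Y` of `σ₁σ₂σ₃` and `σ₁σ₂σ₃σ₁` in `GL(3, R)` under the mod-2 reduced Burau
representation of the 4-strand braid group.
-/

open Matrix LaurentPolynomial

noncomputable section

set_option maxRecDepth 100000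

/-- The paper's commutator convention: `[a,b] = a⁻¹b⁻¹ab`. -/
def br {G : Type*} [Group G] (a b : G) : G := a⁻¹ * b⁻¹ * a * b

/-- The recursively defined elements `x₀ = x`, `x_{i+1} = [yxy, x_i]`. -/
def xseq {G : Type*} [Group G] (x y : G) : ℕ → G
  | 0 => x
  | n + 1 => br (y * x * y) (xseq x y n)

/-- `R = 𝔽₂[t,t⁻¹]`, the ring of Laurent polynomials over the field with two elements. -/
abbrev R2 : Type := LaurentPolynomial (ZMod 2)

instance : CharP R2 2 := charP_of_injective_algebraMap (algebraMap (ZMod 2) R2).injective 2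

/-- The matrix `X = t·!![0,0,1; 1,0,1; 0,1,1]`. -/
def Xmat : Matrix (Fin 3) (Fin 3) R2 := (T 1 : R2) • !![0,0,1; 1,0,1; 0,1,1]

/-- The matrix `Y = t·!![0,0,1; t,1,1; 0,1,1]`. -/
def Ymat : Matrix (Fin 3) (Fin 3) R2 := (T 1 : R2) • !![0,0,1; T 1,1,1; 0,1,1]

/-- An explicit inverse for `Xmat`. -/
def Xmatinv : Matrix (Fin 3) (Fin 3) R2 := (T (-1) : R2) • !![1,1,0; 1,0,1; 1,0,0]

/-- An explicit inverse for `Ymat`. -/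
def Ymatinv : Matrix (Fin 3) (Fin 3) R2 := (T (-2) : R2) • !![0,1,1; T 1,0,T 1; T 1,0,0]

lemma Xmat_mul_Xmatinv : Xmat * Xmatinv = 1 := by
  rw [Xmat, Xmatinv, Matrix.smul_mul, Matrix.mul_smul, smul_smul, ← T_add]
  simp only [Matrix.mul_fin_three, mul_zero, zero_mul, mul_one, one_mul, add_zero, zero_add,
    ← T_add, CharTwo.add_self_eq_zero]
  rw [Matrix.one_fin_three]
  simp only [Matrix.smul_of, Matrix.smul_cons, smul_eq_mul, Matrix.smul_empty, ← T_add,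
    mul_zero, mul_one]
  norm_num [T_zero]

lemma Xmatinv_mul_Xmat : Xmatinv * Xmat = 1 := by
  rw [Xmat, Xmatinv, Matrix.smul_mul, Matrix.mul_smul, smul_smul, ← T_add]
  simp only [Matrix.mul_fin_three, mul_zero, zero_mul, mul_one, one_mul, add_zero, zero_add,
    ← T_add, CharTwo.add_self_eq_zero]
  rw [Matrix.one_fin_three]
  simp only [Matrix.smul_of, Matrix.smul_cons, smul_eq_mul, Matrix.smul_empty, ← T_add,
    mul_zero, mul_one]
  norm_num [T_zero]

lemma Ymat_mul_Ymatinv : Ymat * Ymatinv = 1 := by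
  rw [Ymat, Ymatinv, Matrix.smul_mul, Matrix.mul_smul, smul_smul, ← T_add]
  simp only [Matrix.mul_fin_three, mul_zero, zero_mul, mul_one, one_mul, add_zero, zero_add,
    ← T_add, CharTwo.add_self_eq_zero]
  rw [Matrix.one_fin_three]
  simp only [Matrix.smul_of, Matrix.smul_cons, smul_eq_mul, Matrix.smul_empty, ← T_add,
    mul_zero, mul_one]
  norm_num [T_zero]

lemma Ymatinv_mul_Ymat : Ymatinv * Ymat = 1 := by
  rw [Ymat, Ymatinv, Matrix.mul_smul, Matrix.smul_mul, smul_smul, ← T_add]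
  simp only [Matrix.mul_fin_three, mul_zero, zero_mul, mul_one, one_mul, add_zero, zero_add,
    ← T_add, CharTwo.add_self_eq_zero]
  rw [Matrix.one_fin_three]
  simp only [Matrix.smul_of, Matrix.smul_cons, smul_eq_mul, Matrix.smul_empty, ← T_add,
    mul_zero, mul_one]
  norm_num [T_zero]

/-- `X ∈ GL(3, 𝔽₂[t,t⁻¹])`, the mod-2 reduced Burau image of `σ₁σ₂σ₃`. -/
def X : GL (Fin 3) R2 := ⟨Xmat, Xmatinv, Xmat_mul_Xmatinv, Xmatinv_mul_Xmat⟩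

/-- `Y ∈ GL(3, 𝔽₂[t,t⁻¹])`, the mod-2 reduced Burau image of `σ₁σ₂σ₃σ₁`. -/
def Y : GL (Fin 3) R2 := ⟨Ymat, Ymatinv, Ymat_mul_Ymatinv, Ymatinv_mul_Ymat⟩

/-- `B_{4,2}`, the image of the mod-2 reduced Burau representation: the subgroup of
`GL(3,R)` generated by `X` and `Y`. -/
abbrev B42 : Subgroup (GL (Fin 3) R2) := Subgroup.closure {X, Y}

/-- The generator `x` of the free group on `x, y, t`. -/
def gx : FreeGroup (Fin 3) := FreeGroup.of 0

/-- The generator `y` of the free group on `x, y, t`. -/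
def gy : FreeGroup (Fin 3) := FreeGroup.of 1

/-- The generator `t` of the free group on `x, y, t`. -/
def gT : FreeGroup (Fin 3) := FreeGroup.of 2

/-- The relators of `G̃_i = ⟨x,y,t | x⁴ = y³, [x²,yxy] = 1, x_j⁴ = 1 = [x_j², yxy]
(1 ≤ j ≤ i), [t,yxy] = 1 = [t,x⁴], t·x_i·t⁻¹ = [yxy,x_i]⟩`. -/
def GtiRels (i : ℕ) : Set (FreeGroup (Fin 3)) :=
  {gx ^ 4 * (gy ^ 3)⁻¹, br (gx ^ 2) (gy * gx * gy), br gT (gy * gx * gy), br gT (gx ^ 4),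
      gT * xseq gx gy i * gT⁻¹ * (br (gy * gx * gy) (xseq gx gy i))⁻¹} ∪
    {r | ∃ j : ℕ, 1 ≤ j ∧ j ≤ i ∧ r = xseq gx gy j ^ 4} ∪
    {r | ∃ j : ℕ, 1 ≤ j ∧ j ≤ i ∧ r = br (xseq gx gy j ^ 2) (gy * gx * gy)}

namespace BB
open scoped Pointwise
open Polynomial (toLaurent)

lemma two0 : (2 : R2) = 0 := by
  have := CharP.cast_eq_zero R2 2
  exact_mod_cast this

lemma add_self (a : R2) : a + a = 0 := CharTwo.add_self_eq_zero a

/-- `p ∈ t^n F₂[t]` -/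
def IsP (n : ℤ) (p : R2) : Prop := ∃ q : Polynomial (ZMod 2), p = T n * toLaurent q

lemma IsP.zero (n) : IsP n 0 := ⟨0, by simp⟩
lemma IsP.add {n p q} (h : IsP n p) (h' : IsP n q) : IsP n (p + q) := by
  obtain ⟨a, rfl⟩ := h; obtain ⟨b, rfl⟩ := h'
  exact ⟨a + b, by rw [map_add, mul_add]⟩
lemma IsP.mul {n m p q} (h : IsP n p) (h' : IsP m q) : IsP (n + m) (p * q) := by
  obtain ⟨a, rfl⟩ := h; obtain ⟨b, rfl⟩ := h'
  exact ⟨a * b, by rw [map_mul, T_add]; ring⟩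
lemma IsP.T (n) : IsP n (T n) := ⟨1, by simp⟩
lemma IsP.mono {n m p} (h : IsP n p) (hm : m ≤ n) : IsP m p := by
  obtain ⟨a, rfl⟩ := h
  obtain ⟨k, rfl⟩ := Int.le.dest hm
  exact ⟨Polynomial.X ^ k * a, by rw [map_mul, Polynomial.toLaurent_X_pow, T_add]; ring⟩
lemma IsP.T' {n k} (h : n ≤ k) : IsP n (LaurentPolynomial.T k) := (IsP.T k).mono h
lemma IsP.one {n} (h : n ≤ 0) : IsP n 1 := by
  have := IsP.T' h; rwa [T_zero] at this
lemma isP_T_mul {n k p} : IsP n (LaurentPolynomial.T k * p) ↔ IsP (n - k) p := by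
  constructor
  · intro h
    have := (IsP.T (-k)).mul h
    rw [← mul_assoc, ← T_add] at this
    simpa [T_zero, sub_eq_add_neg, add_comm] using this
  · intro h
    have := (IsP.T k).mul h
    simpa using this
lemma IsP.mulS {n p q} (h : IsP 0 p) (h' : IsP n q) : IsP n (p * q) := by
  simpa using h.mul h'
lemma IsP.exists (p) : ∃ n, IsP n p := by
  obtain ⟨n, f, h⟩ := exists_T_pow p
  refine ⟨-n, f, ?_⟩
  rw [h, mul_comm, mul_assoc, ← T_add]; simp [T_zero]
lemma IsP.dec {n p} (h : IsP n p) : IsP (n + 1) p ∨ IsP (n + 1) (p + LaurentPolynomial.T n) := by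
  obtain ⟨a, rfl⟩ := h
  have h1 := Polynomial.X_mul_divX_add a
  have h2 : ∀ c : ZMod 2, c = 0 ∨ c = 1 := by decide
  rcases h2 (a.coeff 0) with h0 | h0
  · left
    rw [h0] at h1
    rw [← h1]
    exact ⟨a.divX, by rw [T_add, map_add, map_mul, Polynomial.toLaurent_X, map_zero, map_zero]; ring⟩
  · right
    rw [h0] at h1
    rw [← h1]
    refine ⟨a.divX, ?_⟩
    rw [T_add, map_add, map_mul, Polynomial.toLaurent_X, map_one, map_one]
    linear_combination (LaurentPolynomial.T n : R2) * two0
lemma not_isP_T {n k : ℤ} (h : n < k) : ¬ IsP k (LaurentPolynomial.T n : R2) := by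
  intro h1
  have h2 : IsP (n + 1) (LaurentPolynomial.T n : R2) := h1.mono h
  obtain ⟨q, hq⟩ := h2
  have h3 : (1 : R2) = T 1 * toLaurent q := by
    have := congrArg (fun z => (T (-n) : R2) * z) hq
    simp only [← mul_assoc, ← T_add] at this
    simpa [T_zero] using this
  rw [← Polynomial.toLaurent_X, ← map_mul, ← Polynomial.toLaurent_one, Polynomial.toLaurent_inj] at h3
  have := congrArg (Polynomial.eval 0) h3
  simp at this
lemma isP_T_iff {n k : ℤ} : IsP k (LaurentPolynomial.T n : R2) ↔ k ≤ n :=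
  ⟨fun h => by by_contra h'; exact not_isP_T (by omega) h, fun h => IsP.T' h⟩
lemma not_isP_one : ¬ IsP 1 1 := by
  have := @not_isP_T 0 1 (by norm_num); rwa [T_zero] at this
lemma IsP.add_iff {n p q} (h : IsP n p) : IsP n (p + q) ↔ IsP n q := by
  refine ⟨fun h' => ?_, fun h' => h.add h'⟩
  have := h.add h'
  rwa [← add_assoc, add_self, zero_add] at this
lemma IsP.add_iff' {n p q} (h : IsP n p) : IsP n (q + p) ↔ IsP n q := by
  rw [add_comm]; exact h.add_iff

/-- constant in both directions -/
lemma const_of {p : R2} (h : IsP 0 p) (h' : IsP 0 (invert p)) : p = 0 ∨ p = 1 := by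
  have h2 : ∀ c : ZMod 2, c = 0 ∨ c = 1 := by decide
  have key : ∀ q, IsP 0 q → ∀ k < 0, q.coeff k = 0 := by
    rintro q ⟨a, rfl⟩ k hk
    rw [T_zero, one_mul, LaurentPolynomial.coeff_toLaurent]
    apply Finsupp.mapDomain_of_notMem_range
    rintro ⟨m, hm⟩
    simp at hm; omega
  have e : p = C (p.coeff 0) := by
    apply LaurentPolynomial.ext
    intro k
    rw [C_apply]
    rcases lt_trichotomy k 0 with hk | hk | hk
    · rw [if_neg hk.ne, key p h k hk]
    · simp [hk]
    · rw [if_neg hk.ne']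
      have := key _ h' (-k) (by omega)
      rwa [invert_apply, neg_neg] at this
  rcases h2 (p.coeff 0) with h0 | h0
  · left; rw [e, h0, map_zero]
  · right; rw [e, h0, map_one]

/-- induction on Laurent polynomials over F_2 -/
lemma ind {motive : R2 → Prop} (h0 : motive 0) (hT : ∀ n, motive (T n))
    (ha : ∀ p q, motive p → motive q → motive (p + q)) (p) : motive p := by
  have h2 : ∀ c : ZMod 2, c = 0 ∨ c = 1 := by decide
  refine LaurentPolynomial.induction_on' p ha ?_
  intro n a
  rcases h2 a with rfl | rfl
  · simpa using h0
  · simpa using hT n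

lemma TT (n m : ℤ) : (T n * T m : R2) = T (n + m) := (T_add n m).symm
lemma T_inv (n : ℤ) : (T n * T (-n) : R2) = 1 := by rw [TT]; simp [T_zero]
lemma T_inv' (n : ℤ) : (T (-n) * T n : R2) = 1 := by rw [TT]; simp [T_zero]

lemma lam_ne : (1 + T 1 : R2) ≠ 0 := by
  intro h
  have : IsP 1 (1 + T 1 : R2) := h ▸ IsP.zero 1
  rw [(IsP.T 1).add_iff'] at this
  exact not_isP_one this

instance : IsDomain R2 := inferInstance

end BB

namespace BB
open scoped Pointwise

abbrev V := R2 × R2 × R2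

/-- standard lattice -/
def L0 : AddSubgroup V where
  carrier := {v | IsP 0 v.1 ∧ IsP 0 v.2.1 ∧ IsP 0 v.2.2}
  zero_mem' := ⟨IsP.zero _, IsP.zero _, IsP.zero _⟩
  add_mem' := fun h h' => ⟨h.1.add h'.1, h.2.1.add h'.2.1, h.2.2.add h'.2.2⟩
  neg_mem' := fun {v} h => by
    have : -v = v := by ext1 <;> [skip; ext1] <;> exact CharTwo.neg_eq _
    rw [this]; exact h

lemma neg_V (v : V) : -v = v := by ext1 <;> [skip; ext1] <;> exact CharTwo.neg_eq _
lemma add_self_V (v : V) : v + v = 0 := by nth_rw 2 [← neg_V v]; exact add_neg_cancel v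

lemma mem_L0 {p q r : R2} : (p, q, r) ∈ L0 ↔ IsP 0 p ∧ IsP 0 q ∧ IsP 0 r := Iff.rfl

def Tst (M : AddSubgroup V) : Prop := ∀ v ∈ M, (T 1 : R2) • v ∈ M

structure Cov (M M' : AddSubgroup V) : Prop where
  le : M ≤ M'
  tl : ∀ v ∈ M', (T 1 : R2) • v ∈ M
  ex : ∃ v ∈ M', v ∉ M ∧ ∀ u ∈ M', u ∈ M ∨ u + v ∈ M

lemma Cov.tst {M M'} (h : Cov M M') : Tst M := fun v hv => h.tl v (h.le hv)
lemma Cov.tst' {M M'} (h : Cov M M') : Tst M' := fun v hv => h.le (h.tl v hv)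

lemma Cov.any {M M'} (h : Cov M M') {v} (hv : v ∈ M') (hv' : v ∉ M) {u} (hu : u ∈ M') :
    u ∈ M ∨ u + v ∈ M := by
  obtain ⟨a, ha, ha', H⟩ := h.ex
  rcases H u hu with h1 | h1
  · exact Or.inl h1
  · rcases H v hv with h2 | h2
    · exact absurd h2 hv'
    · right
      have := M.add_mem h1 h2
      have e : u + a + (v + a) = u + v + (a + a) := by abel
      rwa [e, add_self_V, add_zero] at this

lemma Cov.squeeze {M M' K} (h : Cov M M') (h1 : M ≤ K) (h2 : K ≤ M') : K = M ∨ K = M' := by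
  by_cases hK : K ≤ M
  · left; exact le_antisymm hK h1
  · right
    obtain ⟨v, hv, hv'⟩ := SetLike.not_le_iff_exists.1 hK
    refine le_antisymm h2 fun u hu => ?_
    rcases h.any (h2 hv) hv' hu with h3 | h3
    · exact h1 h3
    · have := K.add_mem (h1 h3) hv
      rwa [add_assoc, add_self_V, add_zero] at this

lemma Cov.ne {M M'} (h : Cov M M') : M ≠ M' := by
  rintro rfl
  obtain ⟨v, hv, hv', -⟩ := h.ex
  exact hv' hv

lemma Cov.sup {M M1 M2} (h1 : Cov M M1) (h2 : Cov M M2) (hne : M1 ≠ M2) : Cov M1 (M1 ⊔ M2) := by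
  refine ⟨le_sup_left, ?_, ?_⟩
  · intro v hv
    obtain ⟨a, ha, b, hb, rfl⟩ := AddSubgroup.mem_sup.1 hv
    rw [smul_add]
    exact h1.le (M.add_mem (h1.tl a ha) (h2.tl b hb))
  · obtain ⟨b, hb, hb', H⟩ := h2.ex
    refine ⟨b, le_sup_right (a := M1) hb, ?_, ?_⟩
    · intro hb1
      have h21 : M2 ≤ M1 := by
        intro u hu
        rcases H u hu with h3 | h3
        · exact h1.le h3
        · have := M1.add_mem (h1.le h3) hb1
          rwa [add_assoc, add_self_V, add_zero] at this
      rcases h1.squeeze h2.le h21 with h | h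
      · exact h2.ne h.symm
      · exact hne h.symm
    · intro u hu
      obtain ⟨a, ha, c, hc, rfl⟩ := AddSubgroup.mem_sup.1 hu
      rcases H c hc with h3 | h3
      · left; exact M1.add_mem ha (h1.le h3)
      · right; rw [add_assoc]; exact M1.add_mem ha (h1.le h3)

lemma Cov.sup_tl {M M1 M2} (h1 : Cov M M1) (h2 : Cov M M2) : ∀ v ∈ M1 ⊔ M2, (T 1 : R2) • v ∈ M := by
  intro v hv
  obtain ⟨a, ha, b, hb, rfl⟩ := AddSubgroup.mem_sup.1 hv
  rw [smul_add]
  exact M.add_mem (h1.tl a ha) (h2.tl b hb)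

lemma Cov.inf {M M1 M2} (h1 : Cov M M1) (h2 : Cov M M2) (hne : M1 ≠ M2) : M = M1 ⊓ M2 := by
  rcases h1.squeeze (le_inf h1.le h2.le) inf_le_left with h | h
  · exact h.symm
  · exfalso
    have h12 : M1 ≤ M2 := inf_eq_left.1 h
    rcases h2.squeeze h1.le h12 with h | h
    · exact h1.ne h.symm
    · exact hne h

lemma Tst.T {M} (h : Tst M) {v} (hv : v ∈ M) (n : ℕ) : (T (n : ℤ) : R2) • v ∈ M := by
  induction n with
  | zero => simpa [T_zero] using hv
  | succ n ih =>
    have := h _ ih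
    rwa [smul_smul, TT, add_comm] at this

lemma Tst.Tz {M} (h : Tst M) {v} (hv : v ∈ M) {n : ℤ} (hn : 0 ≤ n) : (LaurentPolynomial.T n : R2) • v ∈ M := by
  obtain ⟨k, rfl⟩ := Int.eq_ofNat_of_zero_le hn
  exact h.T hv k

lemma Tst.smul {M} (h : Tst M) {v} (hv : v ∈ M) {p} (hp : IsP 0 p) : p • v ∈ M := by
  obtain ⟨q, rfl⟩ := hp
  rw [T_zero, one_mul]
  have h2 : ∀ c : ZMod 2, c = 0 ∨ c = 1 := by decide
  induction q using Polynomial.induction_on' with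
  | add p q h1 h2 => rw [map_add, add_smul]; exact M.add_mem h1 h2
  | monomial n a =>
    rcases h2 a with rfl | rfl
    · simp
    · rw [Polynomial.monomial_one_right_eq_X_pow, Polynomial.toLaurent_X_pow]
      exact h.T hv n

lemma Tst.isP {M} (h : Tst M) {v : V} {n} (hv : (LaurentPolynomial.T n : R2) • v ∈ M) {p} (hp : IsP n p) : p • v ∈ M := by
  obtain ⟨q, rfl⟩ := hp
  rw [mul_comm, mul_smul]
  exact h.smul hv ⟨q, by rw [T_zero, one_mul]⟩

/-- Fractional ideals -/
lemma ideal (I : Set R2) (hadd : ∀ a ∈ I, ∀ b ∈ I, a + b ∈ I)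
    (hT : ∀ a ∈ I, ∀ p, IsP 0 p → p * a ∈ I)
    (hn : ∃ n, T n ∈ I) (hb : ∃ m, ∀ a ∈ I, IsP m a) : ∃ β, ∀ p, p ∈ I ↔ IsP β p := by
  obtain ⟨m, hm⟩ := hb
  obtain ⟨β, hβ, hmin⟩ := Int.exists_least_of_bdd (P := fun n => T n ∈ I)
    ⟨m, fun z hz => isP_T_iff.1 (hm _ hz)⟩ hn
  have hsub : ∀ p, IsP β p → p ∈ I := by
    rintro p ⟨q, rfl⟩
    rw [mul_comm]
    exact hT _ hβ _ ⟨q, by rw [T_zero, one_mul]⟩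
  refine ⟨β, fun p => ⟨fun hp => ?_, hsub p⟩⟩
  have key : ∀ k : ℕ, m + k ≤ β → IsP (m + k) p := by
    intro k
    induction k with
    | zero => intro _; simpa using hm p hp
    | succ k ih =>
      intro hk
      push_cast at hk
      have h1 := ih (by omega)
      rcases h1.dec with h2 | h2
      · push_cast; rwa [← add_assoc]
      · exfalso
        have h3 : IsP β (T (β - 1 - (m + k)) * (p + T (m + k))) := by
          rw [isP_T_mul]; convert h2 using 1; ring
        have h4 : T (β - 1 - (m + k)) * p ∈ I := hT _ hp _ (IsP.T' (by omega))
        have h5 := hadd _ (hsub _ h3) _ h4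
        have h6 : (T (β - 1 - (m + k)) * (p + T (m + k)) + T (β - 1 - (m + k)) * p : R2) = T (β - 1) := by
          rw [mul_add, TT]
          have : β - 1 - (m + k) + (m + k) = β - 1 := by ring
          rw [this]
          linear_combination (T (β - 1 - (m + ↑k)) * p : R2) * two0
        rw [h6] at h5
        have := hmin _ h5
        omega
  have hmb : m ≤ β := isP_T_iff.1 (hm _ hβ)
  have := key (β - m).toNat (by omega)
  convert this using 1; omega

/-- constant term -/
def ct (p : R2) : ZMod 2 := by classical exact if IsP 1 p then 0 else 1

lemma ct_zero_iff (p) : ct p = 0 ↔ IsP 1 p := by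
  unfold ct; split_ifs with h <;> simp [h]

lemma ct_spec {p} (h : IsP 0 p) : IsP 1 (p + C (ct p)) := by
  unfold ct
  split_ifs with h1
  · simpa using h1
  · have := h.dec
    simp only [zero_add, T_zero] at this
    simpa using this.resolve_left h1

lemma isP_C (c : ZMod 2) : IsP 0 (C c : R2) := ⟨Polynomial.C c, by simp [T_zero]⟩

lemma ct_unique {p c} (h : IsP 1 (p + C c)) : ct p = c := by
  have h2 : ∀ c : ZMod 2, c = 0 ∨ c = 1 := by decide
  rcases h2 c with rfl | rfl
  · rw [ct_zero_iff]; simpa using h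
  · have : ct p ≠ 0 := by
      rw [Ne, ct_zero_iff]
      intro h'
      rw [h'.add_iff, map_one] at h
      exact not_isP_one h
    exact (h2 _).resolve_left this

lemma ct_add {p q} (hp : IsP 0 p) (hq : IsP 0 q) : ct (p + q) = ct p + ct q := by
  apply ct_unique
  rw [map_add]
  have := (ct_spec hp).add (ct_spec hq)
  convert this using 1; ring

lemma ct_C (c : ZMod 2) : ct (C c) = c := by
  apply ct_unique; rw [add_self]; exact IsP.zero _

lemma ct_one : ct 1 = 1 := by have := ct_C 1; rwa [map_one] at this
lemma ct_zero : ct 0 = 0 := by have := ct_C 0; rwa [map_zero] at this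

end BB

namespace BB
open scoped Pointwise

lemma z2 : ∀ c : ZMod 2, c = 0 ∨ c = 1 := by decide

lemma decomp (p q r : R2) : ((p, q, r) : V) = p • (1, 0, 0) + q • (0, 1, 0) + r • (0, 0, 1) := by
  simp

lemma tL0 {M : AddSubgroup V} (h : ∀ v ∈ L0, (T 1 : R2) • v ∈ M) {p q r} (hp : IsP 1 p) (hq : IsP 1 q)
    (hr : IsP 1 r) : (p, q, r) ∈ M := by
  obtain ⟨a, rfl⟩ := hp
  obtain ⟨b, rfl⟩ := hq
  obtain ⟨c, rfl⟩ := hr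
  exact h (Polynomial.toLaurent a, Polynomial.toLaurent b, Polynomial.toLaurent c)
    ⟨⟨a, by simp [T_zero]⟩, ⟨b, by simp [T_zero]⟩, ⟨c, by simp [T_zero]⟩⟩

lemma mem_const {M : AddSubgroup V} (h : ∀ v ∈ L0, (T 1 : R2) • v ∈ M) {p q r} (hv : (p, q, r) ∈ L0) :
    (p, q, r) ∈ M ↔ (C (ct p), C (ct q), C (ct r)) ∈ M := by
  obtain ⟨hp, hq, hr⟩ := hv
  have := tL0 h (ct_spec hp) (ct_spec hq) (ct_spec hr)
  have e : ((p + C (ct p), q + C (ct q), r + C (ct r)) : V) = (p, q, r) + (C (ct p), C (ct q), C (ct r)) := rfl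
  rw [e] at this
  constructor
  · intro h1; exact (M.add_mem_cancel_left h1).1 this
  · intro h1; exact (M.add_mem_cancel_right h1).1 this

/-- lattice given by functional -/
def IsK (φ : ZMod 2 × ZMod 2 × ZMod 2) (M : AddSubgroup V) : Prop :=
  ∀ p q r, (p, q, r) ∈ M ↔ (p, q, r) ∈ L0 ∧ φ.1 * ct p + φ.2.1 * ct q + φ.2.2 * ct r = 0

def IsN (u : ZMod 2 × ZMod 2 × ZMod 2) (M : AddSubgroup V) : Prop :=
  ∀ p q r, (p, q, r) ∈ M ↔ (p, q, r) ∈ L0 ∧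
    ((ct p, ct q, ct r) = (0 : ZMod 2 × ZMod 2 × ZMod 2) ∨ (ct p, ct q, ct r) = u)

lemma IsK.eq {φ M M'} (h : IsK φ M) (h' : IsK φ M') : M = M' := by
  ext ⟨p, q, r⟩; rw [h, h']
lemma IsN.eq {φ M M'} (h : IsN φ M) (h' : IsN φ M') : M = M' := by
  ext ⟨p, q, r⟩; rw [h, h']

lemma ct_mul_C (c d : ZMod 2) : (c * d = 0) ↔ (c = 0 ∨ d = 0) := mul_eq_zero

lemma memC {c d e} : ((C c, C d, C e) : V) ∈ L0 := ⟨isP_C c, isP_C d, isP_C e⟩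

lemma Cov.functional {M} (h : Cov M L0) : ∃ φ, φ ≠ 0 ∧ IsK φ M := by
  classical
  let χ : V → ZMod 2 := fun v => if v ∈ M then 0 else 1
  have χ0 : ∀ v, χ v = 0 ↔ v ∈ M := by
    intro v; simp only [χ]; split_ifs with h <;> simp [h]
  have χa : ∀ u v, u ∈ L0 → v ∈ L0 → χ (u + v) = χ u + χ v := by
    intro u v hu hv
    by_cases h1 : u ∈ M
    · rw [(χ0 u).2 h1, zero_add]
      simp only [χ, M.add_mem_cancel_left h1]
    · by_cases h2 : v ∈ M
      · rw [(χ0 v).2 h2, add_zero]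
        simp only [χ, M.add_mem_cancel_right h2]
      · have h3 := (h.any hv h2 hu).resolve_left h1
        simp only [χ, if_pos h3, if_neg h1, if_neg h2]
        decide
  have χC : ∀ c d e, χ (C c, C d, C e) = c * χ (1, 0, 0) + d * χ (0, 1, 0) + e * χ (0, 0, 1) := by
    intro c d e
    have e1 : ((C c, C d, C e) : V) = (C c, C 0, C 0) + (C 0, C d, C 0) + (C 0, C 0, C e) := by simp
    have z : χ 0 = 0 := (χ0 0).2 M.zero_mem
    rw [e1, χa _ _ (L0.add_mem memC memC) memC, χa _ _ memC memC]
    congr 1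
    · congr 1
      · rcases z2 c with rfl | rfl
        · simp only [map_zero, zero_mul]; exact z
        · simp only [map_zero, map_one, one_mul]
      · rcases z2 d with rfl | rfl
        · simp only [map_zero, zero_mul]; exact z
        · simp only [map_zero, map_one, one_mul]
    · rcases z2 e with rfl | rfl
      · simp only [map_zero, zero_mul]; exact z
      · simp only [map_zero, map_one, one_mul]
  have K : IsK (χ (1, 0, 0), χ (0, 1, 0), χ (0, 0, 1)) M := by
    intro p q r
    by_cases hv : (p, q, r) ∈ L0
    · rw [mem_const h.tl hv, ← χ0, χC]
      simp [hv, mul_comm]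
    · simp only [hv, false_and, iff_false]
      exact fun h' => hv (h.le h')
  refine ⟨_, ?_, K⟩
  intro h0
  obtain ⟨⟨p, q, r⟩, hv, hv', -⟩ := h.ex
  rw [K, h0] at hv'
  simp [hv] at hv'

lemma IsK.cov {φ M} (hφ : φ ≠ 0) (h : IsK φ M) : Cov M L0 := by
  have h01 : ∃ c : ZMod 2 × ZMod 2 × ZMod 2, φ.1 * c.1 + φ.2.1 * c.2.1 + φ.2.2 * c.2.2 = 1 := by
    clear h
    revert φ; decide
  obtain ⟨⟨a, b, c⟩, hc⟩ := h01
  refine ⟨?_, ?_, (C a, C b, C c), memC, ?_, ?_⟩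
  · rintro ⟨p, q, r⟩ hv; exact ((h _ _ _).1 hv).1
  · rintro ⟨p, q, r⟩ ⟨hp, hq, hr⟩
    have h1 : ∀ {p}, IsP 0 p → IsP 1 (T 1 * p) := fun hp => by rw [isP_T_mul]; simpa using hp
    change (T 1 * p, T 1 * q, T 1 * r) ∈ M
    rw [h, (ct_zero_iff _).2 (h1 hp), (ct_zero_iff _).2 (h1 hq), (ct_zero_iff _).2 (h1 hr)]
    exact ⟨⟨(h1 hp).mono (by norm_num), (h1 hq).mono (by norm_num), (h1 hr).mono (by norm_num)⟩, by simp⟩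
  · rw [h, ct_C, ct_C, ct_C, hc]; simp
  · rintro ⟨p, q, r⟩ hv
    change _ ∨ (p + C a, q + C b, r + C c) ∈ M
    have hv1 : (p + C a, q + C b, r + C c) ∈ L0 := L0.add_mem hv (memC (c := a) (d := b) (e := c))
    rw [h, h, ct_add hv.1 (isP_C a), ct_add hv.2.1 (isP_C b), ct_add hv.2.2 (isP_C c), ct_C, ct_C, ct_C]
    rcases z2 (φ.1 * ct p + φ.2.1 * ct q + φ.2.2 * ct r) with h1 | h1
    · left; exact ⟨hv, h1⟩
    · right; refine ⟨hv1, ?_⟩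
      have : φ.1 * (ct p + a) + φ.2.1 * (ct q + b) + φ.2.2 * (ct r + c) =
        (φ.1 * ct p + φ.2.1 * ct q + φ.2.2 * ct r) + (φ.1 * a + φ.2.1 * b + φ.2.2 * c) := by ring
      rw [this, h1]
      simp only at hc
      rw [hc]; decide

lemma two_functionals : ∀ φ ψ : ZMod 2 × ZMod 2 × ZMod 2, φ ≠ 0 → ψ ≠ 0 → φ ≠ ψ →
    ∃ u : ZMod 2 × ZMod 2 × ZMod 2, u ≠ 0 ∧ ∀ c : ZMod 2 × ZMod 2 × ZMod 2,
      (φ.1 * c.1 + φ.2.1 * c.2.1 + φ.2.2 * c.2.2 = 0 ∧ ψ.1 * c.1 + ψ.2.1 * c.2.1 + ψ.2.2 * c.2.2 = 0) ↔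
        (c = 0 ∨ c = u) := by decide

lemma inf_isN {M M1 M2} (h1 : Cov M1 L0) (h2 : Cov M2 L0) (hne : M1 ≠ M2) (hM : M = M1 ⊓ M2) :
    ∃ u, u ≠ 0 ∧ IsN u M := by
  obtain ⟨φ, hφ, H1⟩ := h1.functional
  obtain ⟨ψ, hψ, H2⟩ := h2.functional
  obtain ⟨u, hu, H⟩ := two_functionals φ ψ hφ hψ (by rintro rfl; exact hne (H1.eq H2))
  refine ⟨u, hu, fun p q r => ?_⟩
  rw [hM, AddSubgroup.mem_inf, H1, H2, ← H]
  tauto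

lemma IsN.mem {u M} (h : IsN u M) : (C u.1, C u.2.1, C u.2.2) ∈ M := by
  rw [h, ct_C, ct_C, ct_C]; exact ⟨memC, Or.inr rfl⟩

lemma IsN.functional {u M M1} (h : IsN u M) (h1 : Cov M1 L0) (hle : M ≤ M1) :
    ∃ φ, φ ≠ 0 ∧ IsK φ M1 ∧ φ.1 * u.1 + φ.2.1 * u.2.1 + φ.2.2 * u.2.2 = 0 := by
  obtain ⟨φ, hφ, H1⟩ := h1.functional
  refine ⟨φ, hφ, H1, ?_⟩
  have := hle h.mem
  rw [H1, ct_C, ct_C, ct_C] at this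
  exact this.2

/-! cusps -/
def Cusp (M : AddSubgroup V) : Prop := ∃ α, (T α, 0, 0) ∈ M ∧ ∀ p q r, (p, q, r) ∈ M → IsP α r
def Deep (M : AddSubgroup V) : Prop := ∃ α, (T α, 0, 0) ∈ M ∧ ∀ p q r, (p, q, r) ∈ M → IsP (α + 1) r

lemma Deep.cusp {M M'} (h : Deep M') (hle : M ≤ M') (ht : ∀ v ∈ M', (T 1 : R2) • v ∈ M) : Cusp M := by
  obtain ⟨α, h1, h2⟩ := h
  refine ⟨α + 1, ?_, fun p q r hv => h2 p q r (hle hv)⟩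
  have := ht _ h1
  have e : (T 1 : R2) • ((T α, 0, 0) : V) = (T (α + 1), 0, 0) := by
    rw [Prod.smul_mk, Prod.smul_mk, smul_zero, smul_eq_mul, TT, add_comm]
  rwa [e] at this

lemma cusp_L0 : Cusp L0 := ⟨0, ⟨IsP.T _, IsP.zero _, IsP.zero _⟩, fun _ _ _ h => h.2.2⟩
lemma Deep.cusp' {M} (h : Deep M) : Cusp M := by
  obtain ⟨α, h1, h2⟩ := h
  exact ⟨α, h1, fun p q r h => (h2 p q r h).mono (by omega)⟩

lemma cusp_of_e {M} (h : (1, 0, 0) ∈ M) (hle : M ≤ L0) : Cusp M :=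
  ⟨0, by rwa [T_zero], fun _ _ _ hv => (hle hv).2.2⟩

lemma cusp_of_r {M} (h : ∀ v ∈ L0, (T 1 : R2) • v ∈ M) (h' : ∀ p q r, (p, q, r) ∈ M → IsP 1 r) : Cusp M :=
  ⟨1, tL0 h (IsP.T 1) (IsP.zero _) (IsP.zero _), h'⟩

lemma L0_tl : ∀ v ∈ L0, (T 1 : R2) • v ∈ L0 := by
  rintro ⟨p, q, r⟩ ⟨hp, hq, hr⟩
  have h1 : ∀ {p}, IsP 0 p → IsP 0 (T 1 * p) := fun hp => by rw [isP_T_mul]; exact hp.mono (by norm_num)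
  exact ⟨h1 hp, h1 hq, h1 hr⟩

end BB

namespace BB
open scoped Pointwise

section S
set_option linter.unusedSectionVars false
variable {G : Type*} [Group G] [DistribMulAction G V] [SMulCommClass G R2 V]

structure Setup (x y τ : G) (P : Subgroup G) : Prop where
  hx : ∀ p q r, x • ((p, q, r) : V) = (p + q, q + r, r)
  hy : ∀ p q r, y • ((p, q, r) : V) = (p + q, q + r, (1 + T 1) * p + q)
  ht : ∀ v : V, τ • v = (T 1 : R2) • v
  gen : Subgroup.closure {x, y, τ} = ⊤
  cen : ∀ g, τ * g = g * τ
  hP : P = Subgroup.closure {x, y * x * y, τ}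
  y3 : y * y * y ∈ P
  triv : ∀ p ∈ P, (∀ v : V, p • v = v) → y⁻¹ * p * y ∈ P

def Nact (g : G) (a b c : R2) : Prop := ∀ p q r, g • ((p, q, r) : V) = (p + b * q + c * r, q + a * r, r)

lemma Nact.mul {g h : G} {a b c a' b' c'} (H : Nact g a b c) (H' : Nact h a' b' c') :
    Nact (g * h) (a + a') (b + b') (c + c' + b * a') := by
  intro p q r
  rw [mul_smul, H', H]
  ext1
  · simp only; ring
  · ext1
    · simp only; ring
    · rfl

lemma Nact.one : Nact (1 : G) 0 0 0 := by
  intro p q r; simp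

lemma Nact.inv {g : G} {a b c} (H : Nact g a b c) : Nact g⁻¹ a b (c + a * b) := by
  intro p q r
  rw [inv_smul_eq_iff, H]
  ext1
  · simp only; linear_combination (-(b * q) - a * b * r - c * r) * two0
  · ext1
    · simp only; linear_combination (-(a * r)) * two0
    · rfl

lemma Nact.comm {g h : G} {a b c a' b' c'} (H : Nact g a b c) (H' : Nact h a' b' c') :
    Nact (g * h * g⁻¹ * h⁻¹) 0 0 (b * a' + b' * a) := by
  have := ((H.mul H').mul H.inv).mul H'.inv
  intro p q r
  rw [this p q r]
  ext1
  · simp only; linear_combination ((b + b') * q + (c + c' + a * b + b*a' + b'*a'  ) * r) * two0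
  · ext1
    · simp only; linear_combination ((a + a') * r) * two0
    · rfl

lemma mem_sm {g : G} {M : AddSubgroup V} {v : V} : v ∈ g • M ↔ g⁻¹ • v ∈ M :=
  AddSubgroup.mem_pointwise_smul_iff_inv_smul_mem

lemma sm_mem {g : G} {M : AddSubgroup V} {v : V} : g • v ∈ g • M ↔ v ∈ M := by
  rw [mem_sm, inv_smul_smul]

def Lat (M : AddSubgroup V) : Prop := (∀ v, ∃ n : ℕ, (T (n : ℤ) : R2) • v ∈ M) ∧
  ∃ m, ∀ p q r, (p, q, r) ∈ M → IsP m p ∧ IsP m q ∧ IsP m r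

lemma lat_L0 : Lat L0 := by
  refine ⟨?_, 0, fun p q r h => h⟩
  rintro ⟨p, q, r⟩
  obtain ⟨a, ha⟩ := IsP.exists p
  obtain ⟨b, hb⟩ := IsP.exists q
  obtain ⟨c, hc⟩ := IsP.exists r
  refine ⟨(max (-a) (max (-b) (-c))).toNat, ?_⟩
  refine ⟨?_, ?_, ?_⟩ <;> simp only [Prod.smul_mk, smul_eq_mul, isP_T_mul]
  · exact ha.mono (by omega)
  · exact hb.mono (by omega)
  · exact hc.mono (by omega)

lemma smul_decomp (g : G) (p q r : R2) : g • ((p, q, r) : V) =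
    p • (g • ((1, 0, 0) : V)) + q • (g • ((0, 1, 0) : V)) + r • (g • ((0, 0, 1) : V)) := by
  rw [decomp, smul_add, smul_add, smul_comm g p, smul_comm g q, smul_comm g r]

lemma Lat.smul {M} (h : Lat M) (g : G) : Lat (g • M) := by
  obtain ⟨h1, m, h2⟩ := h
  refine ⟨?_, ?_⟩
  · intro v
    obtain ⟨n, hn⟩ := h1 (g⁻¹ • v)
    exact ⟨n, by rw [mem_sm, smul_comm]; exact hn⟩
  · have key : ∀ v : V, ∃ n, ∀ k ≤ n, IsP k v.1 ∧ IsP k v.2.1 ∧ IsP k v.2.2 := by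
      rintro ⟨p, q, r⟩
      obtain ⟨a, ha⟩ := IsP.exists p
      obtain ⟨b, hb⟩ := IsP.exists q
      obtain ⟨c, hc⟩ := IsP.exists r
      exact ⟨min a (min b c), fun k hk => ⟨ha.mono (by omega), hb.mono (by omega), hc.mono (by omega)⟩⟩
    obtain ⟨a, ha⟩ := key (g • ((1, 0, 0) : V))
    obtain ⟨b, hb⟩ := key (g • ((0, 1, 0) : V))
    obtain ⟨c, hc⟩ := key (g • ((0, 0, 1) : V))
    have ha := ha (min a (min b c)) (by omega)
    have hb := hb (min a (min b c)) (by omega)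
    have hc := hc (min a (min b c)) (by omega)
    refine ⟨m + min a (min b c), fun p q r hv => ?_⟩
    rw [mem_sm] at hv
    rcases hu : g⁻¹ • ((p, q, r) : V) with ⟨p', q', r'⟩
    rw [hu] at hv
    have h3 := h2 _ _ _ hv
    rw [inv_smul_eq_iff, smul_decomp] at hu
    have e1 := congrArg Prod.fst hu
    have e2 := congrArg (fun v : V => v.2.1) hu
    have e3 := congrArg (fun v : V => v.2.2) hu
    simp only [Prod.fst_add, Prod.snd_add, Prod.smul_fst, Prod.smul_snd, smul_eq_mul] at e1 e2 e3
    rw [e1, e2, e3]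
    exact ⟨((h3.1.mul ha.1).add (h3.2.1.mul hb.1)).add (h3.2.2.mul hc.1),
      ((h3.1.mul ha.2.1).add (h3.2.1.mul hb.2.1)).add (h3.2.2.mul hc.2.1),
      ((h3.1.mul ha.2.2).add (h3.2.1.mul hb.2.2)).add (h3.2.2.mul hc.2.2)⟩

lemma Lat.cov {M M'} (h : Lat M') (hc : Cov M M') : Lat M := by
  obtain ⟨h1, m, h2⟩ := h
  refine ⟨?_, m, fun p q r hv => h2 p q r (hc.le hv)⟩
  intro v
  obtain ⟨n, hn⟩ := h1 v
  refine ⟨n + 1, ?_⟩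
  have := hc.tl _ hn
  rw [smul_smul, TT] at this
  push_cast
  rwa [add_comm]

lemma Tst.sm {M} (h : Tst M) (g : G) : Tst (g • M) := by
  intro v hv
  rw [mem_sm] at hv ⊢
  rw [smul_comm]
  exact h _ hv

lemma Cov.sm {M M'} (h : Cov M M') (g : G) : Cov (g • M) (g • M') := by
  refine ⟨?_, ?_, ?_⟩
  · intro v hv; rw [mem_sm] at hv ⊢; exact h.le hv
  · intro v hv; rw [mem_sm] at hv ⊢; rw [smul_comm]; exact h.tl _ hv
  · obtain ⟨v, hv, hv', H⟩ := h.ex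
    refine ⟨g • v, sm_mem.2 hv, fun h => hv' (sm_mem.1 h), fun u hu => ?_⟩
    rw [mem_sm] at hu
    rw [mem_sm, mem_sm, smul_add, inv_smul_smul]
    exact H _ hu

lemma le_sm {M M' : AddSubgroup V} (h : M ≤ M') (g : G) : g • M ≤ g • M' := by
  intro v hv; rw [mem_sm] at hv ⊢; exact h hv

lemma Cov.of_sm {M M'} (g : G) (h : Cov (g • M) (g • M')) : Cov M M' := by
  have := h.sm g⁻¹
  rwa [inv_smul_smul, inv_smul_smul] at this

end S
end BB

namespace BB
open scoped Pointwise

section S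
set_option linter.unusedSectionVars false
variable {G : Type*} [Group G] [DistribMulAction G V] [SMulCommClass G R2 V]
variable {x y τ : G} {P : Subgroup G}

lemma Setup.xP (S : Setup x y τ P) : x ∈ P := by
  rw [S.hP]; exact Subgroup.subset_closure (by simp)
lemma Setup.wP (S : Setup x y τ P) : y * x * y ∈ P := by
  rw [S.hP]; exact Subgroup.subset_closure (by simp)
lemma Setup.tP (S : Setup x y τ P) : τ ∈ P := by
  rw [S.hP]; exact Subgroup.subset_closure (by simp)

lemma Setup.hw (S : Setup x y τ P) (p q r : R2) :
    (y * x * y) • ((p, q, r) : V) = (T 1 * p, q + r, T 1 * r) := by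
  rw [mul_smul, mul_smul, S.hy, S.hx, S.hy]
  ext1
  · simp only; linear_combination (p + 2 * q + r) * two0
  · ext1
    · simp only; linear_combination (q + p + T 1 * p) * two0
    · simp only; linear_combination (p + 2 * q + r + T 1 * p + T 1 * q) * two0

lemma Setup.hwn (S : Setup x y τ P) (n : ℕ) : ∃ A, ∀ p q r : R2,
    (y * x * y) ^ n • ((p, q, r) : V) = (T n * p, q + A * r, T n * r) := by
  induction n with
  | zero => exact ⟨0, by simp [T_zero]⟩
  | succ n ih =>
    obtain ⟨A, hA⟩ := ih
    refine ⟨A + T n, fun p q r => ?_⟩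
    rw [pow_succ', mul_smul, hA, S.hw]
    push_cast
    rw [add_comm (n : ℤ) 1, T_add]
    ext1
    · simp only; ring
    · ext1
      · simp only; ring
      · simp only; ring

lemma Setup.hwz (S : Setup x y τ P) (n : ℤ) : ∃ A, ∀ p q r : R2,
    (y * x * y) ^ n • ((p, q, r) : V) = (T n * p, q + A * r, T n * r) := by
  rcases Int.eq_nat_or_neg n with ⟨k, rfl | rfl⟩
  · simpa using S.hwn k
  · obtain ⟨A, hA⟩ := S.hwn k
    refine ⟨A * T (-k), fun p q r => ?_⟩
    rw [_root_.zpow_neg, zpow_natCast, inv_smul_eq_iff, hA]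
    have := T_inv k
    ext1
    · simp only; linear_combination (-p) * this
    · ext1
      · simp only; linear_combination (- A * T (-k) * r) * two0
      · simp only; linear_combination (-r) * this

lemma Setup.tz (S : Setup x y τ P) (n : ℤ) (v : V) : τ ^ n • v = (T n : R2) • v := by
  have hn : ∀ n : ℕ, ∀ v : V, τ ^ n • v = (T n : R2) • v := by
    intro n
    induction n with
    | zero => intro v; simp [T_zero]
    | succ n ih => intro v; rw [pow_succ', mul_smul, ih, S.ht, smul_smul, TT]; push_cast; rw [add_comm]
  rcases Int.eq_nat_or_neg n with ⟨k, rfl | rfl⟩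
  · rw [zpow_natCast, hn]
  · rw [_root_.zpow_neg, zpow_natCast, inv_smul_eq_iff, hn, smul_smul, T_inv, one_smul]

lemma Setup.uk (S : Setup x y τ P) (k : ℤ) : ∃ g ∈ P, ∃ c, Nact g (T k) (T (-k)) c := by
  obtain ⟨A, hA⟩ := S.hwz k
  obtain ⟨A', hA'⟩ := S.hwz (-k)
  refine ⟨(y * x * y) ^ (-k) * x * (y * x * y) ^ k,
    P.mul_mem (P.mul_mem (P.zpow_mem S.wP _) S.xP) (P.zpow_mem S.wP _), T (-k) * A, ?_⟩
  have hAA : A' * T k = A := by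
    have h1 : (y * x * y) ^ (-k) • (y * x * y) ^ k • ((0, 0, 1) : V) = (0, 0, 1) := by
      rw [← mul_smul, ← _root_.zpow_add]; simp
    rw [hA, hA'] at h1
    have := congrArg (fun v : V => v.2.1) h1
    simp only [mul_one, zero_add] at this
    linear_combination this - A * two0
  intro p q r
  rw [mul_smul, mul_smul, hA, S.hx, hA']
  have := T_inv k
  ext1
  · simp only; linear_combination p * this
  · ext1
    · simp only; linear_combination r * hAA + A * r * two0
    · simp only; linear_combination r * this

lemma Setup.exB (S : Setup x y τ P) (b : R2) : ∃ g ∈ P, ∃ a' b' c', Nact g a' b' c' ∧ IsP 0 (b' + b) := by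
  induction b using ind with
  | h0 => exact ⟨1, P.one_mem, 0, 0, 0, Nact.one, by simpa using IsP.zero 0⟩
  | hT n =>
    obtain ⟨g, hg, c, h⟩ := S.uk (-n)
    exact ⟨g, hg, _, _, c, h, by rw [neg_neg, add_self]; exact IsP.zero 0⟩
  | ha p q h1 h2 =>
    obtain ⟨g, hg, a, b, c, h, h'⟩ := h1
    obtain ⟨g', hg', a', b', c', k, k'⟩ := h2
    refine ⟨g * g', P.mul_mem hg hg', _, _, _, h.mul k, ?_⟩
    have := h'.add k'
    convert this using 1; ring

lemma Setup.exA (S : Setup x y τ P) (a : R2) : ∃ g ∈ P, ∃ a' b' c', Nact g a' b' c' ∧ IsP 0 (a' + a) ∧ IsP 0 b' := by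
  induction a using ind with
  | h0 => exact ⟨1, P.one_mem, 0, 0, 0, Nact.one, by simpa using IsP.zero 0, IsP.zero 0⟩
  | hT n =>
    rcases le_total 0 n with hn | hn
    · exact ⟨1, P.one_mem, 0, 0, 0, Nact.one, by simpa using IsP.T' hn, IsP.zero 0⟩
    · obtain ⟨g, hg, c, h⟩ := S.uk n
      exact ⟨g, hg, _, _, c, h, by rw [add_self]; exact IsP.zero 0, IsP.T' (by omega)⟩
  | ha p q h1 h2 =>
    obtain ⟨g, hg, a, b, c, h, h', h''⟩ := h1
    obtain ⟨g', hg', a', b', c', k, k', k''⟩ := h2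
    refine ⟨g * g', P.mul_mem hg hg', _, _, _, h.mul k, ?_, h''.add k''⟩
    have := h'.add k'
    convert this using 1; ring

lemma Setup.exC (S : Setup x y τ P) (c : R2) : ∃ g ∈ P, ∃ c', Nact g 0 0 c' ∧ IsP 0 (c' + c) := by
  induction c using ind with
  | h0 => exact ⟨1, P.one_mem, 0, Nact.one, by simpa using IsP.zero 0⟩
  | hT n =>
    rcases le_total 0 n with hn | hn
    · exact ⟨1, P.one_mem, 0, Nact.one, by simpa using IsP.T' hn⟩
    · obtain ⟨g, hg, c, h⟩ := S.uk n
      obtain ⟨g', hg', c', h'⟩ := S.uk 0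
      refine ⟨_, P.mul_mem (P.mul_mem (P.mul_mem hg hg') (P.inv_mem hg)) (P.inv_mem hg'), _, h.comm h', ?_⟩
      simp only [neg_zero, T_zero, mul_one, one_mul]
      rw [add_assoc, add_self, add_zero]
      exact IsP.T' (by omega)
  | ha p q h1 h2 =>
    obtain ⟨g, hg, c, h, h'⟩ := h1
    obtain ⟨g', hg', c', k, k'⟩ := h2
    have := h.mul k
    simp only [add_zero, mul_zero] at this
    refine ⟨g * g', P.mul_mem hg hg', _, this, ?_⟩
    have := h'.add k'
    convert this using 1; ring

structure Std (M : AddSubgroup V) : Prop where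
  t : Tst M
  e : (1, 0, 0) ∈ M
  h1 : ∀ p, (p, 0, 0) ∈ M → IsP 0 p
  h2 : ∀ p q, (p, q, 0) ∈ M → IsP 0 q
  h3 : ∀ p q r, (p, q, r) ∈ M → IsP 0 r

lemma Std.nact {M} (h : Std M) {g : G} {a b c} (H : Nact g a b c) : Std (g • M) := by
  refine ⟨h.t.sm g, ?_, ?_, ?_, ?_⟩
  · rw [mem_sm, H.inv]; simpa using h.e
  · intro p hp; rw [mem_sm, H.inv] at hp; exact h.h1 p (by simpa using hp)
  · intro p q hp; rw [mem_sm, H.inv] at hp; exact h.h2 _ q (by simpa using hp)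
  · intro p q r hp; rw [mem_sm, H.inv] at hp; exact h.h3 _ _ r (by simpa using hp)

lemma Std.eq {M} (h : Std M) (hf : (0, 1, 0) ∈ M) (hg : (0, 0, 1) ∈ M) : M = L0 := by
  ext ⟨p, q, r⟩
  constructor
  · intro hv
    have hr := h.h3 _ _ _ hv
    have hv2 := M.add_mem hv (h.t.smul hg hr)
    simp only [Prod.smul_mk, Prod.mk_add_mk, smul_eq_mul, mul_zero, mul_one, add_zero, add_self] at hv2
    have hq := h.h2 _ _ hv2
    have hv3 := M.add_mem hv2 (h.t.smul hf hq)
    simp only [Prod.smul_mk, Prod.mk_add_mk, smul_eq_mul, mul_zero, mul_one, add_zero, add_self] at hv3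
    exact ⟨h.h1 _ hv3, hq, hr⟩
  · rintro ⟨hp, hq, hr⟩
    rw [decomp]
    exact M.add_mem (M.add_mem (h.t.smul h.e hp) (h.t.smul hf hq)) (h.t.smul hg hr)

lemma Setup.std (S : Setup x y τ P) {M} (h : Std M) (hb : ∃ b, (b, 1, 0) ∈ M) (ha : ∃ c a, (c, a, 1) ∈ M) :
    ∃ g ∈ P, g • M = L0 := by
  obtain ⟨b, hb⟩ := hb
  obtain ⟨g1, hg1, a1, b1, c1, H1, I1⟩ := S.exB b
  set M1 := g1 • M with hM1
  have h1 : Std M1 := h.nact H1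
  have hf1 : (0, 1, 0) ∈ M1 := by
    have := sm_mem (g := g1).2 hb
    rw [H1] at this
    have := M1.add_mem this (h1.t.smul h1.e I1)
    simp only [Prod.smul_mk, Prod.mk_add_mk, smul_eq_mul, mul_zero, mul_one, add_zero] at this
    convert this using 2
    linear_combination (-b - b1) * two0
  have ha1 : ∃ c a, (c, a, 1) ∈ M1 := by
    obtain ⟨c, a, h⟩ := ha
    have := sm_mem (g := g1).2 h
    rw [H1] at this
    exact ⟨_, _, this⟩
  obtain ⟨c, a, hca⟩ := ha1
  obtain ⟨g2, hg2, a2, b2, c2, H2, I2, J2⟩ := S.exA a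
  set M2 := g2 • M1 with hM2
  have h2 : Std M2 := h1.nact H2
  have hf2 : (0, 1, 0) ∈ M2 := by
    have := sm_mem (g := g2).2 hf1
    rw [H2] at this
    have := M2.add_mem this (h2.t.smul h2.e J2)
    simp only [Prod.smul_mk, Prod.mk_add_mk, smul_eq_mul, mul_zero, mul_one, add_zero] at this
    convert this using 2
    linear_combination (-b2) * two0
  have hc2 : ∃ c, (c, 0, 1) ∈ M2 := by
    have := sm_mem (g := g2).2 hca
    rw [H2] at this
    have := M2.add_mem this (h2.t.smul hf2 I2)
    simp only [Prod.smul_mk, Prod.mk_add_mk, smul_eq_mul, mul_zero, mul_one, add_zero] at this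
    refine ⟨c + b2 * a + c2, ?_⟩
    convert this using 3
    linear_combination (-a - a2) * two0
  obtain ⟨c', hc'⟩ := hc2
  obtain ⟨g3, hg3, c3, H3, I3⟩ := S.exC c'
  refine ⟨g3 * (g2 * g1), P.mul_mem hg3 (P.mul_mem hg2 hg1), ?_⟩
  rw [mul_smul, mul_smul, ← hM1, ← hM2]
  set M3 := g3 • M2 with hM3
  have h3 : Std M3 := h2.nact H3
  apply h3.eq
  · have := sm_mem (g := g3).2 hf2
    rw [H3] at this
    simpa using this
  · have := sm_mem (g := g3).2 hc'
    rw [H3] at this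
    have := M3.add_mem this (h3.t.smul h3.e I3)
    simp only [Prod.smul_mk, Prod.mk_add_mk, smul_eq_mul, mul_zero, mul_one, zero_mul, add_zero] at this
    convert this using 2
    linear_combination (-c' - c3) * two0

lemma Setup.trans (S : Setup x y τ P) {M} (t : Tst M) (l : Lat M) (hc : Cusp M) (hd : ¬ Deep M) :
    ∃ g ∈ P, M = g • L0 := by
  obtain ⟨l1, m, l2⟩ := l
  obtain ⟨α, hα⟩ := ideal {p | ((p, 0, 0) : V) ∈ M} (fun a ha b hb => by simpa using M.add_mem ha hb)
    (fun a ha p hp => by simpa using t.smul ha hp)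
    (by obtain ⟨n, hn⟩ := l1 (1, 0, 0); exact ⟨n, by simpa using hn⟩) ⟨m, fun a ha => (l2 _ _ _ ha).1⟩
  obtain ⟨β, hβ⟩ := ideal {q | ∃ p, ((p, q, 0) : V) ∈ M}
    (fun a ⟨a', ha⟩ b ⟨b', hb⟩ => ⟨a' + b', by simpa using M.add_mem ha hb⟩)
    (fun a ⟨a', ha⟩ p hp => ⟨p * a', by simpa using t.smul ha hp⟩)
    (by obtain ⟨n, hn⟩ := l1 (0, 1, 0); exact ⟨n, 0, by simpa using hn⟩)
    ⟨m, fun a ⟨a', ha⟩ => (l2 _ _ _ ha).2.1⟩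
  obtain ⟨γ, hγ⟩ := ideal {r | ∃ p q, ((p, q, r) : V) ∈ M}
    (fun a ⟨a', a'', ha⟩ b ⟨b', b'', hb⟩ => ⟨a' + b', a'' + b'', by simpa using M.add_mem ha hb⟩)
    (fun a ⟨a', a'', ha⟩ p hp => ⟨p * a', p * a'', by simpa using t.smul ha hp⟩)
    (by obtain ⟨n, hn⟩ := l1 (0, 0, 1); exact ⟨n, 0, 0, by simpa using hn⟩)
    ⟨m, fun a ⟨a', a'', ha⟩ => (l2 _ _ _ ha).2.2⟩
  simp only [Set.mem_ofPred_eq] at hα hβ hγ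
  have e : γ = α := by
    obtain ⟨k, k1, k2⟩ := hc
    have i1 := isP_T_iff.1 ((hα _).1 k1)
    have i2 : k ≤ γ := by
      obtain ⟨p, q, hv⟩ := (hγ (T γ)).2 (IsP.T γ)
      exact isP_T_iff.1 (k2 _ _ _ hv)
    by_contra h
    apply hd
    refine ⟨α, (hα _).2 (IsP.T α), fun p q r hv => ?_⟩
    exact ((hγ r).1 ⟨p, q, hv⟩).mono (by omega)
  subst e
  obtain ⟨A, hA⟩ := S.hwz (β - γ)
  set d := τ ^ (-β) * (y * x * y) ^ (β - γ) with hd'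
  have hdP : d ∈ P := P.mul_mem (P.zpow_mem S.tP _) (P.zpow_mem S.wP _)
  have hd1 : ∀ p q r : R2, d • ((p, q, r) : V) = (T (-γ) * p, T (-β) * (q + A * r), T (-γ) * r) := by
    intro p q r
    rw [hd', mul_smul, hA, S.tz]
    have : (T (-γ) : R2) = T (-β) * T (β - γ) := by rw [TT]; congr 1; ring
    rw [this]
    simp only [Prod.smul_mk, smul_eq_mul, mul_assoc]
  have key : ∀ {p q r : R2}, (p, q, r) ∈ d • M → ∃ p' q' r', (p', q', r') ∈ M ∧ p = T (-γ) * p' ∧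
      q = T (-β) * (q' + A * r') ∧ r = T (-γ) * r' := by
    intro p q r h
    rw [mem_sm] at h
    rcases hu : d⁻¹ • ((p, q, r) : V) with ⟨p', q', r'⟩
    rw [hu] at h
    rw [inv_smul_eq_iff, hd1] at hu
    simp only [Prod.mk.injEq] at hu
    exact ⟨p', q', r', h, hu⟩
  have Tz : ∀ (n : ℤ) {p : R2}, T n * p = 0 → p = 0 := by
    intro n p h
    have := congrArg (fun z => T (-n) * z) h
    simpa [← mul_assoc, T_inv'] using this
  have std : Std (d • M) := by
    refine ⟨t.sm d, ?_, ?_, ?_, ?_⟩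
    · have := sm_mem (g := d).2 ((hα _).2 (IsP.T γ))
      rw [hd1, T_inv'] at this
      simpa using this
    · intro p h
      obtain ⟨p', q', r', h, h1, h2, h3⟩ := key h
      obtain rfl := Tz _ h3.symm
      have := Tz _ h2.symm
      simp only [mul_zero, add_zero] at this
      subst this
      rw [h1, isP_T_mul]
      simpa using (hα _).1 h
    · intro p q h
      obtain ⟨p', q', r', h, h1, h2, h3⟩ := key h
      obtain rfl := Tz _ h3.symm
      rw [h2, isP_T_mul]
      simpa using (hβ _).1 ⟨_, h⟩
    · intro p q r h
      obtain ⟨p', q', r', h, h1, h2, h3⟩ := key h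
      rw [h3, isP_T_mul]
      simpa using (hγ _).1 ⟨_, _, h⟩
  obtain ⟨g, hg, hgM⟩ := S.std std
    (by
      obtain ⟨p, hp⟩ := (hβ _).2 (IsP.T β)
      have := sm_mem (g := d).2 hp
      rw [hd1] at this
      simp only [mul_zero, add_zero, T_inv'] at this
      exact ⟨_, this⟩)
    (by
      obtain ⟨p, q, hp⟩ := (hγ _).2 (IsP.T γ)
      have := sm_mem (g := d).2 hp
      rw [hd1, T_inv'] at this
      exact ⟨_, _, this⟩)
  refine ⟨(g * d)⁻¹, P.inv_mem (P.mul_mem hg hdP), ?_⟩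
  rw [← hgM, ← mul_smul g d, inv_smul_smul]

end S
end BB

namespace BB
open scoped Pointwise

section S
set_option linter.unusedSectionVars false
variable {G : Type*} [Group G] [DistribMulAction G V] [SMulCommClass G R2 V]
variable {x y τ : G} {P : Subgroup G}

lemma ext3 {a b c a' b' c' : R2} (h1 : a = a') (h2 : b = b') (h3 : c = c') : ((a, b, c) : V) = (a', b', c') := by
  rw [h1, h2, h3]

lemma IsP.one0 : IsP 0 (1 : R2) := IsP.one le_rfl

def UT (g : G) (n m : ℤ) (A B C : R2) : Prop :=
  ∀ p q r, g • ((p, q, r) : V) = (T n * p + B * q + C * r, T m * q + A * r, T n * r)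

lemma UT.inv {g : G} {n m A B C} (h : UT g n m A B C) :
    UT g⁻¹ (-n) (-m) (T (-n) * T (-m) * A) (T (-n) * T (-m) * B) (T (-n) * T (-n) * C + T (-n) * T (-n) * T (-m) * A * B) := by
  intro p q r
  rw [inv_smul_eq_iff, h]
  have h1 := T_inv n
  have h2 := T_inv m
  generalize (T n : R2) = tn at *
  generalize (T (-n) : R2) = tn' at *
  generalize (T m : R2) = tm at *
  generalize (T (-m) : R2) = tm' at *
  apply ext3 <;> grind

lemma Setup.ut (S : Setup x y τ P) {g : G} (hg : g ∈ P) : ∃ n m A B C, UT g n m A B C := by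
  rw [S.hP] at hg
  induction hg using Subgroup.closure_induction with
  | mem g hg =>
    rcases hg with rfl | rfl | rfl
    · exact ⟨0, 0, 1, 1, 0, fun p q r => by rw [S.hx]; simp [T_zero]⟩
    · exact ⟨1, 0, 1, 0, 0, fun p q r => by rw [S.hw]; simp [T_zero]⟩
    · exact ⟨1, 1, 0, 0, 0, fun p q r => by rw [S.ht]; simp⟩
  | one => exact ⟨0, 0, 0, 0, 0, fun p q r => by simp [T_zero]⟩
  | mul g g' _ _ h h' =>
    obtain ⟨n, m, A, B, C, h⟩ := h
    obtain ⟨n', m', A', B', C', h'⟩ := h'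
    refine ⟨n + n', m + m', T m * A' + A * T n', T n * B' + B * T m', T n * C' + B * A' + C * T n', fun p q r => ?_⟩
    rw [mul_smul, h', h, T_add, T_add]
    apply ext3 <;> ring
  | inv g _ h =>
    obtain ⟨n, m, A, B, C, h⟩ := h
    exact ⟨_, _, _, _, _, h.inv⟩

lemma Setup.cusp (S : Setup x y τ P) {g : G} (hg : g ∈ P) {M} (hM : Cusp M) : Cusp (g • M) := by
  obtain ⟨n, m, A, B, C, h⟩ := S.ut hg
  obtain ⟨α, h1, h2⟩ := hM
  refine ⟨n + α, ?_, fun p q r hv => ?_⟩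
  · have := sm_mem (g := g).2 h1
    rw [h, TT] at this
    simpa using this
  · rw [mem_sm] at hv
    rcases hu : g⁻¹ • ((p, q, r) : V) with ⟨p', q', r'⟩
    rw [hu] at hv
    rw [inv_smul_eq_iff, h] at hu
    simp only [Prod.mk.injEq] at hu
    rw [hu.2.2, isP_T_mul]
    exact (h2 _ _ _ hv).mono (by omega)

lemma Setup.cusp_iff (S : Setup x y τ P) {g : G} (hg : g ∈ P) {M} : Cusp (g • M) ↔ Cusp M :=
  ⟨fun h => by simpa using S.cusp (P.inv_mem hg) h, S.cusp hg⟩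

/-- Hermitian form -/
def Hf (v u : V) : R2 := invert v.1 * (1 + T 1) * u.2.2 + invert v.2.1 * ((1 + T 1) * u.2.1 + u.2.2) +
  invert v.2.2 * ((1 + T 1) * u.1 + T 1 * u.2.1 + (1 + T 1) * u.2.2)

lemma Setup.hf (S : Setup x y τ P) (g : G) : ∀ v u : V, Hf (g • v) (g • u) = Hf v u := by
  have hg : g ∈ Subgroup.closure {x, y, τ} := by rw [S.gen]; trivial
  have hT : (T 1 : R2) * T (-1) = 1 := T_inv 1
  induction hg using Subgroup.closure_induction with
  | mem g hg =>
    rintro ⟨p, q, r⟩ ⟨p', q', r'⟩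
    rcases hg with rfl | rfl | rfl
    · rw [S.hx, S.hx]
      simp only [Hf, map_add, map_mul, invert_T, map_one]
      generalize (T 1 : R2) = t at *
      generalize invert p = a
      generalize invert q = b
      generalize invert r = c
      grind
    · rw [S.hy, S.hy]
      simp only [Hf, map_add, map_mul, invert_T, map_one]
      generalize (T 1 : R2) = t at *
      generalize (T (-1) : R2) = t' at *
      generalize invert p = a
      generalize invert q = b
      generalize invert r = c
      grind
    · rw [S.ht, S.ht]
      simp only [Hf, map_mul, invert_T, Prod.smul_mk, smul_eq_mul]
      generalize (T 1 : R2) = t at *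
      generalize (T (-1) : R2) = t' at *
      generalize invert p = a
      generalize invert q = b
      generalize invert r = c
      grind
  | one => intro v u; simp
  | mul g g' _ _ h h' => intro v u; rw [mul_smul, mul_smul, h, h']
  | inv g _ h => intro v u; rw [← h, smul_inv_smul, smul_inv_smul]

lemma Setup.yinv (S : Setup x y τ P) (p q r : R2) : y⁻¹ • ((p, q, r) : V) =
    (T (-1) * (p + r), T (-1) * ((1 + T 1) * p + r), T (-1) * ((1 + T 1) * p + T 1 * q + r)) := by
  have hT : (T 1 : R2) * T (-1) = 1 := T_inv 1
  rw [inv_smul_eq_iff, S.hy]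
  generalize (T 1 : R2) = t at *
  generalize (T (-1) : R2) = t' at *
  apply ext3 <;> grind

lemma Setup.xinv (S : Setup x y τ P) (p q r : R2) : x⁻¹ • ((p, q, r) : V) = (p + q + r, q + r, r) := by
  rw [inv_smul_eq_iff, S.hx]
  apply ext3 <;> grind

lemma Setup.winv (S : Setup x y τ P) (p q r : R2) : (y * x * y)⁻¹ • ((p, q, r) : V) =
    (T (-1) * p, q + T (-1) * r, T (-1) * r) := by
  have hT : (T 1 : R2) * T (-1) = 1 := T_inv 1
  rw [inv_smul_eq_iff, S.hw]
  generalize (T 1 : R2) = t at *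
  generalize (T (-1) : R2) = t' at *
  apply ext3 <;> grind

lemma Setup.xL0 (S : Setup x y τ P) : x • L0 = L0 := by
  ext ⟨p, q, r⟩
  rw [mem_sm, S.xinv, mem_L0, mem_L0]
  constructor
  · rintro ⟨h1, h2, h3⟩
    have hq := h2.add h3
    have hp := h1.add h2
    refine ⟨?_, ?_, h3⟩
    · convert hp using 1; grind
    · convert hq using 1; grind
  · rintro ⟨h1, h2, h3⟩
    exact ⟨(h1.add h2).add h3, h2.add h3, h3⟩

lemma isP_lam {k p} (h : IsP k p) : IsP k ((1 + T 1) * p) := by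
  rw [add_mul, one_mul]
  exact h.add (by rw [isP_T_mul]; exact h.mono (by omega))

lemma Setup.yL0m (S : Setup x y τ P) (p q r : R2) : (p, q, r) ∈ y • L0 ↔ (p, q, r) ∈ L0 ∧ IsP 1 (p + r) := by
  rw [mem_sm, S.yinv, mem_L0, mem_L0, isP_T_mul, isP_T_mul, isP_T_mul, show (0:ℤ) - -1 = 1 from rfl]
  constructor
  · rintro ⟨h1, h2, h3⟩
    have e1 := h1.add h2
    have e2 := h2.add h3
    have hp : IsP 0 p := by
      have : p + r + ((1 + T 1) * p + r) = T 1 * p := by grind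
      rw [this, isP_T_mul] at e1; simpa using e1
    have hq : IsP 0 q := by
      have : ((1 + T 1) * p + r + ((1 + T 1) * p + T 1 * q + r)) = T 1 * q := by grind
      rw [this, isP_T_mul] at e2; simpa using e2
    refine ⟨⟨hp, hq, ?_⟩, h1⟩
    have := (h1.mono (show (0:ℤ) ≤ 1 by norm_num)).add hp
    convert this using 1; grind
  · rintro ⟨⟨h1, h2, h3⟩, h⟩
    have hp : IsP 1 (T 1 * p) := by rw [isP_T_mul]; simpa using h1
    have hq : IsP 1 (T 1 * q) := by rw [isP_T_mul]; simpa using h2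
    refine ⟨h, ?_, ?_⟩
    · convert h.add hp using 1; ring
    · convert (h.add hp).add hq using 1; ring

lemma Setup.yL0 (S : Setup x y τ P) : IsK (1, 0, 1) (y • L0) := by
  intro p q r
  rw [S.yL0m]
  refine and_congr_right fun h => ?_
  rw [← ct_zero_iff, ct_add h.1 h.2.2]
  simp

lemma Setup.y_not (S : Setup x y τ P) : ¬ Cusp (y • L0) := by
  rintro ⟨α, h1, h2⟩
  rw [S.yL0m] at h1
  simp only [add_zero, isP_T_iff] at h1
  have := h2 1 0 1 (by rw [S.yL0m, add_self]; exact ⟨⟨IsP.one0, IsP.zero _, IsP.one0⟩, IsP.zero _⟩)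
  rw [← T_zero, isP_T_iff] at this
  omega

lemma Setup.yy (S : Setup x y τ P) {p : G} (hp : p ∈ P) (h1 : p • L0 = L0) (h2 : p • y • L0 = y • L0) :
    ∀ v : V, p • v = v := by
  obtain ⟨n, m, A, B, C, h⟩ := S.ut hp
  have k : ∀ v ∈ L0, p • v ∈ L0 := fun v hv => by
    have := sm_mem (g := p).2 hv
    rwa [h1] at this
  have k' : ∀ v ∈ L0, p⁻¹ • v ∈ L0 := fun v hv => by
    rwa [← mem_sm, h1]
  have k2 : ∀ v ∈ y • L0, p • v ∈ y • L0 := fun v hv => by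
    have := sm_mem (g := p).2 hv
    rwa [h2] at this
  have me : ((1, 0, 0) : V) ∈ L0 := ⟨IsP.one0, IsP.zero _, IsP.zero _⟩
  have mf : ((0, 1, 0) : V) ∈ L0 := ⟨IsP.zero _, IsP.one0, IsP.zero _⟩
  have mg : ((0, 0, 1) : V) ∈ L0 := ⟨IsP.zero _, IsP.zero _, IsP.one0⟩
  have a1 := k _ me
  have a2 := k _ mf
  have a3 := k _ mg
  have b1 := k' _ me
  have b2 := k' _ mf
  rw [h, mem_L0] at a1 a2 a3
  rw [h.inv, mem_L0] at b1 b2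
  simp only [mul_zero, mul_one, add_zero, zero_add, isP_T_iff] at a1 a2 a3 b1 b2
  obtain rfl : n = 0 := by omega
  obtain rfl : m = 0 := by omega
  have hA : IsP 0 A := a3.2.1
  have hB : IsP 0 B := a2.1
  have hC : IsP 0 C := a3.1
  have c1 := S.hf p (0, 1, 0) (0, 0, 1)
  have c2 := S.hf p (0, 0, 1) (0, 0, 1)
  rw [h, h] at c1
  rw [h] at c2
  simp only [Hf, T_zero, mul_zero, mul_one, add_zero, zero_add, zero_mul, one_mul, map_one, map_zero] at c1 c2
  have hT : (T 1 : R2) * T (-1) = 1 := T_inv 1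
  have e1 : (1 + T 1) * (A + invert B) = 0 := by linear_combination c1
  have e1 : A = invert B := by
    have := (mul_eq_zero.1 e1).resolve_left lam_ne
    grind
  have hBc : B = 0 ∨ B = 1 := const_of hB (e1 ▸ hA)
  have hAB : A = B := by rcases hBc with rfl | rfl <;> simpa using e1
  subst hAB
  have hA0 : A = 0 := by
    have := k2 (0, 1, 0) (by rw [S.yL0m]; exact ⟨mf, by simpa using IsP.zero 1⟩)
    rw [h, S.yL0m] at this
    rcases hBc with rfl | rfl
    · rfl
    · have := this.2
      simp only [mul_zero, mul_one, add_zero, zero_add] at this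
      exact absurd this not_isP_one
  subst hA0
  simp only [mul_zero, zero_mul, map_zero, add_zero, zero_add] at c2
  have e2 : (1 + T 1) * (C + invert C) = 0 := by linear_combination c2
  have e2 : invert C = C := by
    have := (mul_eq_zero.1 e2).resolve_left lam_ne
    grind
  have hCc : C = 0 ∨ C = 1 := const_of hC (e2.symm ▸ hC)
  have hC0 : C = 0 := by
    have := k2 (1, 0, 1) (by rw [S.yL0m, add_self]; exact ⟨⟨IsP.one0, IsP.zero _, IsP.one0⟩, IsP.zero 1⟩)
    rw [h, S.yL0m] at this
    rcases hCc with rfl | rfl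
    · rfl
    · have := this.2
      simp only [T_zero, mul_zero, mul_one, add_zero, zero_add, add_self] at this
      exact absurd this not_isP_one
  subst hC0
  rintro ⟨a, b, c⟩
  rw [h]; simp [T_zero]

end S
end BB

namespace BB
open scoped Pointwise

section S
set_option linter.unusedSectionVars false
variable {G : Type*} [Group G] [DistribMulAction G V] [SMulCommClass G R2 V]
variable {x y τ : G} {P : Subgroup G}

def Fr (P : Subgroup G) (M : AddSubgroup V) (c : G ⧸ P) : Prop := ∃ g : G, c = (g : G ⧸ P) ∧ Cusp (g⁻¹ • M)

lemma Fr.smul {M} {c : G ⧸ P} (h : Fr P M c) (a : G) : Fr P (a • M) (a • c) := by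
  obtain ⟨g, rfl, h⟩ := h
  refine ⟨a * g, rfl, ?_⟩
  rwa [_root_.mul_inv_rev, ← mul_smul, inv_mul_cancel_right]

lemma Setup.fr_mk (S : Setup x y τ P) {M} {g : G} : Fr P M (g : G ⧸ P) ↔ Cusp (g⁻¹ • M) := by
  constructor
  · rintro ⟨a, h1, h2⟩
    have := QuotientGroup.eq.1 h1
    have := S.cusp this h2
    rwa [← mul_smul, mul_inv_cancel_right] at this
  · intro h; exact ⟨g, rfl, h⟩

def Rel (P : Subgroup G) (y : G) (M' : AddSubgroup V) (c' : G ⧸ P) (M : AddSubgroup V) (c : G ⧸ P) : Prop :=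
  (c = c' ∧ Fr P M' c' ∧ Fr P M c) ∨
    ∃ g : G, c' = (g : G ⧸ P) ∧ c = ((g * y : G) : G ⧸ P) ∧ M' = g • L0 ∧ M = (g * y) • L0

lemma Rel.smul {M' M} {c' c : G ⧸ P} (h : Rel P y M' c' M c) (a : G) :
    Rel P y (a • M') (a • c') (a • M) (a • c) := by
  rcases h with ⟨rfl, h1, h2⟩ | ⟨g, rfl, rfl, rfl, rfl⟩
  · exact Or.inl ⟨rfl, h1.smul a, h2.smul a⟩
  · refine Or.inr ⟨a * g, rfl, ?_, ?_, ?_⟩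
    · rw [mul_assoc]; rfl
    · rw [mul_smul]
    · rw [mul_assoc, mul_smul a]

lemma Rel.fr {M' M} {c' c : G ⧸ P} (h : Rel P y M' c' M c) : Fr P M c := by
  rcases h with ⟨rfl, h1, h2⟩ | ⟨g, rfl, rfl, rfl, rfl⟩
  · exact h2
  · exact ⟨_, rfl, by rw [inv_smul_smul]; exact cusp_L0⟩

lemma Setup.det (S : Setup x y τ P) {M' M} {c' c1 c2 : G ⧸ P} (h1 : Rel P y M' c' M c1)
    (h2 : Rel P y M' c' M c2) : c1 = c2 := by
  have aux : ∀ g : G, Fr P ((g * y) • L0) (g : G ⧸ P) → False := by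
    intro g h
    rw [S.fr_mk, ← mul_smul, inv_mul_cancel_left] at h
    exact S.y_not h
  rcases h1 with ⟨e1, h1, h1'⟩ | ⟨g, e1, e2, e3, e4⟩ <;>
    rcases h2 with ⟨f1, h2, h2'⟩ | ⟨k, f1, f2, f3, f4⟩
  · rw [e1, f1]
  · exfalso; subst e1 f1 f4; exact aux _ h1'
  · exfalso; subst f1 e1 e4; exact aux _ h2'
  · subst e2 f2
    rw [QuotientGroup.eq]
    have hp : g⁻¹ * k ∈ P := QuotientGroup.eq.1 (e1 ▸ f1)
    have k1 : (g⁻¹ * k) • L0 = L0 := by rw [mul_smul, ← f3, e3, inv_smul_smul]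
    have k2 : (g⁻¹ * k) • y • L0 = y • L0 := by rw [← mul_smul, mul_assoc, mul_smul, ← f4, e4, mul_smul, inv_smul_smul]
    have := S.triv _ hp (S.yy hp k1 k2)
    convert this using 1; group

lemma Setup.nf (S : Setup x y τ P) {M} {c : G ⧸ P} (h : Fr P M c) (l : Lat M) (t : Tst M) :
    ∃ g : G, c = (g : G ⧸ P) ∧ (Deep (g⁻¹ • M) ∨ M = g • L0) := by
  obtain ⟨g, rfl, h⟩ := h
  by_cases hd : Deep (g⁻¹ • M)
  · exact ⟨g, rfl, Or.inl hd⟩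
  · obtain ⟨a, ha, e⟩ := S.trans (t.sm _) (l.smul _) h hd
    refine ⟨g * a, ?_, Or.inr ?_⟩
    · rw [QuotientGroup.eq, inv_mul_cancel_left]; exact ha
    · rw [mul_smul, ← e, smul_inv_smul]

lemma Setup.xK (S : Setup x y τ P) {a b c M} (h : IsK (a, b, c) M) : IsK (a, a + b, a + b + c) (x • M) := by
  intro p q r
  rw [mem_sm, S.xinv, h, ← S.xinv, ← mem_sm, S.xL0]
  refine and_congr_right fun h => ?_
  rw [ct_add (h.1.add h.2.1) h.2.2, ct_add h.1 h.2.1, ct_add h.2.1 h.2.2]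
  ring_nf

lemma Setup.xinvL0 (S : Setup x y τ P) : x⁻¹ • L0 = L0 := by
  rw [inv_smul_eq_iff, S.xL0]

lemma Setup.xN (S : Setup x y τ P) {a b c M} (hM : IsN (a, b, c) M) : IsN (a + b + c, b + c, c) (x⁻¹ • M) := by
  intro p q r
  rw [mem_sm, inv_inv, S.hx, hM, ← S.hx]
  nth_rw 1 [← inv_inv x]
  rw [← mem_sm, S.xinvL0]
  refine and_congr_right fun h => ?_
  rw [ct_add h.1 h.2.1, ct_add h.2.1 h.2.2]
  clear hM h
  generalize ct p = p, ct q = q, ct r = r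
  revert a b c p q r; decide

lemma Setup.xe (S : Setup x y τ P) {g : G} (hg : g ∈ P) (hg' : g • L0 = L0) :
    Rel P y L0 ((1 : G) : G ⧸ P) ((g * y) • L0) ((g * y : G) : G ⧸ P) :=
  Or.inr ⟨g, by rw [QuotientGroup.eq]; simpa using hg, rfl, hg'.symm, rfl⟩

lemma frL0 : Fr P L0 ((1 : G) : G ⧸ P) := ⟨1, rfl, by simpa using cusp_L0⟩
lemma fr1 {M} (h : Cusp M) : Fr P M ((1 : G) : G ⧸ P) := ⟨1, rfl, by simpa using h⟩

lemma isK_e {b c M} (h : IsK (0, b, c) M) : Cusp M ∨ False := by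
  by_cases hb : (1, 0, 0) ∈ M
  · exact Or.inl (cusp_of_e hb fun ⟨p, q, r⟩ hv => ((h p q r).1 hv).1)
  · exact absurd ((h 1 0 0).2 ⟨⟨IsP.one0, IsP.zero _, IsP.zero _⟩, by simp [ct_zero]⟩) hb

lemma Setup.E0 (S : Setup x y τ P) {M} (h : Cov M L0) : ∃ c, Rel P y L0 ((1 : G) : G ⧸ P) M c := by
  obtain ⟨⟨a, b, c⟩, hφ, H⟩ := h.functional
  rcases z2 a with rfl | rfl
  · exact ⟨_, Or.inl ⟨rfl, frL0, fr1 ((isK_e H).resolve_right id)⟩⟩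
  · have k0 := S.yL0
    have k1 := S.xK k0
    have k2 := S.xK k1
    have k3 := S.xK k2
    rw [← mul_smul] at k1
    rw [← mul_smul, ← mul_smul] at k2
    rw [← mul_smul, ← mul_smul, ← mul_smul] at k3
    rcases z2 b with rfl | rfl <;> rcases z2 c with rfl | rfl
    · obtain rfl : M = (x * x * y) • L0 := H.eq k2
      exact ⟨_, S.xe (P.mul_mem S.xP S.xP) (by rw [mul_smul, S.xL0, S.xL0])⟩
    · obtain rfl : M = y • L0 := H.eq k0
      have := S.xe P.one_mem (one_smul G L0)
      rw [one_mul] at this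
      exact ⟨_, this⟩
    · obtain rfl : M = (x * y) • L0 := H.eq k1
      exact ⟨_, S.xe S.xP S.xL0⟩
    · obtain rfl : M = (x * x * x * y) • L0 := H.eq (by exact k3)
      exact ⟨_, S.xe (P.mul_mem (P.mul_mem S.xP S.xP) S.xP) (by rw [mul_smul, mul_smul, S.xL0, S.xL0, S.xL0])⟩

lemma coe_smul1 (g : G) : g • ((1 : G) : G ⧸ P) = (g : G ⧸ P) := by
  rw [MulAction.Quotient.smul_coe, smul_eq_mul, mul_one]

lemma Setup.E (S : Setup x y τ P) {M M'} {c' : G ⧸ P} (hf : Fr P M' c') (l : Lat M') (h : Cov M M') :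
    ∃ c, Rel P y M' c' M c := by
  obtain ⟨g, rfl, hd | e⟩ := S.nf hf l h.tst'
  · have := hd.cusp (h.sm g⁻¹).le (h.sm g⁻¹).tl
    exact ⟨_, Or.inl ⟨rfl, hf, S.fr_mk.2 this⟩⟩
  · have k := h.sm g⁻¹
    rw [e, inv_smul_smul] at k
    obtain ⟨c, hc⟩ := S.E0 k
    have := hc.smul g
    rw [smul_inv_smul, ← e, coe_smul1] at this
    exact ⟨_, this⟩

lemma Setup.hy3 (S : Setup x y τ P) (v : V) : y • y • y • v = (T 1 : R2) • v := by
  obtain ⟨p, q, r⟩ := v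
  rw [S.hy, S.hy, S.hy, Prod.smul_mk, Prod.smul_mk, smul_eq_mul, smul_eq_mul, smul_eq_mul]
  generalize (T 1 : R2) = t at *
  apply ext3 <;> grind

lemma Setup.wL0 (S : Setup x y τ P) : IsN (0, 1, 0) ((y * x * y) • L0) := by
  intro p q r
  rw [mem_sm, S.winv, mem_L0, mem_L0, isP_T_mul, isP_T_mul, show (0:ℤ) - -1 = 1 from rfl]
  have e : ((ct p, ct q, ct r) = (0 : ZMod 2 × ZMod 2 × ZMod 2) ∨ (ct p, ct q, ct r) = (0, 1, 0)) ↔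
      ct p = 0 ∧ ct r = 0 := by
    generalize ct p = p, ct q = q, ct r = r
    revert p q r; decide
  rw [e, ct_zero_iff, ct_zero_iff]
  have aux : IsP 1 r → IsP 0 (T (-1) * r) := fun h => by rw [isP_T_mul]; exact h
  constructor
  · rintro ⟨h1, h2, h3⟩
    have := h2.add (aux h3)
    rw [add_assoc, add_self, add_zero] at this
    exact ⟨⟨h1.mono (by norm_num), this, h3.mono (by norm_num)⟩, h1, h3⟩
  · rintro ⟨⟨h1, h2, h3⟩, h4, h5⟩
    exact ⟨h4, h2.add (aux h5), h5⟩

lemma Setup.yyL0 (S : Setup x y τ P) : IsN (1, 1, 1) (y • y • L0) := by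
  intro p q r
  rw [mem_sm]
  have hm := S.yL0m p q r
  rw [mem_sm] at hm
  rw [S.yinv] at hm ⊢
  rw [S.yL0m, hm]
  have hT : (T 1 : R2) * T (-1) = 1 := T_inv 1
  have : T (-1) * (p + r) + T (-1) * ((1 + T 1) * p + T 1 * q + r) = p + q := by
    generalize (T 1 : R2) = t at *
    generalize (T (-1) : R2) = t' at *
    grind
  rw [this, and_assoc]
  refine and_congr_right fun h => ?_
  rw [← ct_zero_iff, ← ct_zero_iff, ct_add h.1 h.2.2, ct_add h.1 h.2.1]
  generalize ct p = p, ct q = q, ct r = r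
  revert p q r; decide

lemma Setup.twL0 (S : Setup x y τ P) : IsK (0, 1, 1) ((τ * (y * x * y)⁻¹) • L0) := by
  intro p q r
  have : (τ * (y * x * y)⁻¹)⁻¹ • ((p, q, r) : V) = (p, T (-1) * (q + r), r) := by
    have hT : (T 1 : R2) * T (-1) = 1 := T_inv 1
    rw [inv_smul_eq_iff, mul_smul, S.winv, S.ht, Prod.smul_mk, Prod.smul_mk, smul_eq_mul, smul_eq_mul, smul_eq_mul]
    generalize (T 1 : R2) = t at *
    generalize (T (-1) : R2) = t' at *
    apply ext3 <;> grind
  rw [mem_sm, this, mem_L0, mem_L0, isP_T_mul, show (0:ℤ) - -1 = 1 from rfl]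
  constructor
  · rintro ⟨h1, h2, h3⟩
    have := (h2.mono (show (0:ℤ) ≤ 1 by norm_num)).add h3
    rw [add_assoc, add_self, add_zero] at this
    rw [← ct_zero_iff, ct_add this h3] at h2
    exact ⟨⟨h1, this, h3⟩, by simpa using h2⟩
  · rintro ⟨⟨h1, h2, h3⟩, h4⟩
    refine ⟨h1, ?_, h3⟩
    rw [← ct_zero_iff, ct_add h2 h3]
    simpa using h4

/-- local diamond statement at the standard lattice -/
def Dm (P : Subgroup G) (y : G) (u : ZMod 2 × ZMod 2 × ZMod 2) : Prop :=
  ∀ M, IsN u M → ∃ c : G ⧸ P, ∀ M3, M ≤ M3 → Cov M3 L0 →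
    ∃ c3, Rel P y L0 ((1 : G) : G ⧸ P) M3 c3 ∧ Rel P y M3 c3 M c

lemma Setup.dmx (S : Setup x y τ P) {a b c} (h : Dm P y (a + b + c, b + c, c)) : Dm P y (a, b, c) := by
  intro M hM
  obtain ⟨c, hc⟩ := h _ (S.xN hM)
  refine ⟨x • c, fun M3 h1 h2 => ?_⟩
  have k := h2.sm x⁻¹
  rw [S.xinvL0] at k
  obtain ⟨c3, i, j⟩ := hc _ (le_sm h1 x⁻¹) k
  have i := i.smul x
  have j := j.smul x
  rw [smul_inv_smul] at i j
  rw [smul_inv_smul] at j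
  have e : x • ((1 : G) : G ⧸ P) = ((1 : G) : G ⧸ P) := by
    rw [coe_smul1, QuotientGroup.eq]; simpa using S.xP
  rw [S.xL0, e] at i
  exact ⟨_, i, j⟩

lemma Setup.dm1 (S : Setup x y τ P) : Dm P y (1, 0, 0) := by
  intro M hM
  have he : (1, 0, 0) ∈ M := by simpa using hM.mem
  refine ⟨_, fun M3 h1 h2 => ⟨((1 : G) : G ⧸ P), Or.inl ⟨rfl, frL0, ?_⟩, Or.inl ⟨rfl, ?_, ?_⟩⟩⟩
  · exact fr1 (cusp_of_e (h1 he) h2.le)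
  · exact fr1 (cusp_of_e (h1 he) h2.le)
  · exact fr1 (cusp_of_e he (h1.trans h2.le))

lemma Setup.rel_y (S : Setup x y τ P) : Rel P y L0 ((1 : G) : G ⧸ P) (y • L0) (y : G ⧸ P) := by
  simpa using S.xe P.one_mem (one_smul G L0)

lemma Setup.rel_yw (S : Setup x y τ P) : Rel P y (y • L0) (y : G ⧸ P) ((y * x * y) • L0) ((1 : G) : G ⧸ P) := by
  refine Or.inr ⟨y * x, ?_, ?_, ?_, rfl⟩
  · rw [QuotientGroup.eq]; simpa using S.xP
  · rw [QuotientGroup.eq]; simpa using S.wP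
  · rw [mul_smul, S.xL0]

lemma Setup.coe_one (S : Setup x y τ P) {g : G} (hg : g ∈ P) : (g : G ⧸ P) = ((1 : G) : G ⧸ P) := by
  rw [QuotientGroup.eq]; simpa using P.inv_mem hg

lemma Setup.dm2 (S : Setup x y τ P) : Dm P y (0, 1, 0) := by
  intro M hM
  have hw := hM.eq S.wL0
  have hcu : Cusp M := by rw [hw]; exact S.cusp S.wP cusp_L0
  refine ⟨((1 : G) : G ⧸ P), fun M3 h1 h2 => ?_⟩
  obtain ⟨⟨a, b, c⟩, h0, H, hu⟩ := hM.functional h2 h1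
  simp only [mul_zero, mul_one, add_zero, zero_add] at hu
  subst hu
  rcases z2 a with rfl | rfl
  · have := (isK_e H).resolve_right id
    exact ⟨_, Or.inl ⟨rfl, frL0, fr1 this⟩, Or.inl ⟨rfl, fr1 this, fr1 hcu⟩⟩
  · rcases z2 c with rfl | rfl
    · have e : M3 = x • x • y • L0 := H.eq (S.xK (S.xK S.yL0))
      have i := (S.rel_y.smul x).smul x
      have j := (S.rel_yw.smul x).smul x
      rw [← e, S.xL0, S.xL0, coe_smul1, S.coe_one S.xP, coe_smul1, S.coe_one S.xP] at i
      rw [← e, coe_smul1, S.coe_one S.xP, coe_smul1, S.coe_one S.xP] at j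
      have e' : x • x • ((y * x * y) • L0) = M := by
        rw [← eq_inv_smul_iff, ← eq_inv_smul_iff]
        exact (S.wL0).eq (S.xN (S.xN hM))
      rw [e'] at j
      exact ⟨_, i, j⟩
    · have e : M3 = y • L0 := H.eq S.yL0
      rw [e, hw]
      exact ⟨_, S.rel_y, S.rel_yw⟩

lemma Setup.dm3 (S : Setup x y τ P) : Dm P y (1, 1, 1) := by
  intro M hM
  have hw := hM.eq S.yyL0
  refine ⟨((y * y : G) : G ⧸ P), fun M3 h1 h2 => ?_⟩
  obtain ⟨⟨a, b, c⟩, h0, H, hu⟩ := hM.functional h2 h1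
  simp only [mul_one] at hu
  have cases : (a, b, c) = (1, 0, 1) ∨ (a, b, c) = (0, 1, 1) ∨ (a, b, c) = (1, 1, 0) := by
    clear H hw
    revert a b c; decide
  rcases cases with e | e | e <;> rw [e] at H
  · rw [H.eq S.yL0, hw]
    exact ⟨_, S.rel_y, S.rel_y.smul y |> fun h => by rwa [coe_smul1] at h⟩
  · have e3 := H.eq S.twL0
    have hp : τ * (y * x * y)⁻¹ ∈ P := P.mul_mem S.tP (P.inv_mem S.wP)
    have cu : Cusp M3 := by rw [e3]; exact S.cusp hp cusp_L0
    refine ⟨_, Or.inl ⟨rfl, frL0, fr1 cu⟩, Or.inr ⟨τ * (y * x * y)⁻¹, (S.coe_one hp).symm, ?_, e3, ?_⟩⟩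
    · rw [QuotientGroup.eq]
      have : (y * y)⁻¹ * (τ * (y * x * y)⁻¹ * y) = τ * (y * y * y)⁻¹ * x⁻¹ := by
        rw [← mul_assoc, ← mul_assoc, ← S.cen]; group
      rw [this]
      exact P.mul_mem (P.mul_mem S.tP (P.inv_mem S.y3)) (P.inv_mem S.xP)
    · rw [hw, show τ * (y * x * y)⁻¹ * y = τ * y⁻¹ * x⁻¹ by group, mul_smul, S.xinvL0, mul_smul]
      ext v
      rw [mem_sm, mem_sm, mem_sm, mem_sm]
      have : y⁻¹ • y⁻¹ • v = y⁻¹⁻¹ • τ⁻¹ • v := by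
        rw [inv_inv, inv_smul_eq_iff, inv_smul_eq_iff, S.hy3, ← S.ht, smul_inv_smul]
      rw [this]
  · have e3 : M3 = x • y • L0 := H.eq (S.xK S.yL0)
    have ec : ((y * y : G) : G ⧸ P) = ((x * y : G) : G ⧸ P) := by
      rw [QuotientGroup.eq]
      have : (y * y)⁻¹ * (x * y) = (y * y * y)⁻¹ * (y * x * y) := by group
      rw [this]; exact P.mul_mem (P.inv_mem S.y3) S.wP
    refine ⟨_, ?_, Or.inl ⟨ec, ?_, ?_⟩⟩
    · rw [e3, ← mul_smul]; exact S.xe S.xP S.xL0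
    · rw [e3, ← mul_smul, S.fr_mk, inv_smul_smul]; exact cusp_L0
    · rw [hw, ← mul_smul, S.fr_mk, inv_smul_smul]; exact cusp_L0

lemma Setup.dm (S : Setup x y τ P) : ∀ u : ZMod 2 × ZMod 2 × ZMod 2, u ≠ 0 → Dm P y u := by
  rintro ⟨a, b, c⟩ h
  have h110 : Dm P y (1, 1, 0) := S.dmx (by exact S.dm2)
  have h001 : Dm P y (0, 0, 1) := S.dmx (by exact S.dm3)
  have h011 : Dm P y (0, 1, 1) := S.dmx (by exact h001)
  have h101 : Dm P y (1, 0, 1) := S.dmx (by exact h011)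
  rcases z2 a with rfl | rfl <;> rcases z2 b with rfl | rfl <;> rcases z2 c with rfl | rfl
  · exact absurd rfl h
  · exact h001
  · exact S.dm2
  · exact h011
  · exact S.dm1
  · exact h101
  · exact h110
  · exact S.dm3

lemma Setup.dia (S : Setup x y τ P) {K M M1 M2} {c : G ⧸ P} (hf : Fr P K c) (l : Lat K) (h1 : Cov M M1) (h1' : Cov M1 K)
    (h2 : Cov M M2) (h2' : Cov M2 K) (hne : M1 ≠ M2) :
    ∃ cs, ∀ M3, Cov M M3 → Cov M3 K → ∃ c3, Rel P y K c M3 c3 ∧ Rel P y M3 c3 M cs := by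
  obtain ⟨g, rfl, hd | e⟩ := S.nf hf l h1'.tst'
  · refine ⟨(g : G ⧸ P), fun M3 h3 h3' => ⟨(g : G ⧸ P), ?_⟩⟩
    have k3 : Fr P M3 (g : G ⧸ P) := S.fr_mk.2 (hd.cusp (h3'.sm g⁻¹).le (h3'.sm g⁻¹).tl)
    have k : Fr P M (g : G ⧸ P) := by
      refine S.fr_mk.2 (hd.cusp (((h1.sm g⁻¹).le).trans (h1'.sm g⁻¹).le) fun v hv => ?_)
      rw [h1.inf h2 hne]
      have i1 := (h1'.sm g⁻¹).tl v hv
      have i2 := (h2'.sm g⁻¹).tl v hv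
      rw [mem_sm] at i1 i2 ⊢
      exact ⟨i1, i2⟩
    exact ⟨Or.inl ⟨rfl, hf, k3⟩, Or.inl ⟨rfl, k3, k⟩⟩
  · have k1 := h1.sm g⁻¹
    have k1' := h1'.sm g⁻¹
    have k2 := h2.sm g⁻¹
    have k2' := h2'.sm g⁻¹
    rw [e, inv_smul_smul] at k1' k2'
    have hne' : g⁻¹ • M1 ≠ g⁻¹ • M2 := fun h => hne (by simpa using h)
    obtain ⟨u, hu, hN⟩ := inf_isN k1' k2' hne' (k1.inf k2 hne')
    obtain ⟨cs, hcs⟩ := S.dm u hu _ hN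
    refine ⟨g • cs, fun M3 h3 h3' => ?_⟩
    have k3 := h3.sm g⁻¹
    have k3' := h3'.sm g⁻¹
    rw [e, inv_smul_smul] at k3'
    obtain ⟨c3, i, j⟩ := hcs _ k3.le k3'
    have i := i.smul g
    have j := j.smul g
    rw [smul_inv_smul, ← e, coe_smul1] at i
    rw [smul_inv_smul, smul_inv_smul] at j
    exact ⟨_, i, j⟩

end S
end BB

namespace BB
open scoped Pointwise

section S
set_option linter.unusedSectionVars false
variable {G : Type*} [Group G] [DistribMulAction G V] [SMulCommClass G R2 V]
variable {x y τ : G} {P : Subgroup G}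

inductive Reach (P : Subgroup G) (y : G) : ℕ → AddSubgroup V → G ⧸ P → Prop
  | base : Reach P y 0 L0 ((1 : G) : G ⧸ P)
  | step {n M' M c' c} : Reach P y n M' c' → Cov M M' → Rel P y M' c' M c → Reach P y (n + 1) M c

lemma Reach.lat {n M} {c : G ⧸ P} (h : Reach P y n M c) : Lat M := by
  induction h with
  | base => exact lat_L0
  | step _ h _ ih => exact ih.cov h

lemma Reach.le {n M} {c : G ⧸ P} (h : Reach P y n M c) : M ≤ L0 := by
  induction h with
  | base => exact le_rfl
  | step _ h _ ih => exact h.le.trans ih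

lemma Reach.fr {n M} {c : G ⧸ P} (h : Reach P y n M c) : Fr P M c := by
  cases h with
  | base => exact frL0
  | step _ _ h => exact h.fr

lemma Reach.zero {M} {c : G ⧸ P} (h : Reach P y 0 M c) : M = L0 ∧ c = ((1 : G) : G ⧸ P) := by
  cases h; exact ⟨rfl, rfl⟩

lemma Reach.succ {n M} {c : G ⧸ P} (h : Reach P y (n + 1) M c) :
    ∃ M' c', Reach P y n M' c' ∧ Cov M M' ∧ Rel P y M' c' M c := by
  cases h with
  | step h1 h2 h3 => exact ⟨_, _, h1, h2, h3⟩

lemma Setup.claim (S : Setup x y τ P) (n : ℕ) : ∀ {M M2} {c : G ⧸ P}, Reach P y (n + 1) M c → Cov M M2 → M2 ≤ L0 →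
    ∃ c2, Reach P y n M2 c2 ∧ Rel P y M2 c2 M c := by
  induction n with
  | zero =>
    intro M M2 c h h2 hle
    obtain ⟨M', c', h1, h3, h4⟩ := h.succ
    obtain ⟨rfl, rfl⟩ := h1.zero
    rcases h3.squeeze h2.le hle with e | e
    · exact absurd e.symm h2.ne
    · subst e; exact ⟨_, Reach.base, h4⟩
  | succ k ih =>
    intro M M2 c h h2 hle
    obtain ⟨M', c', h1, h3, h4⟩ := h.succ
    by_cases e : M' = M2
    · subst e; exact ⟨_, h1, h4⟩
    · have k1 := h3.sup h2 e
      have k2 := h2.sup h3 (Ne.symm e)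
      rw [sup_comm] at k2
      obtain ⟨cK, r1, r2⟩ := ih h1 k1 (sup_le h1.le hle)
      obtain ⟨cs, H⟩ := S.dia r1.fr r1.lat h3 k1 h2 k2 e
      obtain ⟨c3, i, j⟩ := H _ h3 k1
      obtain rfl := S.det i r2
      obtain rfl := S.det j h4
      obtain ⟨c2, i2, j2⟩ := H _ h2 k2
      exact ⟨c2, r1.step k2 i2, j2⟩

lemma Setup.uniq (S : Setup x y τ P) {n n' M} {c c' : G ⧸ P} (h : Reach P y n M c) (h' : Reach P y n' M c') : c = c' := by
  induction h generalizing n' c' with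
  | base =>
    cases n' with
    | zero => exact h'.zero.2.symm
    | succ m =>
      obtain ⟨M', d, h1, h3, h4⟩ := h'.succ
      exact absurd (le_antisymm h3.le h1.le) h3.ne
  | step r cv rl ih =>
    cases n' with
    | zero => 
      obtain ⟨rfl, rfl⟩ := h'.zero
      exact absurd (le_antisymm cv.le r.le) cv.ne
    | succ m =>
      obtain ⟨c2, r2, j2⟩ := S.claim m h' cv r.le
      obtain rfl := ih r2
      exact S.det rl j2

lemma Setup.stepy (S : Setup x y τ P) {n} {g : G} (h : Reach P y n (g • L0) (g : G ⧸ P)) :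
    Reach P y (n + 1) ((g * y) • L0) ((g * y : G) : G ⧸ P) := by
  refine h.step ?_ (Or.inr ⟨g, rfl, rfl, rfl, rfl⟩)
  rw [mul_smul]
  exact ((S.yL0).cov (by decide)).sm g

lemma Setup.y3L0 (S : Setup x y τ P) : y • y • y • L0 = τ • L0 := by
  ext v
  rw [mem_sm, mem_sm, mem_sm, mem_sm]
  have : y⁻¹ • y⁻¹ • y⁻¹ • v = τ⁻¹ • v := by
    rw [inv_smul_eq_iff, inv_smul_eq_iff, inv_smul_eq_iff, S.hy3, ← S.ht, smul_inv_smul]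
  rw [this]

lemma Setup.stept (S : Setup x y τ P) {n} {g : G} (h : Reach P y n (g • L0) (g : G ⧸ P)) :
    Reach P y (n + 3) ((g * τ) • L0) ((g * τ : G) : G ⧸ P) := by
  have := S.stepy (S.stepy (S.stepy h))
  have e1 : (g * y * y * y) • L0 = (g * τ) • L0 := by
    rw [mul_smul, mul_smul, mul_smul, S.y3L0, mul_smul]
  have e2 : ((g * y * y * y : G) : G ⧸ P) = ((g * τ : G) : G ⧸ P) := by
    rw [QuotientGroup.eq, show (g * y * y * y)⁻¹ * (g * τ) = (y * y * y)⁻¹ * τ by group]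
    exact P.mul_mem (P.inv_mem S.y3) S.tP
  rwa [e1, e2] at this

lemma Setup.steptn (S : Setup x y τ P) {g : G} (h : ∃ n, Reach P y n (g • L0) (g : G ⧸ P)) (k : ℕ) :
    ∃ n, Reach P y n ((g * τ ^ k) • L0) ((g * τ ^ k : G) : G ⧸ P) := by
  induction k with
  | zero => simpa using h
  | succ k ih =>
    obtain ⟨n, hn⟩ := ih
    rw [pow_succ, ← mul_assoc]
    exact ⟨_, S.stept hn⟩

lemma Setup.all (S : Setup x y τ P) (g : G) : ∃ (k n : ℕ), Reach P y n ((g * τ ^ k) • L0) ((g * τ ^ k : G) : G ⧸ P) := by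
  have hc : ∀ (k : ℕ) (g : G), τ ^ k * g = g * τ ^ k := fun k g => ((show Commute τ g from S.cen g).pow_left k).eq
  have hg : g ∈ Subgroup.closure {x, y, τ} := by rw [S.gen]; trivial
  have ty : ∀ g : G, (∃ (k n : ℕ), Reach P y n ((g * τ ^ k) • L0) ((g * τ ^ k : G) : G ⧸ P)) →
      (∃ (k n : ℕ), Reach P y n ((g * y * τ ^ k) • L0) ((g * y * τ ^ k : G) : G ⧸ P)) := by
    rintro g ⟨k, n, h⟩
    have := S.stepy h
    rw [mul_assoc, hc, ← mul_assoc] at this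
    exact ⟨_, _, this⟩
  induction hg using Subgroup.closure_induction_right with
  | one => exact ⟨0, 0, by simpa using Reach.base⟩
  | mul_right g hg a ha ih =>
    rcases ha with rfl | rfl | rfl
    · obtain ⟨k, n, h⟩ := ih
      refine ⟨k, n, ?_⟩
      have e : g * a * τ ^ k = g * τ ^ k * a := by rw [mul_assoc, ← hc, ← mul_assoc]
      have e2 : ((g * a * τ ^ k : G) : G ⧸ P) = ((g * τ ^ k : G) : G ⧸ P) := by
        rw [QuotientGroup.eq, e, _root_.mul_inv_rev, inv_mul_cancel_right]
        exact P.inv_mem S.xP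
      rwa [e2, e, mul_smul, S.xL0]
    · exact ty _ ih
    · obtain ⟨k, n, h⟩ := ih
      have := S.stept h
      refine ⟨k, n + 3, ?_⟩
      rw [mul_assoc g, ← hc, ← mul_assoc g]
      exact this
  | mul_inv_cancel g hg a ha ih =>
    rcases ha with rfl | rfl | rfl
    · obtain ⟨k, n, h⟩ := ih
      refine ⟨k, n, ?_⟩
      have e : g * a⁻¹ * τ ^ k = g * τ ^ k * a⁻¹ := by rw [mul_assoc, ← hc, ← mul_assoc]
      have e2 : ((g * a⁻¹ * τ ^ k : G) : G ⧸ P) = ((g * τ ^ k : G) : G ⧸ P) := by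
        rw [QuotientGroup.eq, e, _root_.mul_inv_rev, inv_mul_cancel_right, inv_inv]
        exact S.xP
      rwa [e2, e, mul_smul, S.xinvL0]
    · obtain ⟨k, n, h⟩ := ty _ (ty _ ih)
      refine ⟨k + 1, n, ?_⟩
      have e1 : (g * a⁻¹ * τ ^ (k + 1)) • L0 = (g * a * a * τ ^ k) • L0 := by
        rw [pow_succ, ← mul_assoc, mul_smul _ τ, ← S.y3L0, ← mul_smul, ← mul_smul, ← mul_smul]
        congr 1
        rw [← hc, ← hc]
        group
      have e2 : ((g * a⁻¹ * τ ^ (k + 1) : G) : G ⧸ P) = ((g * a * a * τ ^ k : G) : G ⧸ P) := by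
        rw [QuotientGroup.eq]
        have : (g * a⁻¹ * τ ^ (k + 1))⁻¹ * (g * a * a * τ ^ k) = (τ ^ (k + 1))⁻¹ * (a * a * a) * τ ^ k := by
          group
        rw [this]
        exact P.mul_mem (P.mul_mem (P.inv_mem (P.pow_mem S.tP _)) S.y3) (P.pow_mem S.tP _)
      rwa [e1, e2]
    · obtain ⟨k, n, h⟩ := ih
      refine ⟨k + 1, n, ?_⟩
      rw [pow_succ', ← mul_assoc, inv_mul_cancel_right]
      exact h

theorem Setup.thmC (S : Setup x y τ P) (g : G) (hg : ∀ v : V, g • v = v) : g ∈ P := by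
  obtain ⟨k, n, h⟩ := S.all g
  obtain ⟨n', h'⟩ := S.steptn (g := 1) ⟨0, by simpa using Reach.base⟩ k
  have e : (g * τ ^ k) • L0 = (1 * τ ^ k) • L0 := by
    rw [mul_smul, one_mul]
    ext v
    rw [mem_sm]
    have : g⁻¹ • v = v := by rw [inv_smul_eq_iff, hg]
    rw [this]
  rw [e] at h
  have := S.uniq h h'
  rw [QuotientGroup.eq] at this
  have e : ((g * τ ^ k)⁻¹ * (1 * τ ^ k)) = (τ ^ k)⁻¹ * g⁻¹ * τ ^ k := by group
  rw [e] at this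
  have h2 := P.mul_mem (P.mul_mem (P.pow_mem S.tP k) this) (P.inv_mem (P.pow_mem S.tP k))
  have e : τ ^ k * ((τ ^ k)⁻¹ * g⁻¹ * τ ^ k) * (τ ^ k)⁻¹ = g⁻¹ := by group
  rw [e] at h2
  simpa using h2

end S
end BB

namespace BB

section Q
variable {Q : Type*} [Group Q]

/-- the sequence attached to `x, w` -/
def ys (x w : Q) : ℕ → Q
  | 0 => x
  | n + 1 => br w (ys x w n)

def uu (x w : Q) (k : ℤ) : Q := w ^ (-k) * x * w ^ k

lemma uu_zero (x w : Q) : uu x w 0 = x := by simp [uu]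

lemma uu_conj (x w : Q) (k : ℤ) : w⁻¹ * uu x w k * w = uu x w (k + 1) := by
  unfold uu
  rw [neg_add, _root_.zpow_add, add_comm k 1, _root_.zpow_add]
  have : w ^ (-k) * w ^ (-1 : ℤ) = w ^ (-1 : ℤ) * w ^ (-k) := (Commute.zpow_zpow_self w _ _).eq
  rw [this]
  simp [mul_assoc]
  exact ((Commute.refl w).zpow_left k).eq

lemma uu_conj' (x w : Q) (n k : ℤ) : w ^ (-n) * uu x w k * w ^ n = uu x w (k + n) := by
  unfold uu
  rw [show -(k + n) = -n + -k by ring, _root_.zpow_add, _root_.zpow_add]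
  simp only [mul_assoc]

def Us (x w : Q) (a b : ℕ) : Set Q := {g | ∃ k : ℕ, a ≤ k ∧ k ≤ b ∧ g = uu x w k}

lemma Us_conj {x w : Q} {a b : ℕ} {g} (hg : g ∈ Subgroup.closure (Us x w a b)) :
    w⁻¹ * g * w ∈ Subgroup.closure (Us x w (a + 1) (b + 1)) := by
  induction hg using Subgroup.closure_induction with
  | mem g hg =>
    obtain ⟨k, h1, h2, rfl⟩ := hg
    rw [uu_conj]
    exact Subgroup.subset_closure ⟨k + 1, by omega, by omega, by push_cast; rfl⟩
  | one => simpa using Subgroup.one_mem _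
  | mul g g' _ _ h h' =>
    have := Subgroup.mul_mem _ h h'
    convert this using 1; group
  | inv g _ h =>
    have := Subgroup.inv_mem _ h
    convert this using 1; group

lemma comm_of_closure {S : Set Q} (h : ∀ a ∈ S, ∀ b ∈ S, a * b = b * a) {a b} (ha : a ∈ Subgroup.closure S)
    (hb : b ∈ Subgroup.closure S) : a * b = b * a := by
  induction ha, hb using Subgroup.closure_induction₂ with
  | mem a b ha hb => exact h a ha b hb
  | one_left b _ => simp
  | one_right a _ => simp
  | mul_left a b c _ _ _ h1 h2 => exact (Commute.mul_left (h1 : Commute _ _) h2).eq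
  | mul_right a b c _ _ _ h1 h2 => exact (Commute.mul_right (h1 : Commute _ _) h2).eq
  | inv_left a b _ _ h1 => exact (Commute.inv_left (h1 : Commute _ _)).eq
  | inv_right a b _ _ h1 => exact (Commute.inv_right (h1 : Commute _ _)).eq

lemma sq_of_closure {S : Set Q} (h : ∀ a ∈ S, ∀ b ∈ S, a * b = b * a) (h2 : ∀ a ∈ S, a * a = 1)
    {a} (ha : a ∈ Subgroup.closure S) : a * a = 1 := by
  induction ha using Subgroup.closure_induction with
  | mem a ha => exact h2 a ha
  | one => simp
  | mul a b ha hb h3 h4 =>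
    have := comm_of_closure h ha hb
    calc a * b * (a * b) = a * (b * a) * b := by group
      _ = (a * a) * (b * b) := by rw [← this]; group
      _ = 1 := by rw [h3, h4, one_mul]
  | inv a _ h => rw [← _root_.mul_inv_rev, h, inv_one]

lemma uu_comm {x w : Q} {j : ℕ} (h : ∀ i : ℕ, i < j → uu x w i * x = x * uu x w i) {a b : ℕ} (hab : b < a + j) :
    ∀ g ∈ Us x w a b, ∀ g' ∈ Us x w a b, g * g' = g' * g := by
  have key : ∀ k i : ℕ, i < j → uu x w (k + i : ℕ) * uu x w k = uu x w k * uu x w (k + i : ℕ) := by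
    intro k i hi
    have := h i hi
    have e1 := uu_conj' x w k i
    have e2 := uu_conj' x w k 0
    rw [uu_zero, zero_add] at e2
    push_cast
    rw [add_comm (k : ℤ), ← e1, ← e2]
    have e3 : ∀ a b : Q, w ^ (-k : ℤ) * a * w ^ (k : ℤ) * (w ^ (-k : ℤ) * b * w ^ (k : ℤ)) = w ^ (-k : ℤ) * (a * b) * w ^ (k : ℤ) := by
      intro a b; group
    rw [e3, e3, this]
  rintro _ ⟨k, h1, h2, rfl⟩ _ ⟨l, h3, h4, rfl⟩
  rcases le_total k l with hkl | hkl
  · obtain ⟨i, rfl⟩ := Nat.exists_eq_add_of_le hkl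
    exact (key k i (by omega)).symm
  · obtain ⟨i, rfl⟩ := Nat.exists_eq_add_of_le hkl
    exact (key l i (by omega))

lemma uu_sq {x w : Q} (hx : x * x = 1) (k : ℤ) : uu x w k * uu x w k = 1 := by
  unfold uu
  rw [show w ^ (-k) * x * w ^ k * (w ^ (-k) * x * w ^ k) = w ^ (-k) * (x * x) * w ^ k by group, hx]
  group

lemma Us_mono {x w : Q} {a b a' b' : ℕ} (h1 : a' ≤ a) (h2 : b ≤ b') :
    Subgroup.closure (Us x w a b) ≤ Subgroup.closure (Us x w a' b') := by
  apply Subgroup.closure_mono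
  rintro _ ⟨k, h3, h4, rfl⟩
  exact ⟨k, by omega, by omega, rfl⟩

lemma mem_Us {x w : Q} {a b k : ℕ} (h1 : a ≤ k) (h2 : k ≤ b) : uu x w k ∈ Subgroup.closure (Us x w a b) :=
  Subgroup.subset_closure ⟨k, h1, h2, rfl⟩

lemma ys_form {x w : Q} (hx : x * x = 1) {j : ℕ} (h : ∀ i : ℕ, i < j → uu x w i * x = x * uu x w i) (m : ℕ) (hm : m + 1 ≤ j) :
    ∃ r ∈ Subgroup.closure (Us x w 1 m), ys x w (m + 1) = uu x w (m + 1 : ℕ) * r * uu x w (0 : ℕ) := by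
  induction m with
  | zero =>
    refine ⟨1, Subgroup.one_mem _, ?_⟩
    have := uu_conj x w 0
    rw [uu_zero, zero_add] at this
    have e : x⁻¹ = x := inv_eq_of_mul_eq_one_left hx
    simp only [ys, br, e, Nat.cast_zero, uu_zero, mul_one]
    rw [this]; rfl
  | succ m ih =>
    obtain ⟨r, hr, e⟩ := ih (by omega)
    set X := ys x w (m + 1) with hX
    have hmem : X ∈ Subgroup.closure (Us x w 0 (m + 1)) := by
      rw [e]
      exact Subgroup.mul_mem _ (Subgroup.mul_mem _ (mem_Us (by omega) le_rfl) (Us_mono (by omega) (by omega) hr)) (mem_Us le_rfl (by omega))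
    have hsq := sq_of_closure (uu_comm h (by omega)) (by rintro _ ⟨k, _, _, rfl⟩; exact uu_sq hx k) hmem
    have hinv : X⁻¹ = X := inv_eq_of_mul_eq_one_left hsq
    refine ⟨w⁻¹ * r * w * uu x w (1 : ℕ) * uu x w (m + 1 : ℕ) * r, ?_, ?_⟩
    · refine Subgroup.mul_mem _ (Subgroup.mul_mem _ (Subgroup.mul_mem _ ?_ (mem_Us le_rfl (by omega))) (mem_Us (by omega) le_rfl)) ?_
      · exact Us_mono (by omega) (by omega) (Us_conj hr)
      · exact Us_mono (by omega) (by omega) hr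
    · have : ys x w (m + 1 + 1) = w⁻¹ * X⁻¹ * w * X := rfl
      rw [this, hinv, e]
      have e1 := uu_conj x w (m + 1 : ℕ)
      have e2 := uu_conj x w (0 : ℕ)
      push_cast at e1 e2 ⊢
      rw [← e1]
      rw [← e2]
      group

lemma ys_sq {x w : Q} (hx : x * x = 1) {m : ℕ} (h : ∀ i : ℕ, i < m + 1 → uu x w i * x = x * uu x w i) :
    ys x w (m + 1) * ys x w (m + 1) = uu x w (m + 1 : ℕ) * x * (uu x w (m + 1 : ℕ) * x) := by
  obtain ⟨r, hr, e⟩ := ys_form hx h m le_rfl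
  have hsq := sq_of_closure (uu_comm h (by omega)) (by rintro _ ⟨k, _, _, rfl⟩; exact uu_sq hx k) hr
  have c1 := comm_of_closure (uu_comm h (a := 1) (b := m + 1) (by omega)) (Us_mono le_rfl (by omega) hr) (mem_Us (by omega) le_rfl)
  have c2 := comm_of_closure (uu_comm h (a := 0) (b := m) (by omega)) (Us_mono (by omega) le_rfl hr) (mem_Us (k := 0) le_rfl (by omega))
  rw [e]
  rw [show ((0 : ℕ) : ℤ) = 0 from rfl, uu_zero] at *
  generalize uu x w ((m + 1 : ℕ) : ℤ) = u at *
  calc u * r * x * (u * r * x) = u * (r * x) * (u * r) * x := by group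
    _ = u * x * ((r * u) * r) * x := by rw [c2]; group
    _ = u * x * u * (r * r) * x := by rw [c1]; group
    _ = _ := by rw [hsq]; group

lemma map_uu {x w : Q} {H : Type*} [Group H] (f : Q →* H) (k : ℤ) : f (uu x w k) = uu (f x) (f w) k := by
  simp [uu]

lemma map_ys {x w : Q} {H : Type*} [Group H] (f : Q →* H) (k : ℕ) : f (ys x w k) = ys (f x) (f w) k := by
  induction k with
  | zero => rfl
  | succ k ih => simp only [ys, br, map_mul, map_inv, ih]

end Q
end BB

namespace BB
section Q
set_option linter.unusedSectionVars false
variable {Q : Type*} [Group Q] [DistribMulAction Q V] [SMulCommClass Q R2 V]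

structure SA (x w : Q) : Prop where
  hx : ∀ p q r, x • ((p, q, r) : V) = (T 1 : R2) • (p + q, q + r, r)
  hw : ∀ p q r, w • ((p, q, r) : V) = (T 3 : R2) • (T 1 * p, q + r, T 1 * r)
  gen : Subgroup.closure {x, w} = ⊤
  sw : x * x * w = w * (x * x)
  r1 : ∀ j, ys x w (j + 1) ^ 4 = 1
  r2 : ∀ j, ys x w (j + 1) ^ 2 * w = w * ys x w (j + 1) ^ 2

variable {x w : Q}

lemma SA.cen (S : SA x w) {g : Q} (h1 : g * x = x * g) (h2 : g * w = w * g) (h : Q) : g * h = h * g := by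
  have hh : h ∈ Subgroup.closure {x, w} := by rw [S.gen]; trivial
  induction hh using Subgroup.closure_induction with
  | mem h hh => rcases hh with rfl | rfl <;> assumption
  | one => simp
  | mul a b _ _ ha hb => exact (Commute.mul_right (ha : Commute _ _) hb).eq
  | inv a _ ha => exact (Commute.inv_right (ha : Commute _ _)).eq

lemma SA.scen (S : SA x w) (h : Q) : x * x * h = h * (x * x) := S.cen (by group) S.sw h

lemma act_zpow {g : Q} {v : V} {a : ℤ} (h : g • v = (T a : R2) • v) (k : ℤ) : g ^ k • v = (T (a * k) : R2) • v := by
  induction k using Int.induction_on with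
  | zero => simp [T_zero]
  | succ k ih =>
    rw [_root_.zpow_add_one, mul_smul, h, smul_comm, ih, smul_smul, TT]; congr 2; ring
  | pred k ih =>
    have h' : g⁻¹ • v = (T (-a) : R2) • v := by
      rw [inv_smul_eq_iff, smul_comm, h, smul_smul, TT]; simp [T_zero]
    rw [_root_.zpow_sub_one, mul_smul, h', smul_comm, ih, smul_smul, TT]; congr 2; ring

lemma T_inj {a b : ℤ} (h : (T a : R2) = T b) : a = b := by
  have h1 : IsP b (T a : R2) := by rw [h]; exact IsP.T b
  have h2 : IsP a (T b : R2) := by rw [← h]; exact IsP.T a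
  exact le_antisymm (isP_T_iff.1 h2) (isP_T_iff.1 h1)

lemma SA.s0 (S : SA x w) {k : ℤ} (h : (x * x) ^ k = 1) : k = 0 := by
  have h1 : x • ((1, 0, 0) : V) = (T 1 : R2) • (1, 0, 0) := by rw [S.hx]; simp
  have h2 : (x * x) • ((1, 0, 0) : V) = (T 2 : R2) • (1, 0, 0) := by
    rw [mul_smul, h1, smul_comm, h1, smul_smul, TT]; rfl
  have := act_zpow h2 k
  rw [h, one_smul] at this
  have := congrArg Prod.fst this
  simp only [Prod.smul_fst, smul_eq_mul, mul_one] at this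
  rw [← T_zero] at this
  have := T_inj this
  omega

def Zst (x w : Q) (S : SA x w) : Subgroup Q where
  carrier := {ζ | (∀ h, ζ * h = h * ζ) ∧ ∃ m : ℤ, ζ * ζ = (x * x) ^ m}
  one_mem' := ⟨by simp, 0, by simp⟩
  mul_mem' := by
    rintro a b ⟨h1, m, h2⟩ ⟨h3, n, h4⟩
    refine ⟨fun h => (Commute.mul_left (h1 h : Commute _ _) (h3 h)).eq, m + n, ?_⟩
    rw [_root_.zpow_add, ← h2, ← h4, mul_assoc, ← mul_assoc b, h3 a]; group
  inv_mem' := by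
    rintro a ⟨h1, m, h2⟩
    refine ⟨fun h => (Commute.inv_left (h1 h : Commute _ _)).eq, -m, ?_⟩
    rw [_root_.zpow_neg, ← h2]; group

instance (S : SA x w) : (Zst x w S).Normal := ⟨by
  rintro a ⟨h1, h2⟩ g
  rw [← h1 g, mul_inv_cancel_right]
  exact ⟨h1, h2⟩⟩

lemma SA.uusq (S : SA x w) (k : ℤ) : uu x w k * uu x w k = x * x := by
  unfold uu
  rw [show w ^ (-k) * x * w ^ k * (w ^ (-k) * x * w ^ k) = w ^ (-k) * (x * x) * w ^ k by group, ← S.scen]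
  group

/-- commutators -/
def cc (x w : Q) (j : ℕ) : Q := br (uu x w (j + 1 : ℕ)) x

lemma SA.cc_cen (S : SA x w) (j : ℕ) : (∀ h, cc x w j * h = h * cc x w j) ∧ cc x w j * cc x w j = 1 := by
  induction j using Nat.strong_induction_on with
  | _ j ih =>
    set π := QuotientGroup.mk' (Zst x w S) with hπ
    have hxx : π x * π x = 1 := by
      rw [← map_mul, ← MonoidHom.mem_ker, QuotientGroup.ker_mk']
      exact ⟨S.scen, 2, (zpow_two _).symm⟩
    have hcom : ∀ i : ℕ, i < j + 1 → uu (π x) (π w) i * π x = π x * uu (π x) (π w) i := by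
      intro i hi
      cases i with
      | zero => rw [show ((0 : ℕ) : ℤ) = 0 from rfl, uu_zero]
      | succ i =>
        have h1 : π (cc x w i) = 1 := by
          rw [← MonoidHom.mem_ker, QuotientGroup.ker_mk']
          exact ⟨(ih i (by omega)).1, 0, by simpa using (ih i (by omega)).2⟩
        rw [cc, br, map_mul, map_mul, map_mul, map_inv, map_inv, map_uu] at h1
        generalize uu (π x) (π w) _ = u at *
        calc u * π x = π x * u * (u⁻¹ * (π x)⁻¹ * u * π x) := by group
          _ = _ := by rw [h1, mul_one]
    have hsq := ys_sq hxx hcom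
    rw [← map_uu, ← map_ys, ← map_mul, ← map_mul, ← map_mul] at hsq
    have hζ := (QuotientGroup.eq (s := Zst x w S)).1 hsq
    set Y' := ys x w (j + 1) with hY
    set u := uu x w (j + 1 : ℕ) with hu
    have huu : u * u = x * x := S.uusq _
    obtain ⟨ζ, hζe⟩ : ∃ ζ, ζ = (Y' * Y')⁻¹ * (u * x * (u * x)) := ⟨_, rfl⟩
    rw [← hζe] at hζ
    obtain ⟨z1, m, z2⟩ := hζ
    have hd : u * x * (u * x) = Y' * Y' * ζ := by rw [hζe]; group
    set c := cc x w j with hc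
    have c1 : x * x * (x * x) * c = u * x * (u * x) := by
      rw [hc, cc, br, ← hu]
      calc x * x * (x * x) * (u⁻¹ * x⁻¹ * u * x) = (x * x) * (x * x * (u⁻¹ * x⁻¹)) * u * x := by group
        _ = (x * x * (u⁻¹ * x⁻¹)) * (x * x) * u * x := by rw [S.scen (x * x * (u⁻¹ * x⁻¹))]
        _ = u * u * u⁻¹ * x * u * x := by rw [huu]; group
        _ = _ := by group
    have c2 : c = (x * x * (x * x))⁻¹ * (Y' * Y') * ζ := by rw [mul_assoc, ← hd, ← c1]; group
    have hs2 : ∀ h, (x * x * (x * x))⁻¹ * h = h * (x * x * (x * x))⁻¹ := fun h =>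
      (Commute.inv_left (Commute.mul_left (S.scen h : Commute _ _) (S.scen h))).eq
    have hyw : Y' * Y' * w = w * (Y' * Y') := by have := S.r2 j; rwa [pow_two] at this
    have hy4 : Y' * Y' * (Y' * Y') = 1 := by
      have := S.r1 j
      rw [← hY] at this
      simpa [pow_succ, mul_assoc] using this
    have cw : c * w = w * c := by
      rw [c2]
      exact ((Commute.mul_left (Commute.mul_left (hs2 w : Commute _ _) hyw) (z1 w))).eq
    have csq : c * c = (x * x) ^ (m - 4) := by
      have : c * c = (x * x * (x * x))⁻¹ * (x * x * (x * x))⁻¹ * (Y' * Y' * (Y' * Y')) * (ζ * ζ) := by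
        rw [c2]
        generalize (x * x * (x * x))⁻¹ = S2 at *
        calc S2 * (Y' * Y') * ζ * (S2 * (Y' * Y') * ζ) = S2 * (Y' * Y') * (ζ * (S2 * (Y' * Y'))) * ζ := by group
          _ = S2 * ((Y' * Y') * S2) * (Y' * Y') * (ζ * ζ) := by rw [z1]; group
          _ = _ := by rw [← hs2]; group
      rw [this, hy4, z2]
      generalize x * x = s
      rw [show m - 4 = -2 + -2 + m by ring, _root_.zpow_add, _root_.zpow_add, _root_.zpow_neg, zpow_two, mul_one]
    have cx : x * c * x⁻¹ = c⁻¹ := by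
      rw [hc, cc, br, ← hu]
      have e := S.scen (x⁻¹ * u⁻¹ * x)
      calc x * (u⁻¹ * x⁻¹ * u * x) * x⁻¹ = (x * x * (x⁻¹ * u⁻¹ * x)) * (x * x)⁻¹ * u := by group
        _ = _ := by rw [e]; group
    have c4 : (x * x) ^ (2 * (m - 4)) = 1 := by
      have h1 : x * (c * c) * x⁻¹ = c * c := by
        rw [csq, ← ((show Commute (x * x) x from S.scen x).zpow_left _).eq, mul_inv_cancel_right]
      have h2 : x * (c * c) * x⁻¹ = (c * c)⁻¹ := by
        calc x * (c * c) * x⁻¹ = (x * c * x⁻¹) * (x * c * x⁻¹) := by group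
          _ = _ := by rw [cx]; group
      rw [two_mul, _root_.zpow_add, ← csq]
      nth_rw 1 [← h1]
      rw [h2, inv_mul_cancel]
    have hm := S.s0 c4
    have hm : m - 4 = 0 := by omega
    rw [hm, zpow_zero] at csq
    refine ⟨S.cen ?_ cw, csq⟩
    rw [← eq_inv_of_mul_eq_one_left csq] at cx
    nth_rw 1 [← cx]
    group

end Q
end BB

namespace BB
section Q
set_option linter.unusedSectionVars false
set_option linter.unusedVariables false

lemma consL {Q : Type*} [Group Q] {ι : Type*} [DecidableEq ι] (Z : Subgroup Q) (hZ : ∀ z ∈ Z, ∀ h, z * h = h * z)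
    (f : ι → Q) (hsq : ∀ k, f k * f k ∈ Z) (hc : ∀ k l, ∃ z ∈ Z, f k * f l = z * (f l * f k)) (k : ι) (L : List ι)
    (hL : L.Nodup) : ∃ ζ ∈ Z, ∃ L' : List ι, L'.Nodup ∧ L' ⊆ k :: L ∧ f k * (L.map f).prod = ζ * (L'.map f).prod := by
  induction L with
  | nil => exact ⟨1, Z.one_mem, [k], by simp, by simp, by simp⟩
  | cons a L ih =>
    rw [List.nodup_cons] at hL
    by_cases h : k = a
    · subst h
      exact ⟨f k * f k, hsq k, L, hL.2, by intro z hz; simp [hz], by simp [mul_assoc]⟩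
    · obtain ⟨ζ, hζ, L', h1, h2, h3⟩ := ih hL.2
      obtain ⟨z, hz, e⟩ := hc k a
      refine ⟨z * ζ, Z.mul_mem hz hζ, a :: L', ?_, ?_, ?_⟩
      · rw [List.nodup_cons]
        refine ⟨fun h4 => ?_, h1⟩
        have := h2 h4
        rw [List.mem_cons] at this
        rcases this with h5 | h5
        · exact h h5.symm
        · exact hL.1 h5
      · intro y hy
        rw [List.mem_cons] at hy
        rcases hy with rfl | hy
        · simp
        · have := h2 hy
          rw [List.mem_cons] at this
          rcases this with h5 | h5 <;> simp [h5]
      · rw [List.map_cons, List.prod_cons, List.map_cons, List.prod_cons, ← mul_assoc, e]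
        calc z * (f a * f k) * (L.map f).prod = z * f a * (f k * (L.map f).prod) := by group
          _ = z * (f a * ζ) * (L'.map f).prod := by rw [h3]; group
          _ = _ := by rw [← hZ ζ hζ]; group

variable {Q : Type*} [Group Q] [DistribMulAction Q V] [SMulCommClass Q R2 V] {x w : Q}

def Z1 (x w : Q) : Subgroup Q := Subgroup.closure ({x * x} ∪ Set.range (cc x w))

lemma SA.Z1cen (S : SA x w) : ∀ z ∈ Z1 x w, ∀ h, z * h = h * z := by
  intro z hz h
  induction hz using Subgroup.closure_induction with
  | mem z hz =>
    rcases hz with rfl | ⟨j, rfl⟩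
    · exact S.scen h
    · exact (S.cc_cen j).1 h
  | one => simp
  | mul a b _ _ ha hb => exact (Commute.mul_left (ha : Commute _ _) hb).eq
  | inv a _ ha => exact (Commute.inv_left (ha : Commute _ _)).eq

lemma SA.Z1form (S : SA x w) {ζ} (hζ : ζ ∈ Z1 x w) :
    ∃ a : ℤ, ∃ L : List ℕ, L.Nodup ∧ ζ = (x * x) ^ a * (L.map (cc x w)).prod := by
  have hz : ∀ z ∈ Subgroup.zpowers (x * x), ∀ h, z * h = h * z := by
    rintro _ ⟨a, rfl⟩ h
    exact ((show Commute (x * x) h from S.scen h).zpow_left a).eq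
  have st : ∀ j : ℕ, ∀ y : Q, (∃ a : ℤ, ∃ L : List ℕ, L.Nodup ∧ y = (x * x) ^ a * (L.map (cc x w)).prod) →
      (∃ a : ℤ, ∃ L : List ℕ, L.Nodup ∧ cc x w j * y = (x * x) ^ a * (L.map (cc x w)).prod) := by
    rintro j y ⟨a, L, hL, rfl⟩
    obtain ⟨_, ⟨b, rfl⟩, L', h1, -, h2⟩ := consL (Subgroup.zpowers (x * x)) hz (cc x w)
      (fun k => by rw [(S.cc_cen k).2]; exact Subgroup.one_mem _)
      (fun k l => ⟨1, Subgroup.one_mem _, by rw [one_mul, (S.cc_cen k).1]⟩) j L hL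
    refine ⟨a + b, L', h1, ?_⟩
    rw [← mul_assoc, (S.cc_cen j).1, mul_assoc, h2, _root_.zpow_add, mul_assoc]
  induction hζ using Subgroup.closure_induction_left with
  | one => exact ⟨0, [], by simp, by simp⟩
  | mul_left z hz y _ ih =>
    rcases hz with rfl | ⟨j, rfl⟩
    · obtain ⟨a, L, hL, rfl⟩ := ih
      exact ⟨1 + a, L, hL, by rw [_root_.zpow_add, zpow_one]; simp only [mul_assoc]⟩
    · exact st j y ih
  | inv_mul_cancel z hz y _ ih =>
    rcases hz with rfl | ⟨j, rfl⟩
    · obtain ⟨a, L, hL, rfl⟩ := ih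
      exact ⟨-1 + a, L, hL, by rw [_root_.zpow_add, _root_.zpow_neg_one, mul_assoc]⟩
    · rw [← eq_inv_of_mul_eq_one_left (S.cc_cen j).2]
      exact st j y ih

lemma SA.uucomm (S : SA x w) (k l : ℤ) : ∃ z ∈ Z1 x w, uu x w k * uu x w l = z * (uu x w l * uu x w k) := by
  have key : ∀ (l : ℤ) (j : ℕ), uu x w (l + (j + 1 : ℕ)) * uu x w l = cc x w j * (uu x w l * uu x w (l + (j + 1 : ℕ))) := by
    intro l j
    rw [(S.cc_cen j).1]
    have e : w ^ (-l) * cc x w j * w ^ l = cc x w j := by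
      rw [← (S.cc_cen j).1, mul_assoc, ← _root_.zpow_add]; simp
    have e1 := uu_conj' x w l (j + 1 : ℕ)
    have e2 := uu_conj' x w l 0
    rw [uu_zero, zero_add] at e2
    rw [← e, add_comm l, ← e1, ← e2, cc, br]
    group
  have hm : ∀ j, cc x w j ∈ Z1 x w := fun j => Subgroup.subset_closure (Or.inr ⟨j, rfl⟩)
  rcases lt_trichotomy k l with h | h | h
  · obtain ⟨j, hj⟩ := Int.eq_ofNat_of_zero_le (show 0 ≤ l - k - 1 by omega)
    have : l = k + (j + 1 : ℕ) := by push_cast; omega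
    refine ⟨(cc x w j)⁻¹, (Z1 x w).inv_mem (hm j), ?_⟩
    rw [this, key]; group
  · subst h; exact ⟨1, Subgroup.one_mem _, by simp⟩
  · obtain ⟨j, hj⟩ := Int.eq_ofNat_of_zero_le (show 0 ≤ k - l - 1 by omega)
    have : k = l + (j + 1 : ℕ) := by push_cast; omega
    refine ⟨(cc x w j), (hm j), ?_⟩
    rw [this, key]

lemma shiftL (x w : Q) (n : ℤ) (L : List ℤ) : w ^ n * (L.map (uu x w)).prod = ((L.map (· - n)).map (uu x w)).prod * w ^ n := by
  induction L with
  | nil => simp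
  | cons a L ih =>
    simp only [List.map_cons, List.prod_cons]
    rw [mul_assoc, ← ih]
    have := uu_conj' x w (-n) a
    rw [neg_neg] at this
    rw [← _root_.sub_eq_add_neg] at this
    rw [← this]; group

lemma SA.form (S : SA x w) (g : Q) :
    ∃ ζ ∈ Z1 x w, ∃ L : List ℤ, L.Nodup ∧ ∃ l : ℤ, g = ζ * (L.map (uu x w)).prod * w ^ l := by
  have hs : x * x ∈ Z1 x w := Subgroup.subset_closure (Or.inl rfl)
  have st : ∀ y : Q, (∃ ζ ∈ Z1 x w, ∃ L : List ℤ, L.Nodup ∧ ∃ l : ℤ, y = ζ * (L.map (uu x w)).prod * w ^ l) →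
    (∃ ζ ∈ Z1 x w, ∃ L : List ℤ, L.Nodup ∧ ∃ l : ℤ, x * y = ζ * (L.map (uu x w)).prod * w ^ l) := by
    rintro y ⟨ζ, hζ, L, hL, l, rfl⟩
    obtain ⟨z, hz, L', h1, -, h2⟩ := consL (Z1 x w) S.Z1cen (uu x w)
      (fun k => by rw [S.uusq]; exact hs) S.uucomm 0 L hL
    refine ⟨ζ * z, Subgroup.mul_mem _ hζ hz, L', h1, l, ?_⟩
    rw [uu_zero] at h2
    rw [← mul_assoc, ← mul_assoc, ← S.Z1cen ζ hζ, mul_assoc ζ, h2]; group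
  have stw : ∀ (n : ℤ) (y : Q), (∃ ζ ∈ Z1 x w, ∃ L : List ℤ, L.Nodup ∧ ∃ l : ℤ, y = ζ * (L.map (uu x w)).prod * w ^ l) →
    (∃ ζ ∈ Z1 x w, ∃ L : List ℤ, L.Nodup ∧ ∃ l : ℤ, w ^ n * y = ζ * (L.map (uu x w)).prod * w ^ l) := by
    rintro n y ⟨ζ, hζ, L, hL, l, rfl⟩
    refine ⟨ζ, hζ, L.map (· - n), hL.map (sub_left_injective), n + l, ?_⟩
    rw [← mul_assoc, ← mul_assoc, ← S.Z1cen ζ hζ, mul_assoc ζ, shiftL, _root_.zpow_add]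
    simp only [mul_assoc]
  have hg : g ∈ Subgroup.closure {x, w} := by rw [S.gen]; trivial
  induction hg using Subgroup.closure_induction_left with
  | one => exact ⟨1, Subgroup.one_mem _, [], by simp, 0, by simp⟩
  | mul_left z hz y _ ih =>
    rcases hz with rfl | rfl
    · exact st y ih
    · have := stw 1 y ih
      rwa [zpow_one] at this
  | inv_mul_cancel z hz y _ ih =>
    rcases hz with rfl | rfl
    · obtain ⟨ζ, hζ, L, hL, l, e⟩ := st y ih
      refine ⟨(z * z)⁻¹ * ζ, Subgroup.mul_mem _ (Subgroup.inv_mem _ hs) hζ, L, hL, l, ?_⟩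
      calc z⁻¹ * y = (z * z)⁻¹ * (z * y) := by group
        _ = _ := by rw [e]; group
    · have := stw (-1) y ih
      rwa [_root_.zpow_neg_one] at this

end Q
end BB

namespace BB
section Q
set_option linter.unusedSectionVars false
set_option linter.unusedVariables false

variable {Q : Type*} [Group Q] [DistribMulAction Q V] [SMulCommClass Q R2 V] {x w : Q}

def Ract (g : Q) (n : ℤ) (a b c : R2) : Prop :=
  ∀ p q r, g • ((p, q, r) : V) = (T n : R2) • ((p + b * q + c * r, q + a * r, r) : V)

lemma Ract.one : Ract (1 : Q) 0 0 0 0 := by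
  intro p q r
  rw [one_smul, T_zero, one_smul]
  apply ext3 <;> grind

lemma Ract.mul {g h : Q} {n n' a a' b b' c c'} (H : Ract g n a b c) (H' : Ract h n' a' b' c') :
    Ract (g * h) (n + n') (a + a') (b + b') (c + c' + b * a') := by
  intro p q r
  rw [mul_smul, H', smul_comm, H, smul_smul, TT, add_comm n']
  congr 1
  apply ext3 <;> grind

lemma Ract.inv {g : Q} {n a b c} (H : Ract g n a b c) : Ract g⁻¹ (-n) a b (c + a * b) := by
  intro p q r
  rw [inv_smul_eq_iff, smul_comm, H, smul_smul, TT]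
  have := two0
  simp only [neg_add_cancel, T_zero, one_smul]
  apply ext3 <;> grind

lemma Ract.congr {g h : Q} {n n' a a' b b' c c'} (H : Ract g n a b c) (e : g = h) (e1 : n = n') (e2 : a = a') (e3 : b = b') (e4 : c = c') :
    Ract h n' a' b' c' := by subst e e1 e2 e3 e4; exact H

lemma SA.Rx (S : SA x w) : Ract x 1 1 1 0 := by
  intro p q r
  rw [S.hx]
  congr 1
  apply ext3 <;> grind

lemma winvA (hw : ∀ p q r, w • ((p, q, r) : V) = (T 3 : R2) • (T 1 * p, q + r, T 1 * r)) (p q r : R2) : w⁻¹ • ((p, q, r) : V) = (T (-3) : R2) • (T (-1) * p, q + T (-1) * r, T (-1) * r) := by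
  rw [inv_smul_eq_iff, smul_comm, hw, smul_smul, TT]
  have hT : (T 1 : R2) * T (-1) = 1 := T_inv 1
  have := two0
  simp only [neg_add_cancel, T_zero, one_smul]
  apply ext3 <;> grind

lemma RconjA (hw : ∀ p q r, w • ((p, q, r) : V) = (T 3 : R2) • (T 1 * p, q + r, T 1 * r)) {g : Q} {n a b c} (H : Ract g n a b c) :
    ∃ c', Ract (w⁻¹ * g * w) n (T 1 * a) (T (-1) * b) c' := by
  refine ⟨c + T (-1) * b, ?_⟩
  intro p q r
  have hT : (T 1 : R2) * T (-1) = 1 := T_inv 1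
  have := two0
  rw [mul_smul, mul_smul, hw, smul_comm g (T 3 : R2), H, smul_smul, TT, smul_comm w⁻¹, winvA hw, smul_smul, TT]
  rw [show (3:ℤ) + n + -3 = n by ring]
  congr 1
  apply ext3 <;> grind

lemma SA.winv (S : SA x w) (p q r : R2) : w⁻¹ • ((p, q, r) : V) = (T (-3) : R2) • (T (-1) * p, q + T (-1) * r, T (-1) * r) :=
  winvA S.hw p q r

lemma SA.Rconj' (S : SA x w) {g : Q} {n a b c} (H : Ract g n a b c) :
    ∃ c', Ract (w * g * w⁻¹) n (T (-1) * a) (T 1 * b) c' := by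
  refine ⟨c + b, ?_⟩
  intro p q r
  have hT : (T 1 : R2) * T (-1) = 1 := T_inv 1
  have := two0
  rw [mul_smul, mul_smul, S.winv, smul_comm g (T (-3) : R2), H, smul_smul, TT, smul_comm w, S.hw, smul_smul, TT]
  rw [show (-3:ℤ) + n + 3 = n by ring]
  congr 1
  apply ext3 <;> grind

lemma SA.Ruu (S : SA x w) (k : ℤ) : ∃ c, Ract (uu x w k) 1 (T k) (T (-k)) c := by
  induction k using Int.induction_on with
  | zero => exact ⟨0, S.Rx.congr (uu_zero x w).symm rfl (by simp [T_zero]) (by simp [T_zero]) rfl⟩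
  | succ k ih =>
    obtain ⟨c, h⟩ := ih
    obtain ⟨c', h⟩ := RconjA S.hw h
    exact ⟨c', h.congr (uu_conj x w k) rfl (by rw [TT]; congr 1; ring) (by rw [TT]; congr 1; ring) rfl⟩
  | pred k ih =>
    obtain ⟨c, h⟩ := ih
    obtain ⟨c', h⟩ := S.Rconj' h
    refine ⟨c', h.congr ?_ rfl (by rw [TT]; congr 1; ring) (by rw [TT]; congr 1; ring) rfl⟩
    have := uu_conj x w (-k - 1)
    rw [sub_add_cancel] at this
    rw [← this]; group

lemma SA.Rcc (S : SA x w) (j : ℕ) : Ract (cc x w j) 0 0 0 (T (j + 1) + T (-(j + 1))) := by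
  obtain ⟨c, h⟩ := S.Ruu (j + 1 : ℕ)
  have := two0
  have hT : (T (j + 1) : R2) * T (-(j + 1)) = 1 := by rw [TT]; simp [T_zero]
  refine (((h.inv.mul S.Rx.inv).mul h).mul S.Rx).congr rfl (by ring) ?_ ?_ ?_
  all_goals push_cast
  all_goals grind

lemma SA.Rs (S : SA x w) (a : ℤ) : Ract ((x * x) ^ a) (2 * a) 0 0 (a : R2) := by
  have h0 : Ract (x * x) 2 0 0 1 := by
    have := two0
    refine (S.Rx.mul S.Rx).congr rfl rfl ?_ ?_ ?_ <;> grind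
  have := two0
  induction a using Int.induction_on with
  | zero => exact Ract.one.congr (by simp) (by simp) rfl rfl (by simp)
  | succ k ih => exact (ih.mul h0).congr (by rw [_root_.zpow_add_one]) (by ring) (by simp) (by simp) (by push_cast; simp)
  | pred k ih => exact (ih.mul h0.inv).congr (by rw [_root_.zpow_sub_one]) (by ring) (by simp) (by simp) (by push_cast; grind)

lemma SA.Rccs (S : SA x w) (L : List ℕ) :
    Ract (L.map (cc x w)).prod 0 0 0 (L.map (fun j : ℕ => (T (j + 1) + T (-(j + 1)) : R2))).sum := by
  induction L with
  | nil => exact Ract.one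
  | cons j L ih =>
    exact ((S.Rcc j).mul ih).congr (by simp) (by simp) (by simp) (by simp) (by simp)

lemma SA.Ruus (S : SA x w) (L : List ℤ) :
    ∃ n b c, Ract (L.map (uu x w)).prod n (L.map (fun j : ℤ => (T j : R2))).sum b c := by
  induction L with
  | nil => exact ⟨0, 0, 0, Ract.one⟩
  | cons j L ih =>
    obtain ⟨n, b, c, h⟩ := ih
    obtain ⟨c', h'⟩ := S.Ruu j
    exact ⟨_, _, _, (h'.mul h).congr (by simp) rfl (by simp) rfl rfl⟩

lemma sumT (L : List ℤ) (hL : L.Nodup) (m : ℤ) :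
    (L.map (fun j : ℤ => (T j : R2))).sum.coeff m = if m ∈ L then 1 else 0 := by
  induction L with
  | nil => simp
  | cons j L ih =>
    rw [List.nodup_cons] at hL
    simp only [List.map_cons, List.sum_cons, AddMonoidAlgebra.coeff_add, Finsupp.add_apply, ih hL.2, LaurentPolynomial.T_apply, List.mem_cons]
    by_cases h : j = m
    · subst h; simp [hL.1]
    · simp [h, Ne.symm h]

lemma sumTT (L : List ℕ) (hL : L.Nodup) (m : ℕ) :
    (L.map (fun j : ℕ => (T (j + 1) + T (-(j + 1)) : R2))).sum.coeff (m + 1) = if m ∈ L then 1 else 0 := by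
  induction L with
  | nil => simp
  | cons j L ih =>
    rw [List.nodup_cons] at hL
    simp only [List.map_cons, List.sum_cons, AddMonoidAlgebra.coeff_add, Finsupp.add_apply, ih hL.2, LaurentPolynomial.T_apply, List.mem_cons]
    rw [if_neg (show ¬ (-(j + 1 : ℤ) = m + 1) by omega)]
    by_cases h : j = m
    · subst h; simp [hL.1]
    · simp [h, Ne.symm h]

theorem SA.scalar (S : SA x w) {g : Q} {m : ℤ} (hg : ∀ v : V, g • v = (T m : R2) • v) :
    ∃ l : ℤ, g = (x * x * (x * x)) ^ l := by
  obtain ⟨ζ, hζ, L, hL, l, rfl⟩ := S.form g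
  obtain ⟨a, L', hL', rfl⟩ := S.Z1form hζ
  obtain ⟨n, b, c, h⟩ := S.Ruus L
  have H0 := (S.Rs a).mul (S.Rccs L')
  have H := H0.mul h
  have hTne : ∀ k : ℤ, (T k : R2) ≠ 0 := fun k hk => by
    have : (T k : R2) * T (-k) = 1 := by rw [TT]; simp [T_zero]
    rw [hk, zero_mul] at this
    exact zero_ne_one this
  have hl : l = 0 := by
    have w1 : w • ((1, 0, 0) : V) = (T 4 : R2) • (1, 0, 0) := by
      rw [S.hw]
      simp only [Prod.smul_mk, smul_eq_mul, mul_zero, mul_one, add_zero, zero_add, zero_mul, TT]; rfl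
    have w2 : w • ((0, 1, 0) : V) = (T 3 : R2) • (0, 1, 0) := by
      rw [S.hw]
      simp only [Prod.smul_mk, smul_eq_mul, mul_zero, mul_one, add_zero, zero_add, zero_mul]
    have e1 := hg (1, 0, 0)
    have e2 := hg (0, 1, 0)
    rw [mul_smul, act_zpow w1, smul_comm, H, smul_smul, TT] at e1
    rw [mul_smul, act_zpow w2, smul_comm, H, smul_smul, TT] at e2
    have e1 := congrArg (fun v : V => v.1) e1
    have e2 := congrArg (fun v : V => v.2.1) e2
    simp only [Prod.smul_mk, smul_eq_mul, mul_zero, mul_one, add_zero, zero_add, zero_mul] at e1 e2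
    have e1 := T_inj e1
    have e2 := T_inj e2
    omega
  subst hl
  rw [zpow_zero, mul_one] at hg ⊢
  have e3 := hg (0, 0, 1)
  rw [H] at e3
  have hL0 : L = [] := by
    have e3 := congrArg (fun v : V => v.2.1) e3
    simp only [Prod.smul_mk, smul_eq_mul, mul_zero, mul_one, add_zero, zero_add, zero_mul] at e3
    have e3 := (mul_eq_zero.1 e3).resolve_left (hTne _)
    rcases L with _ | ⟨k, L⟩
    · rfl
    · have := sumT (k :: L) hL k
      rw [e3] at this
      simp at this
  subst hL0
  simp only [List.map_nil, List.prod_nil, mul_one] at hg ⊢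
  have e4 := hg (0, 0, 1)
  rw [H0] at e4
  have e4 := congrArg (fun v : V => v.1) e4
  simp only [Prod.smul_mk, smul_eq_mul, mul_zero, mul_one, add_zero, zero_add, zero_mul] at e4
  have e4 := (mul_eq_zero.1 e4).resolve_left (hTne _)
  have hL0 : L' = [] := by
    rcases L' with _ | ⟨k, L⟩
    · rfl
    · have := sumTT (k :: L) hL' k
      have e4 := congrArg (fun f : R2 => f.coeff (k + 1)) e4
      simp only [List.map_cons, List.sum_cons, AddMonoidAlgebra.coeff_add, Finsupp.add_apply] at this e4
      rw [this] at e4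
      have hc : (a : R2).coeff (k + 1 : ℤ) = 0 := by
        rw [← map_intCast (C : ZMod 2 →+* R2), LaurentPolynomial.C_apply, if_neg (by omega)]
      rw [hc] at e4
      simp at e4
  subst hL0
  simp at e4
  obtain ⟨d, rfl⟩ := (CharP.intCast_eq_zero_iff R2 2 a).1 e4
  refine ⟨d, ?_⟩
  simp only [List.map_nil, List.prod_nil, mul_one]
  rw [_root_.zpow_mul]
  congr 1
  exact zpow_two _

end Q
end BB

namespace BB
section Q
set_option linter.unusedSectionVars false
set_option linter.unusedVariables false

variable {G : Type*} [Group G] [DistribMulAction G V] [SMulCommClass G R2 V]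

structure MA (x y : G) : Prop where
  hx : ∀ p q r, x • ((p, q, r) : V) = (T 1 : R2) • (p + q, q + r, r)
  hy : ∀ p q r, y • ((p, q, r) : V) = (T 1 : R2) • (p + q, q + r, (1 + T 1) * p + q)
  gen : Subgroup.closure {x, y} = ⊤
  r0 : x ^ 4 = y ^ 3
  sw : x * x * (y * x * y) = y * x * y * (x * x)
  r1 : ∀ j, ys x (y * x * y) (j + 1) ^ 4 = 1
  r2 : ∀ j, ys x (y * x * y) (j + 1) ^ 2 * (y * x * y) = (y * x * y) * ys x (y * x * y) (j + 1) ^ 2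

variable {x y : G}

lemma MA.hw (S : MA x y) (p q r : R2) : (y * x * y) • ((p, q, r) : V) = (T 3 : R2) • (T 1 * p, q + r, T 1 * r) := by
  have := two0
  rw [mul_smul, mul_smul, S.hy p q r, smul_comm x (T 1 : R2), S.hx, smul_smul, TT, smul_comm y (T (1 + 1) : R2), S.hy, smul_smul, TT]
  rw [show (1 + 1 + 1 : ℤ) = 3 by norm_num]
  congr 1
  apply ext3 <;> grind

lemma MA.scalar (S : MA x y) {g : G} (hg : g ∈ Subgroup.closure {x, y * x * y}) {m : ℤ}
    (h : ∀ v : V, g • v = (T m : R2) • v) : ∃ l : ℤ, g = (x ^ 4) ^ l := by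
  have hxm : x ∈ Subgroup.closure {x, y * x * y} := Subgroup.subset_closure (by simp)
  have hwm : y * x * y ∈ Subgroup.closure {x, y * x * y} := Subgroup.subset_closure (by simp)
  have hys : ∀ j, ((ys (⟨x, hxm⟩ : Subgroup.closure {x, y * x * y}) ⟨y * x * y, hwm⟩ j : Subgroup.closure {x, y * x * y}) : G) = ys x (y * x * y) j :=
    fun j => map_ys (Subgroup.subtype _) j
  have A : SA (⟨x, hxm⟩ : Subgroup.closure {x, y * x * y}) ⟨y * x * y, hwm⟩ := by
    refine ⟨S.hx, S.hw, ?_, ?_, ?_, ?_⟩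
    · rw [← Subgroup.closure_closure_coe_preimage]
      congr 1
      ext ⟨z, hz⟩
      simp
    · exact Subtype.ext S.sw
    · intro j
      apply Subtype.ext
      push_cast [hys]
      exact S.r1 j
    · intro j
      apply Subtype.ext
      push_cast [hys]
      exact S.r2 j
  obtain ⟨l, hl⟩ := A.scalar (g := ⟨g, hg⟩) (m := m) h
  refine ⟨l, ?_⟩
  have := congrArg Subtype.val hl
  simp only [Subgroup.coe_zpow, Subgroup.coe_mul] at this
  rw [this]
  congr 1
  simp [pow_succ, mul_assoc]

lemma MA.zcen (S : MA x y) (h : G) : x ^ 4 * h = h * x ^ 4 := by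
  have hh : h ∈ Subgroup.closure {x, y} := by rw [S.gen]; trivial
  induction hh using Subgroup.closure_induction with
  | mem h hh =>
    rcases hh with rfl | rfl
    · exact ((Commute.refl _).pow_left 4).eq
    · rw [S.r0]; exact ((Commute.refl _).pow_left 3).eq
  | one => simp
  | mul a b _ _ ha hb => exact (Commute.mul_right (ha : Commute _ _) hb).eq
  | inv a _ ha => exact (Commute.inv_right (ha : Commute _ _)).eq

/-- extension of the action by scalars -/
@[reducible] def actZ (G : Type*) [Group G] [DistribMulAction G V] [SMulCommClass G R2 V] :
    DistribMulAction (G × Multiplicative ℤ) V where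
  smul g v := (T g.2.toAdd : R2) • (g.1 • v)
  one_smul v := by
    change (T (0 : ℤ) : R2) • ((1 : G) • v) = v
    rw [T_zero, one_smul, one_smul]
  mul_smul g h v := by
    change (T (g.2.toAdd + h.2.toAdd) : R2) • ((g.1 * h.1) • v) = (T g.2.toAdd : R2) • (g.1 • ((T h.2.toAdd : R2) • (h.1 • v)))
    rw [mul_smul, smul_comm g.1 (T h.2.toAdd : R2), smul_smul (T g.2.toAdd : R2), TT]
  smul_zero g := by
    change (T g.2.toAdd : R2) • (g.1 • (0 : V)) = 0
    rw [smul_zero, smul_zero]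
  smul_add g v w := by
    change (T g.2.toAdd : R2) • (g.1 • (v + w)) = (T g.2.toAdd : R2) • (g.1 • v) + (T g.2.toAdd : R2) • (g.1 • w)
    rw [smul_add, smul_add]

theorem MA.main (S : MA x y) (κ : G) (hκ : ∀ v : V, κ • v = v) : κ = 1 := by
  let := actZ G
  have hdef : ∀ (g : G) (n : Multiplicative ℤ) (v : V), (g, n) • v = (T n.toAdd : R2) • (g • v) := fun _ _ _ => rfl
  have : SMulCommClass (G × Multiplicative ℤ) R2 V := ⟨by
    rintro ⟨g, n⟩ a v
    rw [hdef, hdef, smul_comm g a, smul_smul, smul_smul, mul_comm]⟩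
  let t : Multiplicative ℤ := Multiplicative.ofAdd 1
  let x1 : G × Multiplicative ℤ := (x, t⁻¹)
  let y1 : G × Multiplicative ℤ := (y, t⁻¹)
  let τ1 : G × Multiplicative ℤ := (1, t)
  let P := Subgroup.closure {x1, y1 * x1 * y1, τ1}
  have hPfst : ∀ p ∈ P, p.1 ∈ Subgroup.closure {x, y * x * y} := by
    intro p hp
    have : P ≤ (Subgroup.closure {x, y * x * y}).comap (MonoidHom.fst G (Multiplicative ℤ)) := by
      rw [Subgroup.closure_le]
      rintro _ (rfl | rfl | rfl)
      · exact Subgroup.subset_closure (by simp [x1])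
      · exact Subgroup.subset_closure (by simp [x1, y1])
      · exact Subgroup.one_mem (Subgroup.closure {x, y * x * y})
    exact this hp
  have hx1 : x1 ∈ P := Subgroup.subset_closure (by simp)
  have hτ1 : τ1 ∈ P := Subgroup.subset_closure (by simp)
  have hcen : ∀ g, τ1 * g = g * τ1 := by
    rintro ⟨g, n⟩
    simp only [τ1, Prod.mk_mul_mk, one_mul, mul_one, mul_comm]
  have hinv : Multiplicative.toAdd t⁻¹ = -1 := rfl
  have hT : (T (-1) : R2) * T 1 = 1 := by rw [TT]; simp [T_zero]
  have A : Setup x1 y1 τ1 P := by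
    refine ⟨?_, ?_, ?_, ?_, hcen, rfl, ?_, ?_⟩
    · intro p q r
      rw [hdef, S.hx, smul_smul, hinv, hT, one_smul]
    · intro p q r
      rw [hdef, S.hy, smul_smul, hinv, hT, one_smul]
    · intro v
      rw [hdef, one_smul]; rfl
    · rw [eq_top_iff]
      rintro ⟨g, n⟩ -
      set H := Subgroup.closure {x1, y1, τ1} with hH
      have h1 : x1 ∈ H := Subgroup.subset_closure (by simp)
      have h2 : y1 ∈ H := Subgroup.subset_closure (by simp)
      have h3 : τ1 ∈ H := Subgroup.subset_closure (by simp)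
      have hg : Subgroup.closure {x, y} ≤ H.comap (MonoidHom.inl G (Multiplicative ℤ)) := by
        rw [Subgroup.closure_le]
        rintro _ (rfl | rfl)
        · have := H.mul_mem h1 h3
          simpa [x1, τ1] using this
        · have := H.mul_mem h2 h3
          simpa [y1, τ1] using this
      have h4 : (g, (1 : Multiplicative ℤ)) ∈ H := hg (by rw [S.gen]; trivial)
      have h5 := H.mul_mem h4 (H.zpow_mem h3 n.toAdd)
      have h6 : t ^ (Multiplicative.toAdd n) = n := by
        rw [← ofAdd_zsmul, smul_eq_mul, mul_one, ofAdd_toAdd]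
      have h7 : (g, (1 : Multiplicative ℤ)) * τ1 ^ (Multiplicative.toAdd n) = (g, n) := by
        ext
        · simp [τ1]
        · simp only [τ1, Prod.snd_mul, one_mul, Prod.pow_snd, h6]
      rwa [h7] at h5
    · have : y1 * y1 * y1 = x1 * x1 * x1 * x1 * τ1 := by
        have e : x * x * x * x = y * y * y := by have := S.r0; simpa [pow_succ] using this
        ext
        · simp [x1, y1, τ1, e]
        · simp [x1, y1, τ1]
      rw [this]
      exact P.mul_mem (P.mul_mem (P.mul_mem (P.mul_mem hx1 hx1) hx1) hx1) hτ1
    · rintro ⟨g, n⟩ hp htr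
      obtain ⟨l, hl⟩ := S.scalar (hPfst _ hp) (m := -n.toAdd) (fun v => by
        have := htr v
        rw [hdef] at this
        nth_rw 2 [← this]
        rw [smul_smul, TT]; simp [T_zero])
      have : y1⁻¹ * (g, n) * y1 = (g, n) := by
        ext
        · simp only [y1, Prod.fst_mul, Prod.fst_inv]
          change g = _ at hl
          rw [hl, mul_assoc, ((show Commute (x ^ 4) y from S.zcen y).zpow_left l).eq, inv_mul_cancel_left]
        · simp [y1]
      rwa [this]
  have h1 := A.thmC (κ, 1) (fun v => by rw [hdef, hκ]; simp [T_zero])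
  obtain ⟨l, hl⟩ := S.scalar (hPfst _ h1) (m := 0) (fun v => by rw [T_zero, one_smul]; exact hκ v)
  change κ = _ at hl
  have e1 : x • ((1, 0, 0) : V) = (T 1 : R2) • (1, 0, 0) := by
    rw [S.hx]; simp only [add_zero]
  have e4 := act_zpow e1 (4 * l)
  have e5 : x ^ (4 * l) = κ := by rw [hl, _root_.zpow_mul, zpow_ofNat]
  rw [e5, hκ] at e4
  have := congrArg Prod.fst e4
  simp only [Prod.smul_fst, smul_eq_mul, mul_one] at this
  rw [← T_zero] at this
  have := T_inj this
  have : l = 0 := by omega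
  rw [hl, this, zpow_zero]

end Q
end BB

namespace BB
section Q
set_option linter.unusedSectionVars false
set_option linter.unusedVariables false

def phi (v : V) : Fin 3 → R2 := ![v.1, v.2.1 + v.2.2, v.1 + v.2.1]
def psi (u : Fin 3 → R2) : V := (u 0, u 0 + u 2, u 0 + u 1 + u 2)

lemma psi_phi (v : V) : psi (phi v) = v := by
  have := two0
  simp only [psi, phi, Matrix.cons_val_zero, Matrix.cons_val_one, Matrix.cons_val]
  apply ext3 <;> grind

lemma phi_psi (v : Fin 3 → R2) : phi (psi v) = v := by
  have := two0
  funext i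
  fin_cases i <;> simp [psi, phi] <;> grind

lemma phi_add (v w : V) : phi (v + w) = phi v + phi w := by
  funext i
  fin_cases i <;> simp [phi] <;> grind
lemma psi_add (v w) : psi (v + w) = psi v + psi w := by
  simp only [psi]
  apply ext3 <;> simp <;> grind
lemma phi_smul (a : R2) (v : V) : phi (a • v) = a • phi v := by
  funext i
  fin_cases i <;> simp [phi] <;> grind
lemma psi_smul (a : R2) (v) : psi (a • v) = a • psi v := by
  simp only [psi]
  apply ext3 <;> simp <;> grind
lemma psi_zero : psi 0 = 0 := by
  simp only [psi]
  apply ext3 <;> simp 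
lemma phi_zero : phi 0 = 0 := by
  rw [← psi_zero, phi_psi]

@[reducible] def actM {G : Type*} [Group G] (f : G →* GL (Fin 3) R2) : DistribMulAction G V where
  smul g v := psi ((f g : Matrix (Fin 3) (Fin 3) R2) *ᵥ phi v)
  one_smul v := by
    change psi ((f 1 : Matrix (Fin 3) (Fin 3) R2) *ᵥ phi v) = v
    rw [map_one, Units.val_one, one_mulVec, psi_phi]
  mul_smul g h v := by
    change psi ((f (g * h) : Matrix (Fin 3) (Fin 3) R2) *ᵥ phi v) = psi ((f g : Matrix (Fin 3) (Fin 3) R2) *ᵥ phi (psi ((f h : Matrix (Fin 3) (Fin 3) R2) *ᵥ phi v)))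
    rw [phi_psi, map_mul, Units.val_mul, mulVec_mulVec]
  smul_zero g := by
    change psi ((f g : Matrix (Fin 3) (Fin 3) R2) *ᵥ phi 0) = 0
    rw [phi_zero, mulVec_zero, psi_zero]
  smul_add g v w := by
    change psi ((f g : Matrix (Fin 3) (Fin 3) R2) *ᵥ phi (v + w)) = psi ((f g : Matrix (Fin 3) (Fin 3) R2) *ᵥ phi v) + psi ((f g : Matrix (Fin 3) (Fin 3) R2) *ᵥ phi w)
    rw [phi_add, mulVec_add, psi_add]

lemma X_act (p q r : R2) : psi ((X : Matrix (Fin 3) (Fin 3) R2) *ᵥ phi (p, q, r)) = (T 1 : R2) • ((p + q, q + r, r) : V) := by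
  have := two0
  change psi (Xmat *ᵥ phi (p, q, r)) = _
  rw [Xmat, smul_mulVec, psi_smul]
  congr 1
  simp only [psi, phi]
  apply ext3 <;> simp [Matrix.mulVec, dotProduct, Fin.sum_univ_three] <;> grind

lemma Y_act (p q r : R2) : psi ((Y : Matrix (Fin 3) (Fin 3) R2) *ᵥ phi (p, q, r)) = (T 1 : R2) • ((p + q, q + r, (1 + T 1) * p + q) : V) := by
  have := two0
  change psi (Ymat *ᵥ phi (p, q, r)) = _
  rw [Ymat, smul_mulVec, psi_smul]
  congr 1
  simp only [psi, phi]
  apply ext3 <;> simp [Matrix.mulVec, dotProduct, Fin.sum_univ_three] <;> grind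

lemma actM_comm {G : Type*} [Group G] (f : G →* GL (Fin 3) R2) : letI := actM f; SMulCommClass G R2 V := by
  letI := actM f
  refine ⟨fun g a v => ?_⟩
  change psi ((f g : Matrix (Fin 3) (Fin 3) R2) *ᵥ phi (a • v)) = a • psi ((f g : Matrix (Fin 3) (Fin 3) R2) *ᵥ phi v)
  rw [phi_smul, mulVec_smul, psi_smul]

end Q

section
variable {A : Type*} [CommRing A] (t s : A)

def th : Matrix (Fin 3) (Fin 3) A := !![1+s+t+t^2,0,0; t^2,1,t^2; s,t,1+t+t^2]
def Xg : Matrix (Fin 3) (Fin 3) A := t • !![0,0,1; 1,0,1; 0,1,1]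
def Yg : Matrix (Fin 3) (Fin 3) A := t • !![0,0,1; t,1,1; 0,1,1]
def Wg : Matrix (Fin 3) (Fin 3) A := t ^ 3 • !![t,0,0; t,1+t,t; t,1,0]

variable {t s}
lemma m3 {a b c d e f g h i a' b' c' d' e' f' g' h' i' : A} (h1 : a = a') (h2 : b = b') (h3 : c = c') (h4 : d = d') (h5 : e = e') (h6 : f = f') (h7 : g = g') (h8 : h = h') (h9 : i = i') : 
  !![a,b,c;d,e,f;g,h,i] = !![a',b',c';d',e',f';g',h',i'] := by subst_vars; rfl

lemma s3 {k a b c d e f g h i : A} : 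
  k • !![a,b,c;d,e,f;g,h,i] = !![k*a,k*b,k*c;k*d,k*e,k*f;k*g,k*h,k*i] := by 
  simp [Matrix.smul_of, Matrix.smul_cons]

lemma g1 (h2 : (2 : A) = 0) : Xg t ^ 4 = t ^ 4 • 1 := by
  simp only [Xg, pow_succ, pow_zero, one_mul, Matrix.one_fin_three, s3, Matrix.mul_fin_three]
  apply m3 <;> grind
lemma g2 (h2 : (2 : A) = 0) : Yg t ^ 3 = t ^ 4 • 1 := by
  simp only [Yg, pow_succ, pow_zero, one_mul, Matrix.one_fin_three, s3, Matrix.mul_fin_three]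
  apply m3 <;> grind
lemma g3 (h2 : (2 : A) = 0) : Yg t * Xg t * Yg t = Wg t := by
  simp only [Xg, Yg, Wg, s3, Matrix.mul_fin_three]
  apply m3 <;> grind
lemma g4 (h2 : (2 : A) = 0) (hs : t * s = 1) : th t s * Wg t = Wg t * th t s := by
  simp only [th, Wg, s3, Matrix.mul_fin_three]
  apply m3 <;> grind
lemma g5 (h2 : (2 : A) = 0) (hs : t * s = 1) : Xg t * Wg t * th t s * Xg t = t • (Wg t * Xg t * th t s) := by
  simp only [th, Xg, Wg, s3, Matrix.mul_fin_three]
  apply m3 <;> grind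
lemma g6 (h2 : (2 : A) = 0) : Xg t * Xg t * Wg t = Wg t * (Xg t * Xg t) := by
  simp only [Xg, Wg, s3, Matrix.mul_fin_three]
  apply m3 <;> grind
lemma g7 (h2 : (2 : A) = 0) : (th t s).det = (1 + s + t + t ^ 2) * (1 + t) ^ 3 := by
  rw [th, Matrix.det_fin_three]
  simp
  grind
end

section
variable {Q : Type*} [Group Q] [DistribMulAction Q V] [SMulCommClass Q R2 V]
lemma Ract.rels {w g : Q} (hw : ∀ p q r, w • ((p, q, r) : V) = (T 3 : R2) • (T 1 * p, q + r, T 1 * r)) {a b c}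
    (H : Ract g 0 a b c) : (∀ v : V, (g ^ 4) • v = (1 : Q) • v) ∧ ∀ v : V, (g ^ 2 * w) • v = (w * g ^ 2) • v := by
  have h2 := two0
  obtain ⟨d, H2⟩ : ∃ d, Ract (g ^ 2) 0 0 0 d := by
    refine ⟨_, (H.mul H).congr (pow_two g).symm rfl ?_ ?_ rfl⟩ <;> grind
  constructor
  · rintro ⟨p, q, r⟩
    have H4 := (H2.mul H2) p q r
    rw [← pow_add] at H4
    rw [one_smul, show 4 = 2 + 2 from rfl, H4, add_zero, T_zero, one_smul]
    apply ext3 <;> grind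
  · rintro ⟨p, q, r⟩
    rw [mul_smul _ w, mul_smul w, hw p q r, H2 p q r, smul_comm (g ^ 2) (T 3 : R2), H2, smul_comm w (T 0 : R2), hw,
      smul_smul, smul_smul, TT, TT]
    rw [add_zero, zero_add]
    congr 1
    apply ext3 <;> grind
end

section
variable {M : Type*} [Group M]

lemma xseq_eq (x y : M) (j : ℕ) : xseq x y j = ys x (y * x * y) j := by
  induction j with
  | zero => rfl
  | succ j ih => rw [xseq, ys, ih]

lemma map_xseq {H : Type*} [Group H] (f : M →* H) (x y : M) (j : ℕ) : f (xseq x y j) = xseq (f x) (f y) j := by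
  rw [xseq_eq, xseq_eq, map_ys, map_mul, map_mul]

lemma Xg_eq : (X : Matrix (Fin 3) (Fin 3) R2) = Xg (T 1 : R2) := rfl
lemma Yg_eq : (Y : Matrix (Fin 3) (Fin 3) R2) = Yg (T 1 : R2) := rfl
lemma Wg_eq : ((Y * X * Y : GL (Fin 3) R2) : Matrix (Fin 3) (Fin 3) R2) = Wg (T 1 : R2) := by
  rw [Units.val_mul, Units.val_mul, Xg_eq, Yg_eq, g3 two0]

lemma X4v : ((X ^ 4 : GL (Fin 3) R2) : Matrix (Fin 3) (Fin 3) R2) = (T 1 : R2) ^ 4 • 1 := by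
  rw [Units.val_pow_eq_pow_val, Xg_eq, g1 two0]

lemma X4 : X ^ 4 = Y ^ 3 := by
  apply Units.ext
  rw [X4v, Units.val_pow_eq_pow_val, Yg_eq, g2 two0]

lemma XXW : X * X * (Y * X * Y) = Y * X * Y * (X * X) := by
  apply Units.ext
  rw [Units.val_mul, Units.val_mul (Y * X * Y), Wg_eq, Units.val_mul, Xg_eq, g6 two0]

lemma faith {g h : GL (Fin 3) R2} (e : ∀ v, psi ((g : Matrix (Fin 3) (Fin 3) R2) *ᵥ phi v) = psi ((h : Matrix (Fin 3) (Fin 3) R2) *ᵥ phi v)) : g = h := by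
  apply Units.ext
  apply Matrix.ext_of_mulVec_single
  intro i
  have := congrArg phi (e (psi (Pi.single i 1)))
  rwa [phi_psi, phi_psi, phi_psi] at this

lemma XrelsV (j : ℕ) : xseq X Y (j + 1) ^ 4 = 1 ∧ xseq X Y (j + 1) ^ 2 * (Y * X * Y) = Y * X * Y * xseq X Y (j + 1) ^ 2 := by
  let _ := actM (MonoidHom.id (GL (Fin 3) R2))
  have : SMulCommClass (GL (Fin 3) R2) R2 V := actM_comm _
  have h2 := two0
  have hw : ∀ p q r, (Y * X * Y) • ((p, q, r) : V) = (T 3 : R2) • (T 1 * p, q + r, T 1 * r) := by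
    intro p q r
    rw [mul_smul, mul_smul, show Y • ((p, q, r) : V) = _ from Y_act p q r, smul_comm X (T 1 : R2),
      show X • ((p + q, q + r, (1 + T 1) * p + q) : V) = _ from X_act _ _ _, smul_smul, TT, smul_comm Y (T (1 + 1) : R2),
      show Y • ((_, _, _) : V) = _ from Y_act _ _ _, smul_smul, TT]
    rw [show (1 + 1 + 1 : ℤ) = 3 by norm_num]
    congr 1
    apply ext3 <;> grind
  have hx : Ract X 1 1 1 0 := by
    intro p q r
    rw [show X • ((p, q, r) : V) = _ from X_act _ _ _]
    congr 1
    apply ext3 <;> grind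
  have key : ∀ j : ℕ, ∃ n a b c, Ract (xseq X Y j) n a b c := by
    intro j
    induction j with
    | zero => exact ⟨_, _, _, _, hx⟩
    | succ j ih =>
      obtain ⟨n, a, b, c, h⟩ := ih
      obtain ⟨c', h'⟩ := RconjA hw h.inv
      exact ⟨_, _, _, _, h'.mul h⟩
  obtain ⟨n, a, b, c, h⟩ := key j
  obtain ⟨c', h'⟩ := RconjA hw h.inv
  have H := h'.mul h
  change Ract (xseq X Y (j + 1)) _ _ _ _ at H
  generalize xseq X Y (j + 1) = g at *
  rw [neg_add_cancel] at H
  obtain ⟨e1, e2⟩ := Ract.rels hw H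
  exact ⟨faith e1, faith e2⟩

end
end BB

namespace BB
section

abbrev KK := FractionRing R2

def iot : GL (Fin 3) R2 →* GL (Fin 3) KK := GeneralLinearGroup.map (algebraMap R2 KK)

lemma iot_val (g : GL (Fin 3) R2) : (iot g : Matrix (Fin 3) (Fin 3) KK) = (g : Matrix (Fin 3) (Fin 3) R2).map (algebraMap R2 KK) := rfl

lemma iot_inj : Function.Injective iot := by
  intro g h e
  have := congrArg Units.val e
  rw [iot_val, iot_val] at this
  exact Units.ext (Matrix.map_injective (IsFractionRing.injective R2 KK) this)

lemma th_det : ((th (T 1 : R2) (T (-1))).map (algebraMap R2 KK)).det ≠ 0 := by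
  have h2 := two0
  have hT : (T 1 : R2) * T (-1) = 1 := T_inv 1
  have e : ((th (T 1 : R2) (T (-1))).map (algebraMap R2 KK)).det = algebraMap R2 KK (th (T 1 : R2) (T (-1))).det := by
    rw [RingHom.map_det]; rfl
  rw [e, g7 two0, show (1 + T (-1) + T 1 + T 1 ^ 2 : R2) = T (-1) * (1 + T 1) ^ 3 by grind]
  rw [Ne, IsFractionRing.to_map_eq_zero_iff]
  have h1 : (T (-1) : R2) ≠ 0 := fun h => by rw [h, mul_zero] at hT; exact zero_ne_one hT
  exact mul_ne_zero (mul_ne_zero h1 (pow_ne_zero _ lam_ne)) (pow_ne_zero _ lam_ne)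

def Tht : GL (Fin 3) KK := GeneralLinearGroup.mkOfDetNeZero _ th_det

lemma Tht_val : (Tht : Matrix (Fin 3) (Fin 3) KK) = (th (T 1 : R2) (T (-1))).map (algebraMap R2 KK) := rfl

lemma br_one {G : Type*} [Group G] {a b : G} : br a b = 1 ↔ a * b = b * a := by
  rw [br]
  constructor
  · intro h
    calc a * b = b * a * (a⁻¹ * b⁻¹ * a * b) := by group
      _ = _ := by rw [h, mul_one]
  · intro h
    rw [mul_assoc, h]; group

lemma map_br {G H : Type*} [Group G] [Group H] (f : G →* H) (a b : G) : f (br a b) = br (f a) (f b) := by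
  simp only [br, map_mul, map_inv]

lemma Tht_W : Tht * iot (Y * X * Y) = iot (Y * X * Y) * Tht := by
  apply Units.ext
  rw [Units.val_mul, Units.val_mul, Tht_val, iot_val, ← Matrix.map_mul, ← Matrix.map_mul, Wg_eq, g4 two0 (T_inv 1)]

lemma Tht_X4 : Tht * iot (X ^ 4) = iot (X ^ 4) * Tht := by
  apply Units.ext
  rw [Units.val_mul, Units.val_mul, Tht_val, iot_val, ← Matrix.map_mul, ← Matrix.map_mul, X4v]
  rw [Matrix.mul_smul, Matrix.smul_mul, mul_one, one_mul]

/-- scalar `t` -/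
def sct : GL (Fin 3) R2 := ⟨(T 1 : R2) • 1, (T (-1) : R2) • 1, by
    rw [Matrix.smul_mul, Matrix.mul_smul, smul_smul, T_inv, one_smul, one_mul], by
    rw [Matrix.smul_mul, Matrix.mul_smul, smul_smul, T_inv', one_smul, one_mul]⟩

lemma sct_val : (sct : Matrix (Fin 3) (Fin 3) R2) = (T 1 : R2) • 1 := rfl

lemma sct_cen (g : GL (Fin 3) R2) : sct * g = g * sct := by
  apply Units.ext
  rw [Units.val_mul, Units.val_mul, sct_val, Matrix.smul_mul, Matrix.mul_smul, one_mul, mul_one]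

lemma Tht_X : iot X * iot (Y * X * Y) * Tht * iot X = iot sct * (iot (Y * X * Y) * iot X * Tht) := by
  apply Units.ext
  simp only [Units.val_mul _ Tht, Units.val_mul _ (iot X), Units.val_mul (iot sct), Units.val_mul _ (iot (Y * X * Y)), Tht_val, iot_val, ← Matrix.map_mul, Wg_eq, Xg_eq, sct_val]
  rw [g5 two0 (T_inv 1), Matrix.smul_mul, one_mul]

lemma Tht_X1 : Tht * iot X * Tht⁻¹ = iot sct * iot (xseq X Y 1) := by
  have h := Tht_X
  have hc : ∀ g, iot sct * iot g = iot g * iot sct := fun g => by rw [← map_mul, sct_cen, map_mul]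
  have e : iot (xseq X Y 1) = (iot (Y * X * Y))⁻¹ * (iot X)⁻¹ * iot (Y * X * Y) * iot X := by
    simp only [xseq, br, map_mul, map_inv]
  rw [e]
  have hcx := hc X
  have hcw := hc (Y * X * Y)
  generalize iot (Y * X * Y) = W at *
  generalize iot X = x at *
  generalize iot sct = c at *
  generalize Tht = θ at *
  have h' : θ * x = W⁻¹ * x⁻¹ * (x * W * θ * x) := by group
  rw [h', h]
  have c1 : Commute c W := hcw
  have c2 : Commute c x := hcx
  have c3 : W⁻¹ * x⁻¹ * c = c * (W⁻¹ * x⁻¹) := ((c1.inv_right.mul_right c2.inv_right).symm).eq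
  calc W⁻¹ * x⁻¹ * (c * (W * x * θ)) * θ⁻¹ = (W⁻¹ * x⁻¹ * c) * W * x := by group
    _ = _ := by rw [c3]; group

lemma Tht_xs (j : ℕ) : Tht * iot (xseq X Y (j + 1)) * Tht⁻¹ = iot (xseq X Y (j + 2)) := by
  have hbr : ∀ g, Tht * iot (br (Y * X * Y) g) * Tht⁻¹ = br (iot (Y * X * Y)) (Tht * iot g * Tht⁻¹) := by
    intro g
    have hW : Tht * iot (Y * X * Y) * Tht⁻¹ = iot (Y * X * Y) := by rw [Tht_W, mul_inv_cancel_right]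
    calc Tht * iot (br (Y * X * Y) g) * Tht⁻¹ = br (Tht * iot (Y * X * Y) * Tht⁻¹) (Tht * iot g * Tht⁻¹) := by
          rw [map_br, br, br]; group
      _ = _ := by rw [hW]
  induction j with
  | zero =>
    change Tht * iot (br (Y * X * Y) X) * Tht⁻¹ = iot (br (Y * X * Y) (xseq X Y 1))
    rw [hbr, Tht_X1]
    have hc : ∀ g, Commute (iot sct) (iot g) := fun g => by rw [Commute, SemiconjBy, ← map_mul, sct_cen, map_mul]
    rw [map_br, br, br]
    have c1 := hc (Y * X * Y)
    have c2 := hc (xseq X Y 1)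
    generalize iot (Y * X * Y) = W at *
    generalize iot (xseq X Y 1) = x at *
    generalize iot sct = c at *
    have c3 : W⁻¹ * x⁻¹ * c⁻¹ * W = W⁻¹ * x⁻¹ * W * c⁻¹ := by
      rw [mul_assoc, c1.inv_left.eq]; group
    calc W⁻¹ * (c * x)⁻¹ * W * (c * x) = (W⁻¹ * x⁻¹ * c⁻¹ * W) * c * x := by group
      _ = _ := by rw [c3]; group
  | succ j ih =>
    change Tht * iot (br (Y * X * Y) (xseq X Y (j + 1))) * Tht⁻¹ = iot (br (Y * X * Y) (xseq X Y (j + 2)))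
    rw [hbr, ih]
    rw [map_br]

def genK : Fin 3 → GL (Fin 3) KK := ![iot X, iot Y, Tht]

lemma relsK (i : ℕ) (hi : 1 ≤ i) : ∀ r ∈ GtiRels i, FreeGroup.lift genK r = 1 := by
  have e0 : FreeGroup.lift genK gx = iot X := by rw [gx, FreeGroup.lift_apply_of]; rfl
  have e1 : FreeGroup.lift genK gy = iot Y := by rw [gy, FreeGroup.lift_apply_of]; rfl
  have e2 : FreeGroup.lift genK gT = Tht := by rw [gT, FreeGroup.lift_apply_of]; rfl
  have ex : ∀ j, FreeGroup.lift genK (xseq gx gy j) = iot (xseq X Y j) := by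
    intro j; rw [map_xseq, map_xseq, e0, e1]
  obtain ⟨i, rfl⟩ := Nat.exists_eq_add_of_le' hi
  have ew : FreeGroup.lift genK (gy * gx * gy) = iot (Y * X * Y) := by
    rw [map_mul, map_mul, e0, e1, map_mul, map_mul]
  rintro r ((hr | ⟨j, h1, h2, rfl⟩) | ⟨j, h1, h2, rfl⟩)
  · rcases hr with rfl | rfl | rfl | rfl | rfl
    · rw [map_mul, map_inv, map_pow, map_pow, e0, e1, ← map_pow, ← map_pow, X4, mul_inv_cancel]
    · rw [map_br, ew, map_pow, e0, br_one, ← map_pow, ← map_mul, ← map_mul, pow_two, XXW]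
    · rw [map_br, ew, e2, br_one, Tht_W]
    · rw [map_br, map_pow, e0, ← map_pow, e2, br_one, Tht_X4]
    · rw [map_mul, map_inv, map_mul, map_mul, map_inv, map_br, ew, e2, ex, Tht_xs, ← map_br]
      exact mul_inv_cancel _
  · obtain ⟨j, rfl⟩ := Nat.exists_eq_add_of_le' h1
    rw [map_pow, ex, ← map_pow, (XrelsV j).1, map_one]
  · obtain ⟨j, rfl⟩ := Nat.exists_eq_add_of_le' h1
    rw [map_br, ew, map_pow, ex, ← map_pow, br_one, ← map_mul, (XrelsV j).2, map_mul]

end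

section
variable (i : ℕ)

lemma Hrel {r : FreeGroup (Fin 3)} (hr : r ∈ GtiRels i) : PresentedGroup.mk (GtiRels i) r = 1 :=
  PresentedGroup.one_of_mem hr

abbrev hx : PresentedGroup (GtiRels i) := PresentedGroup.of 0
abbrev hy : PresentedGroup (GtiRels i) := PresentedGroup.of 1
abbrev ht : PresentedGroup (GtiRels i) := PresentedGroup.of 2

lemma mk_xs (j : ℕ) : PresentedGroup.mk (GtiRels i) (xseq gx gy j) = xseq (hx i) (hy i) j := map_xseq _ _ _ _

lemma mk_w : PresentedGroup.mk (GtiRels i) (gy * gx * gy) = hy i * hx i * hy i := rfl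

lemma hr0 : hx i ^ 4 = hy i ^ 3 := by
  have := Hrel i (Or.inl (Or.inl (Or.inl rfl)))
  rw [map_mul, map_inv, mul_inv_eq_one] at this
  exact this

lemma hsw : hx i * hx i * (hy i * hx i * hy i) = hy i * hx i * hy i * (hx i * hx i) := by
  have := Hrel i (Or.inl (Or.inl (Or.inr (Or.inl rfl))))
  rw [map_br, br_one, pow_two] at this
  exact this

lemma htw : ht i * (hy i * hx i * hy i) = hy i * hx i * hy i * ht i := by
  have := Hrel i (Or.inl (Or.inl (Or.inr (Or.inr (Or.inl rfl)))))
  rw [map_br, br_one] at this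
  exact this

lemma htx : ht i * xseq (hx i) (hy i) i * (ht i)⁻¹ = xseq (hx i) (hy i) (i + 1) := by
  have := Hrel i (Or.inl (Or.inl (Or.inr (Or.inr (Or.inr (Or.inr rfl))))))
  rw [map_mul, map_inv, mul_inv_eq_one, map_mul, map_inv, map_br, mk_w, map_mul, mk_xs] at this
  exact this

lemma hrels (hi : 1 ≤ i) (j : ℕ) : xseq (hx i) (hy i) (j + 1) ^ 4 = 1 ∧
    xseq (hx i) (hy i) (j + 1) ^ 2 * (hy i * hx i * hy i) = hy i * hx i * hy i * xseq (hx i) (hy i) (j + 1) ^ 2 := by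
  by_cases h : j + 1 ≤ i
  · have h1 := Hrel i (Or.inl (Or.inr ⟨j + 1, by omega, h, rfl⟩))
    have h2 := Hrel i (Or.inr ⟨j + 1, by omega, h, rfl⟩)
    rw [map_pow, mk_xs] at h1
    rw [map_br, br_one, map_pow, mk_xs, mk_w] at h2
    exact ⟨h1, h2⟩
  · have sh : ∀ m, ht i * xseq (hx i) (hy i) (i + m) * (ht i)⁻¹ = xseq (hx i) (hy i) (i + m + 1) := by
      intro m
      induction m with
      | zero => exact htx i
      | succ m ih =>
        have hw := htw i
        rw [← add_assoc]
        change ht i * br (hy i * hx i * hy i) (xseq (hx i) (hy i) (i + m)) * (ht i)⁻¹ = br (hy i * hx i * hy i) (xseq (hx i) (hy i) (i + m + 1))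
        rw [← ih]
        generalize hy i * hx i * hy i = w at *
        generalize ht i = t at *
        have hw' : t * w * t⁻¹ = w := by rw [hw, mul_inv_cancel_right]
        rw [br, br]
        nth_rw 3 4 [← hw']
        group
    have key : ∀ m, xseq (hx i) (hy i) (i + m) ^ 4 = 1 ∧
      xseq (hx i) (hy i) (i + m) ^ 2 * (hy i * hx i * hy i) = hy i * hx i * hy i * xseq (hx i) (hy i) (i + m) ^ 2 := by
      intro m
      induction m with
      | zero =>
        have h1 := Hrel i (Or.inl (Or.inr ⟨i, hi, le_rfl, rfl⟩))
        have h2 := Hrel i (Or.inr ⟨i, hi, le_rfl, rfl⟩)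
        rw [map_pow, mk_xs] at h1
        rw [map_br, br_one, map_pow, mk_xs, mk_w] at h2
        exact ⟨h1, h2⟩
      | succ m ih =>
        have hw := htw i
        rw [← add_assoc, ← sh m, conj_pow, conj_pow]
        obtain ⟨e1, e2⟩ := ih
        rw [e1]
        refine ⟨by group, ?_⟩
        generalize hy i * hx i * hy i = w at *
        generalize ht i = t at *
        have c1 : Commute w t := hw.symm
        exact ((c1.mul_right (show Commute w _ from e2.symm)).mul_right c1.inv_right).symm.eq
    obtain ⟨m, hm⟩ := Nat.exists_eq_add_of_le (show i ≤ j + 1 by omega)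
    rw [hm]
    exact key m

end
end BB

namespace BB
section
set_option linter.unusedVariables false

def GG (i : ℕ) : Subgroup (PresentedGroup (GtiRels i) × GL (Fin 3) R2) := Subgroup.closure {(hx i, X), (hy i, Y)}

lemma memX (i : ℕ) : (hx i, X) ∈ GG i := Subgroup.subset_closure (by simp)
lemma memY (i : ℕ) : (hy i, Y) ∈ GG i := Subgroup.subset_closure (by simp)

def f2 (i : ℕ) : GG i →* GL (Fin 3) R2 := (MonoidHom.snd _ _).comp (GG i).subtype
def f1 (i : ℕ) : GG i →* PresentedGroup (GtiRels i) := (MonoidHom.fst _ _).comp (GG i).subtype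

lemma GG_ext {i : ℕ} {a b : GG i} (h1 : f1 i a = f1 i b) (h2 : f2 i a = f2 i b) : a = b :=
  Subtype.ext (Prod.ext h1 h2)

lemma f2_inj (i : ℕ) (hi : 1 ≤ i) : Function.Injective (f2 i) := by
  let _ := actM (f2 i)
  have : SMulCommClass (GG i) R2 V := actM_comm _
  let x : GG i := ⟨_, memX i⟩
  let y : GG i := ⟨_, memY i⟩
  have x1 : f1 i x = hx i := rfl
  have x2 : f2 i x = X := rfl
  have y1 : f1 i y = hy i := rfl
  have y2 : f2 i y = Y := rfl
  have A : MA x y := by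
    refine ⟨X_act, Y_act, ?_, ?_, ?_, ?_, ?_⟩
    · have h := Subgroup.closure_closure_coe_preimage (k := {(hx i, X), (hy i, Y)})
      change Subgroup.closure (Subtype.val ⁻¹' _ : Set (GG i)) = ⊤ at h
      rw [← h]
      congr 1
      ext ⟨z, hz⟩
      simp [x, y]
    · apply GG_ext
      · rw [map_pow, map_pow, x1, y1, hr0]
      · rw [map_pow, map_pow, x2, y2, X4]
    · apply GG_ext
      · simp only [map_mul, x1, y1, hsw]
      · simp only [map_mul, x2, y2, XXW]
    · intro j
      rw [← xseq_eq]
      apply GG_ext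
      · rw [map_pow, map_xseq, x1, y1, (hrels i hi j).1, map_one]
      · rw [map_pow, map_xseq, x2, y2, (XrelsV j).1, map_one]
    · intro j
      rw [← xseq_eq]
      apply GG_ext
      · simp only [map_mul, map_pow, map_xseq, x1, y1, (hrels i hi j).2]
      · simp only [map_mul, map_pow, map_xseq, x2, y2, (XrelsV j).2]
  rw [injective_iff_map_eq_one]
  intro κ hκ
  apply A.main
  intro v
  change psi ((f2 i κ : Matrix (Fin 3) (Fin 3) R2) *ᵥ phi v) = v
  rw [hκ, Units.val_one, one_mulVec, psi_phi]

lemma compat (i : ℕ) (hi : 1 ≤ i) (g : GG i) : PresentedGroup.toGroup (relsK i hi) (f1 i g) = iot (f2 i g) := by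
  obtain ⟨g, hg⟩ := g
  have : GG i ≤ ((PresentedGroup.toGroup (relsK i hi)).comp (MonoidHom.fst _ _)).eqLocus (iot.comp (MonoidHom.snd _ _)) := by
    rw [GG, Subgroup.closure_le]
    rintro _ (rfl | rfl)
    · exact PresentedGroup.toGroup.of (relsK i hi)
    · exact PresentedGroup.toGroup.of (relsK i hi)
  exact this hg

lemma B_le (i : ℕ) : B42 ≤ (f2 i).range := by
  rw [Subgroup.closure_le]
  rintro _ (rfl | rfl)
  · exact ⟨⟨_, memX i⟩, rfl⟩
  · exact ⟨⟨_, memY i⟩, rfl⟩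

theorem final (i : ℕ) (hi : 1 ≤ i) :
    ∃ εi : B42 →* PresentedGroup (GtiRels i),
      Function.Injective εi ∧
        εi ⟨X, Subgroup.subset_closure (Set.mem_insert _ _)⟩ = PresentedGroup.of 0 ∧
        εi ⟨Y, Subgroup.subset_closure (Set.mem_insert_of_mem _ rfl)⟩ =
          PresentedGroup.of 1 := by
  let e := MonoidHom.ofInjective (f2_inj i hi)
  let σ : B42 →* GG i := e.symm.toMonoidHom.comp (Subgroup.inclusion (B_le i))
  have hσ : ∀ b : B42, f2 i (σ b) = b := by
    intro b
    have : e (σ b) = Subgroup.inclusion (B_le i) b := e.apply_symm_apply _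
    exact congrArg Subtype.val this
  refine ⟨(f1 i).comp σ, ?_, ?_, ?_⟩
  · intro a b hab
    have hab : f1 i (σ a) = f1 i (σ b) := hab
    have := congrArg (PresentedGroup.toGroup (relsK i hi)) hab
    rw [compat i hi, compat i hi, hσ, hσ] at this
    exact Subtype.ext (iot_inj this)
  · have : σ ⟨X, Subgroup.subset_closure (Set.mem_insert _ _)⟩ = ⟨_, memX i⟩ := by
      apply f2_inj i hi
      rw [hσ]; rfl
    rw [MonoidHom.comp_apply, this]; rfl
  · have : σ ⟨Y, Subgroup.subset_closure (Set.mem_insert_of_mem _ rfl)⟩ = ⟨_, memY i⟩ := by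
      apply f2_inj i hi
      rw [hσ]; rfl
    rw [MonoidHom.comp_apply, this]; rfl

end
end BB

/-- **Lemma 3.1.** For each `i ≥ 1` there is an injective homomorphism
`ε̃_i : B_{4,2} → G̃_i` with `ε̃_i(X) = x` and `ε̃_i(Y) = y`. -/
theorem statement7 (i : ℕ) (hi : 1 ≤ i) :
    ∃ εi : B42 →* PresentedGroup (GtiRels i),
      Function.Injective εi ∧
        εi ⟨X, Subgroup.subset_closure (Set.mem_insert _ _)⟩ = PresentedGroup.of 0 ∧
        εi ⟨Y, Subgroup.subset_closure (Set.mem_insert_of_mem _ rfl)⟩ =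
          PresentedGroup.of 1 := by
  exact BB.final i hi
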